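/- Let q ∈ ℂ* be transcendental and let G be a connected simply connected complex semisimple algebraic group. Then the quantised coordinate ring O_q(G) is a maximal order in its division ring of fractions. -/

import Mathlib

open scoped TensorProduct

/-- The `q`-factorial `(q - q⁻¹)(q² - q⁻²)⋯(qᵐ - q⁻ᵐ)`. -/
noncomputable def qfac (t : ℂ) (m : ℕ) : ℂ :=
  ∏ j ∈ Finset.range m, (t ^ (j + 1) - t⁻¹ ^ (j + 1))

/-- The `q`-binomial coefficient `[m k]` at parameter `t`. -/
noncomputable def qbinom (t : ℂ) (m k : ℕ) : ℂ :=
  qfac t m / (qfac t k * qfac t (m - k))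

/-- The defining relations of the quantised enveloping algebra `U_q(𝔤)` associated to a
Cartan matrix `a` with symmetrising integers `d`, on elements `E i`, `F i`, `K i` of a
`ℂ`-algebra `B`: the `K i` are commuting units, conjugation by `K i` rescales `E j` and
`F j` by `q_i^{±a i j}` (where `q_i = q^{d i}`), the commutator `[E i, F j]` is
`δ_{ij} (K_i - K_i⁻¹)/(q_i - q_i⁻¹)`, and the quantum Serre relations hold. -/
def UqRels (q : ℂ) {n : ℕ} (a : Fin n → Fin n → ℤ) (d : Fin n → ℕ)
    (B : Type) [Ring B] [Algebra ℂ B] (E F : Fin n → B) (K : Fin n → Bˣ) : Prop :=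
  (∀ i j, (K i : B) * (K j : B) = (K j : B) * (K i : B)) ∧
  (∀ i j, (K i : B) * E j = (q ^ ((d i : ℤ) * a i j)) • (E j * (K i : B))) ∧
  (∀ i j, (K i : B) * F j = (q ^ (-((d i : ℤ) * a i j))) • (F j * (K i : B))) ∧
  (∀ i j, E i * F j - F j * E i =
    if i = j then (q ^ (d i : ℤ) - q ^ (-(d i : ℤ)))⁻¹ • ((K i : B) - (((K i)⁻¹ : Bˣ) : B))
    else 0) ∧
  (∀ i j, i ≠ j → ∑ k ∈ Finset.range ((1 - a i j).toNat + 1),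
      ((-1 : ℂ) ^ k * qbinom (q ^ (d i : ℤ)) ((1 - a i j).toNat) k) •
        (E i ^ ((1 - a i j).toNat - k) * E j * E i ^ k) = 0) ∧
  (∀ i j, i ≠ j → ∑ k ∈ Finset.range ((1 - a i j).toNat + 1),
      ((-1 : ℂ) ^ k * qbinom (q ^ (d i : ℤ)) ((1 - a i j).toNat) k) •
        (F i ^ ((1 - a i j).toNat - k) * F j * F i ^ k) = 0)

/-- The weight space of weight `μ = ∑ μ i ϖ i` in a `U_q(𝔤)`-module: the set of vectors on
which each `K i` acts by the scalar `q^{(μ, α_i)} = q^{μ i * d i}`. -/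
noncomputable def wtSp (q : ℂ) {n : ℕ} (d : Fin n → ℕ)
    {U : Type} [Ring U] [Algebra ℂ U] (K : Fin n → Uˣ)
    {Vc : Type} [AddCommGroup Vc] [Module ℂ Vc] (ρ : U →ₐ[ℂ] Module.End ℂ Vc)
    (μ : Fin n → ℤ) : Submodule ℂ Vc :=
  ⨅ i : Fin n, LinearMap.ker (ρ (K i : U) - (q ^ (μ i * (d i : ℤ))) • (1 : Module.End ℂ Vc))

/-- `ξ` is a dual vector of weight `μ`:  equivalently (via the antipode-twisted action on the
dual module), `ξ` vanishes on every weight space of weight `ν ≠ -μ`. -/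
noncomputable def inDualWt (q : ℂ) {n : ℕ} (d : Fin n → ℕ)
    {U : Type} [Ring U] [Algebra ℂ U] (K : Fin n → Uˣ)
    {Vc : Type} [AddCommGroup Vc] [Module ℂ Vc] (ρ : U →ₐ[ℂ] Module.End ℂ Vc)
    (μ : Fin n → ℤ) (ξ : Module.Dual ℂ Vc) : Prop :=
  ∀ ν : Fin n → ℤ, ν ≠ -μ → ∀ x ∈ wtSp q d K ρ ν, ξ x = 0

/-- The Demazure-type submodule generated by the weight space of weight `ν` under the
subalgebra of `U` generated by `gens` (take `gens = Set.range E` for `V⁺_w(λ)` with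
`ν = wλ`, and `gens = Set.range F` for `V⁻_w(λ)`). -/
noncomputable def demazure (q : ℂ) {n : ℕ} (d : Fin n → ℕ)
    {U : Type} [Ring U] [Algebra ℂ U] (gens : Set U) (K : Fin n → Uˣ)
    {Vc : Type} [AddCommGroup Vc] [Module ℂ Vc] (ρ : U →ₐ[ℂ] Module.End ℂ Vc)
    (ν : Fin n → ℤ) : Submodule ℂ Vc :=
  Submodule.span ℂ
    {x | ∃ y ∈ Algebra.adjoin ℂ gens, ∃ u ∈ wtSp q d K ρ ν, x = ρ y u}

/-- A two-sided ideal of a (possibly noncommutative) ring is prime if it is proper and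
`x R y ⊆ P` implies `x ∈ P` or `y ∈ P`. -/
def IsPrimeTwoSided {R : Type*} [Ring R] (P : TwoSidedIdeal R) : Prop :=
  P ≠ ⊤ ∧ ∀ x y : R, (∀ r : R, x * r * y ∈ P) → x ∈ P ∨ y ∈ P

/-- An element `r` of a ring is normal if `rR = Rr`. -/
def IsNormalElem {R : Type*} [Ring R] (r : R) : Prop :=
  (∀ x, ∃ y, r * x = y * r) ∧ ∀ x, ∃ y, x * r = r * y

/-- The ideal `Q⁺_{w}` of `O_q(G)`: generated by the coordinate functions `c^{ϖ_j}_{ξ,v}` with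
`v` a highest weight vector of `V(ϖ_j)` and `ξ` orthogonal to the Demazure module
`V⁺_w(ϖ_j)`. -/
noncomputable def Qplus (q : ℂ) {n : ℕ} (d : Fin n → ℕ)
    {U : Type} [Ring U] [Algebra ℂ U] (E : Fin n → U) (K : Fin n → Uˣ)
    {V : (Fin n → ℕ) → Type} [∀ c, AddCommGroup (V c)] [∀ c, Module ℂ (V c)]
    (ρ : ∀ c, U →ₐ[ℂ] Module.End ℂ (V c))
    {W : Type} [Group W] (σ : W →* Multiplicative (AddAut (Fin n → ℤ)))
    {A : Type} [Ring A]
    (cf : ∀ c : Fin n → ℕ, Module.Dual ℂ (V c) → V c → A)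
    (w : W) : TwoSidedIdeal A :=
  TwoSidedIdeal.span
    {x | ∃ j : Fin n, ∃ ξ : Module.Dual ℂ (V (Pi.single j 1)),
      ∃ v ∈ wtSp q d K (ρ (Pi.single j 1)) (fun k => ((Pi.single j 1 : Fin n → ℕ) k : ℤ)),
        (∀ y ∈ demazure q d (Set.range E) K (ρ (Pi.single j 1))
            (σ w (fun k => ((Pi.single j 1 : Fin n → ℕ) k : ℤ))), ξ y = 0) ∧
        x = cf (Pi.single j 1) ξ v}

/-- The ideal `Q⁻_{w}` of `O_q(G)`: generated by the coordinate functions `c^{ϖ_j}_{ξ,v}` with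
`v` a lowest weight vector of `V(ϖ_j)` and `ξ` orthogonal to the Demazure module
`V⁻_{w w₀}(ϖ_j)`. -/
noncomputable def Qminus (q : ℂ) {n : ℕ} (d : Fin n → ℕ)
    {U : Type} [Ring U] [Algebra ℂ U] (F : Fin n → U) (K : Fin n → Uˣ)
    {V : (Fin n → ℕ) → Type} [∀ c, AddCommGroup (V c)] [∀ c, Module ℂ (V c)]
    (ρ : ∀ c, U →ₐ[ℂ] Module.End ℂ (V c))
    {W : Type} [Group W] (σ : W →* Multiplicative (AddAut (Fin n → ℤ))) (w₀ : W)
    {A : Type} [Ring A]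
    (cf : ∀ c : Fin n → ℕ, Module.Dual ℂ (V c) → V c → A)
    (w : W) : TwoSidedIdeal A :=
  TwoSidedIdeal.span
    {x | ∃ j : Fin n, ∃ ξ : Module.Dual ℂ (V (Pi.single j 1)),
      ∃ v ∈ wtSp q d K (ρ (Pi.single j 1)) (σ w₀ (fun k => ((Pi.single j 1 : Fin n → ℕ) k : ℤ))),
        (∀ y ∈ demazure q d (Set.range F) K (ρ (Pi.single j 1))
            (σ (w * w₀) (fun k => ((Pi.single j 1 : Fin n → ℕ) k : ℤ))), ξ y = 0) ∧
        x = cf (Pi.single j 1) ξ v}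



theorem mo_euclid {D : Type} [DivisionRing D] (R P A : Subring D) (hAP : A ≤ P) (hAR : A ≤ R)
    (deg : D → ℕ)
    (hmul : ∀ x ∈ P, ∀ y ∈ P, x ≠ 0 → y ≠ 0 → deg (x * y) = deg x + deg y)
    (hunit : ∀ x ∈ P, x ≠ 0 → deg x = 0 → x⁻¹ ∈ P)
    (hr : ∀ p ∈ P, ∀ h ∈ P, p ≠ 0 → h ≠ 0 → deg h ≤ deg p →
      ∃ r ∈ P, p - h * r = 0 ∨ deg (p - h * r) < deg p)
    (hl : ∀ p ∈ P, ∀ h ∈ P, p ≠ 0 → h ≠ 0 → deg h ≤ deg p →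
      ∃ r ∈ P, p - r * h = 0 ∨ deg (p - r * h) < deg p)
    (hden : ∀ p ∈ P, ∃ c ∈ A, c ≠ 0 ∧ c⁻¹ ∈ P ∧ c * p ∈ A)
    (hfr : ∀ x : D, ∃ a ∈ A, ∃ b ∈ A, b ≠ 0 ∧ x = a * b⁻¹)
    (hfl : ∀ x : D, ∃ a ∈ A, ∃ b ∈ A, b ≠ 0 ∧ x = b⁻¹ * a)
    (a b : D) (ha : a ≠ 0) (hb : b ≠ 0) (hab : ∀ x ∈ R, a * x * b ∈ A) : R ≤ P := by
  -- reduce to `a, b ∈ A`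
  obtain ⟨a₁, ha₁, s, hs, hs0, haa⟩ := hfl a
  obtain ⟨b₁, hb₁, r, hr₁, hr0, hbb⟩ := hfr b
  have ha₁0 : a₁ ≠ 0 := by rintro rfl; simp at haa; exact ha haa
  have hb₁0 : b₁ ≠ 0 := by rintro rfl; simp at hbb; exact hb hbb
  have hab₁ : ∀ x ∈ R, a₁ * x * b₁ ∈ A := by
    intro x hx
    have h1 := A.mul_mem (A.mul_mem hs (hab x hx)) hr₁
    have : s * (a * x * b) * r = a₁ * x * b₁ := by
      rw [haa, hbb]
      simp only [mul_assoc]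
      rw [mul_inv_cancel_left₀ hs0, inv_mul_cancel₀ hr0, mul_one]
    rwa [this] at h1
  have hdeg1 : deg 1 = 0 := by
    have := hmul 1 P.one_mem 1 P.one_mem one_ne_zero one_ne_zero
    simp at this; exact this
  -- the set N
  let N : Set D := {z | ∀ x ∈ R, a₁ * x * z ∈ P}
  have hNb : b₁ ∈ N := fun x hx => hAP (hab₁ x hx)
  have hNR : ∀ x ∈ R, ∀ z ∈ N, x * z ∈ N := by
    intro x hx z hz y hy
    have := hz (y * x) (R.mul_mem hy hx)
    simpa [mul_assoc] using this
  have hNP : ∀ z ∈ N, ∀ p ∈ P, z * p ∈ N := by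
    intro z hz p hp y hy
    have := P.mul_mem (hz y hy) hp
    simpa [mul_assoc] using this
  have hNsub : ∀ z ∈ N, ∀ w ∈ N, z - w ∈ N := by
    intro z hz w hw y hy
    have := P.sub_mem (hz y hy) (hw y hy)
    simpa [mul_sub] using this
  have hNa : ∀ z ∈ N, a₁ * z ∈ P := by
    intro z hz; simpa using hz 1 R.one_mem
  -- minimal element
  have hex : ∃ k, ∃ z ∈ N, z ≠ 0 ∧ deg (a₁ * z) = k := ⟨_, b₁, hNb, hb₁0, rfl⟩
  classical
  obtain ⟨n, hnN, hn0, hndeg⟩ := Nat.find_spec hex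
  have hnmin : ∀ z ∈ N, z ≠ 0 → deg (a₁ * n) ≤ deg (a₁ * z) := by
    intro z hz hz0
    rw [hndeg]
    exact Nat.find_min' hex ⟨z, hz, hz0, rfl⟩
  have hgen : ∀ k, ∀ z ∈ N, deg (a₁ * z) = k → ∃ p ∈ P, z = n * p := by
    intro k
    induction k using Nat.strong_induction_on with
    | _ k ih =>
      intro z hz hk
      by_cases hz0 : z = 0
      · exact ⟨0, P.zero_mem, by simp [hz0]⟩
      obtain ⟨t, ht, h⟩ := hr (a₁ * z) (hNa z hz) (a₁ * n) (hNa n hnN)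
        (mul_ne_zero ha₁0 hz0) (mul_ne_zero ha₁0 hn0) (hnmin z hz hz0)
      have heq : a₁ * z - a₁ * n * t = a₁ * (z - n * t) := by
        rw [mul_sub, mul_assoc]
      rw [heq] at h
      rcases h with h | h
      · have : z - n * t = 0 := by
          rcases mul_eq_zero.1 h with h | h
          · exact absurd h ha₁0
          · exact h
        exact ⟨t, ht, sub_eq_zero.1 this⟩
      · obtain ⟨p, hp, hzp⟩ := ih _ (hk ▸ h) (z - n * t) (hNsub z hz _ (hNP n hnN t ht)) rfl
        refine ⟨p + t, P.add_mem hp ht, ?_⟩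
        rw [mul_add, ← hzp]; abel
  have hgen' : ∀ z ∈ N, ∃ p ∈ P, z = n * p := fun z hz => hgen _ z hz rfl
  -- units of P lying in A preserve N
  have hc : ∀ c ∈ A, c ≠ 0 → c⁻¹ ∈ P → ∃ p ∈ P, c⁻¹ * n = n * p := by
    intro c hcA hc0 hcP
    obtain ⟨p, hp, hcn⟩ := hgen' (c * n) (hNR c (hAR hcA) n hnN)
    have hp0 : p ≠ 0 := by
      rintro rfl
      rw [mul_zero] at hcn
      exact (mul_ne_zero hc0 hn0) hcn
    have hcdeg : deg c = 0 := by
      have := hmul c (hAP hcA) c⁻¹ hcP hc0 (inv_ne_zero hc0)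
      rw [mul_inv_cancel₀ hc0, hdeg1] at this
      omega
    obtain ⟨u, hu, v, hv, hv0, hnuv⟩ := hfl n
    have hu0 : u ≠ 0 := by rintro rfl; simp at hnuv; exact hn0 hnuv
    obtain ⟨w, hw, s', hs', hs'0, hws⟩ := hfl (v * c * v⁻¹)
    have h1 : s' * (v * c) = w * v := by
      have : v * c = s'⁻¹ * w * v := by
        rw [← hws, mul_assoc, inv_mul_cancel₀ hv0, mul_one]
      rw [this]; simp only [mul_assoc]; rw [mul_inv_cancel_left₀ hs'0]
    have hw0 : w ≠ 0 := by
      rintro rfl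
      rw [zero_mul] at h1
      exact (mul_ne_zero hs'0 (mul_ne_zero hv0 hc0)) h1
    have d1 : deg s' = deg w := by
      have e1 := hmul s' (hAP hs') (v * c) (P.mul_mem (hAP hv) (hAP hcA)) hs'0 (mul_ne_zero hv0 hc0)
      have e2 := hmul v (hAP hv) c (hAP hcA) hv0 hc0
      have e3 := hmul w (hAP hw) v (hAP hv) hw0 hv0
      rw [h1] at e1
      omega
    have h2 : s' * (u * p) = w * u := by
      have hu' : u = v * n := by rw [hnuv, mul_inv_cancel_left₀ hv0]
      calc s' * (u * p) = s' * (v * (n * p)) := by rw [hu', mul_assoc]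
        _ = s' * (v * c) * n := by rw [← hcn]; simp only [mul_assoc]
        _ = w * u := by rw [h1, hu', mul_assoc]
    have d2 : deg p = 0 := by
      have e1 := hmul s' (hAP hs') (u * p) (P.mul_mem (hAP hu) hp) hs'0 (mul_ne_zero hu0 hp0)
      have e2 := hmul u (hAP hu) p hp hu0 hp0
      have e3 := hmul w (hAP hw) u (hAP hu) hw0 hu0
      rw [h2] at e1
      omega
    refine ⟨p⁻¹, hunit p hp hp0 d2, ?_⟩
    rw [eq_mul_inv_iff_mul_eq₀ hp0, mul_assoc, ← hcn, inv_mul_cancel_left₀ hc0]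
  have hPn : ∀ p ∈ P, ∃ p' ∈ P, p * n = n * p' := by
    intro p hp
    obtain ⟨c, hcA, hc0, hcP, hcp⟩ := hden p hp
    obtain ⟨p₁, hp₁, h1⟩ := hgen' (c * p * n) (hNR _ (hAR hcp) n hnN)
    obtain ⟨p₂, hp₂, h2⟩ := hc c hcA hc0 hcP
    refine ⟨p₂ * p₁, P.mul_mem hp₂ hp₁, ?_⟩
    calc p * n = c⁻¹ * (c * p * n) := by
          rw [mul_assoc, inv_mul_cancel_left₀ hc0]
      _ = c⁻¹ * n * p₁ := by rw [h1, mul_assoc]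
      _ = n * (p₂ * p₁) := by rw [h2, mul_assoc]
  -- generic generation facts
  have gen_l : ∀ (H : Set D), (∀ x ∈ H, x ∈ P) → (∀ x ∈ H, ∀ y ∈ H, x - y ∈ H) →
      (∀ x ∈ H, ∀ p ∈ P, p * x ∈ H) → ∀ g ∈ H, g ≠ 0 →
      (∀ x ∈ H, x ≠ 0 → deg g ≤ deg x) → ∀ x ∈ H, ∃ p ∈ P, x = p * g := by
    intro H hHP hsub hmulH g hg hg0 hmin
    have : ∀ k, ∀ x ∈ H, deg x = k → ∃ p ∈ P, x = p * g := by
      intro k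
      induction k using Nat.strong_induction_on with
      | _ k ih =>
        intro x hx hk
        by_cases hx0 : x = 0
        · exact ⟨0, P.zero_mem, by simp [hx0]⟩
        obtain ⟨t, ht, h⟩ := hl x (hHP x hx) g (hHP g hg) hx0 hg0 (hmin x hx hx0)
        rcases h with h | h
        · exact ⟨t, ht, sub_eq_zero.1 h⟩
        · obtain ⟨p, hp, hzp⟩ := ih _ (hk ▸ h) (x - t * g) (hsub x hx _ (hmulH g hg t ht)) rfl
          refine ⟨p + t, P.add_mem hp ht, ?_⟩
          rw [add_mul, ← hzp]; abel
    exact fun x hx => this _ x hx rfl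
  have gen_r : ∀ (H : Set D), (∀ x ∈ H, x ∈ P) → (∀ x ∈ H, ∀ y ∈ H, x - y ∈ H) →
      (∀ x ∈ H, ∀ p ∈ P, x * p ∈ H) → ∀ g ∈ H, g ≠ 0 →
      (∀ x ∈ H, x ≠ 0 → deg g ≤ deg x) → ∀ x ∈ H, ∃ p ∈ P, x = g * p := by
    intro H hHP hsub hmulH g hg hg0 hmin
    have : ∀ k, ∀ x ∈ H, deg x = k → ∃ p ∈ P, x = g * p := by
      intro k
      induction k using Nat.strong_induction_on with
      | _ k ih =>
        intro x hx hk
        by_cases hx0 : x = 0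
        · exact ⟨0, P.zero_mem, by simp [hx0]⟩
        obtain ⟨t, ht, h⟩ := hr x (hHP x hx) g (hHP g hg) hx0 hg0 (hmin x hx hx0)
        rcases h with h | h
        · exact ⟨t, ht, sub_eq_zero.1 h⟩
        · obtain ⟨p, hp, hzp⟩ := ih _ (hk ▸ h) (x - g * t) (hsub x hx _ (hmulH g hg t ht)) rfl
          refine ⟨p + t, P.add_mem hp ht, ?_⟩
          rw [mul_add, ← hzp]; abel
    exact fun x hx => this _ x hx rfl
  -- the ideal G
  let G : Set D := {p | p ∈ P ∧ p * n ∈ P}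
  have hGP : ∀ x ∈ G, x ∈ P := fun x hx => hx.1
  have hGsub : ∀ x ∈ G, ∀ y ∈ G, x - y ∈ G := fun x hx y hy =>
    ⟨P.sub_mem hx.1 hy.1, by rw [sub_mul]; exact P.sub_mem hx.2 hy.2⟩
  have hGl : ∀ x ∈ G, ∀ p ∈ P, p * x ∈ G := fun x hx p hp =>
    ⟨P.mul_mem hp hx.1, by rw [mul_assoc]; exact P.mul_mem hp hx.2⟩
  have hGr : ∀ x ∈ G, ∀ p ∈ P, x * p ∈ G := by
    intro x hx p hp
    refine ⟨P.mul_mem hx.1 hp, ?_⟩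
    obtain ⟨p', hp', h⟩ := hPn p hp
    rw [mul_assoc, h, ← mul_assoc]
    exact P.mul_mem hx.2 hp'
  have hGa : a₁ ∈ G := ⟨hAP ha₁, hNa n hnN⟩
  have hexG : ∃ k, ∃ z ∈ G, z ≠ 0 ∧ deg z = k := ⟨_, a₁, hGa, ha₁0, rfl⟩
  obtain ⟨g, hgG, hg0, hgdeg⟩ := Nat.find_spec hexG
  have hgmin : ∀ z ∈ G, z ≠ 0 → deg g ≤ deg z := by
    intro z hz hz0
    rw [hgdeg]
    exact Nat.find_min' hexG ⟨z, hz, hz0, rfl⟩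
  have hGg := gen_r G hGP hGsub hGr g hgG hg0 hgmin
  have hPg : ∀ p ∈ P, ∃ p' ∈ P, p * g = g * p' := fun p hp => hGg _ (hGl g hgG p hp)
  -- the ideal H
  let H : Set D := {z | ∃ p ∈ P, z = g * n * p}
  have hHP : ∀ x ∈ H, x ∈ P := by
    rintro _ ⟨p, hp, rfl⟩; exact P.mul_mem hgG.2 hp
  have hHsub : ∀ x ∈ H, ∀ y ∈ H, x - y ∈ H := by
    rintro _ ⟨p, hp, rfl⟩ _ ⟨p', hp', rfl⟩
    exact ⟨p - p', P.sub_mem hp hp', by rw [mul_sub]⟩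
  have hHl : ∀ x ∈ H, ∀ p ∈ P, p * x ∈ H := by
    rintro _ ⟨p, hp, rfl⟩ p₁ hp₁
    obtain ⟨p₂, hp₂, h2⟩ := hPg p₁ hp₁
    obtain ⟨p₃, hp₃, h3⟩ := hPn p₂ hp₂
    refine ⟨p₃ * p, P.mul_mem hp₃ hp, ?_⟩
    calc p₁ * (g * n * p) = (p₁ * g) * n * p := by simp only [mul_assoc]
      _ = g * (p₂ * n) * p := by rw [h2]; simp only [mul_assoc]
      _ = g * n * (p₃ * p) := by rw [h3]; simp only [mul_assoc]
  have hgn0 : g * n ≠ 0 := mul_ne_zero hg0 hn0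
  have hHgn := gen_l H hHP hHsub hHl (g * n) ⟨1, P.one_mem, by simp⟩ hgn0 (by
    rintro _ ⟨p, hp, rfl⟩ h0
    have hp0 : p ≠ 0 := by rintro rfl; simp at h0
    rw [hmul _ hgG.2 _ hp hgn0 hp0]
    omega)
  intro x hx
  obtain ⟨p, hp, hxn⟩ := hgen' (x * n) (hNR x hx n hnN)
  obtain ⟨p₁, hp₁, h1⟩ := hHgn (g * n * p) ⟨p, hp, rfl⟩
  obtain ⟨p₂, hp₂, h2⟩ := hPg p₁ hp₁
  have : g * (x * n) = g * (p₂ * n) := by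
    rw [hxn, ← mul_assoc, h1, ← mul_assoc, h2]; simp only [mul_assoc]
  have h3 : x = p₂ := mul_right_cancel₀ hn0 (mul_left_cancel₀ hg0 this)
  rw [h3]; exact hp₂

section MOExt
variable {A D : Type} [Ring A] [DivisionRing D]

theorem mo_ore (φ : A →+* D) (hinj : Function.Injective φ)
    (hfr : ∀ x : D, ∃ a b : A, b ≠ 0 ∧ x = φ a * (φ b)⁻¹) (a d : A) (hd : d ≠ 0) :
    ∃ s t : A, s ≠ 0 ∧ a * s = d * t := by
  have hφ0 : ∀ x : A, x ≠ 0 → φ x ≠ 0 := fun x hx h => hx (hinj (by simpa using h))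
  obtain ⟨t, s, hs, h⟩ := hfr ((φ d)⁻¹ * φ a)
  refine ⟨s, t, hs, hinj ?_⟩
  rw [map_mul, map_mul]
  have : φ a * φ s = φ d * ((φ d)⁻¹ * φ a) * φ s := by
    rw [mul_inv_cancel_left₀ (hφ0 d hd)]
  rw [this, h, mul_assoc, inv_mul_cancel_right₀ (hφ0 s hs)]

theorem mo_common (φ : A →+* D) (hinj : Function.Injective φ) [Nontrivial A]
    (hfr : ∀ x : D, ∃ a b : A, b ≠ 0 ∧ x = φ a * (φ b)⁻¹) (S : Finset D) :
    ∃ b : A, b ≠ 0 ∧ ∀ x ∈ S, ∃ a, x * φ b = φ a := by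
  have hφ0 : ∀ x : A, x ≠ 0 → φ x ≠ 0 := fun x hx h => hx (hinj (by simpa using h))
  classical
  induction S using Finset.induction_on with
  | empty => exact ⟨1, one_ne_zero, by simp⟩
  | insert x S _ ih =>
    obtain ⟨b, hb, h⟩ := ih
    obtain ⟨c, d, hd, hx⟩ := hfr x
    obtain ⟨s, t, hs, hst⟩ := mo_ore φ hinj hfr b d hd
    refine ⟨b * s, fun h0 => ?_, ?_⟩
    · have : φ b * φ s = 0 := by rw [← map_mul, h0, map_zero]
      exact mul_ne_zero (hφ0 b hb) (hφ0 s hs) this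
    · intro y hy
      rcases Finset.mem_insert.1 hy with rfl | hy
      · refine ⟨c * t, ?_⟩
        rw [hst, hx, map_mul, map_mul, mul_assoc, inv_mul_cancel_left₀ (hφ0 d hd)]
      · obtain ⟨a, ha⟩ := h y hy
        exact ⟨a * s, by rw [map_mul, map_mul, ← ha, mul_assoc]⟩

theorem mo_ext {B : Type} [Ring B] (φ : A →+* D) (hinj : Function.Injective φ)
    (hfr : ∀ x : D, ∃ a b : A, b ≠ 0 ∧ x = φ a * (φ b)⁻¹)
    (ψ : A →+* B) (hψ : ∀ a, a ≠ 0 → IsUnit (ψ a)) :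
    ∃ Ψ : D →+* B, ∀ a, Ψ (φ a) = ψ a := by
  have hφ0 : ∀ x : A, x ≠ 0 → φ x ≠ 0 := fun x hx h => hx (hinj (by simpa using h))
  haveI : Nontrivial A := by
    obtain ⟨a, b, hb, -⟩ := hfr 0
    exact ⟨b, 0, hb⟩
  have key : ∀ x : D, ∃ y : B, ∀ a b, b ≠ 0 → x * φ b = φ a → y * ψ b = ψ a := by
    intro x
    obtain ⟨c, d, hd, hx⟩ := hfr x
    have hxd : x * φ d = φ c := by rw [hx, inv_mul_cancel_right₀ (hφ0 d hd)]
    obtain ⟨u, hu⟩ := hψ d hd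
    refine ⟨ψ c * (u⁻¹ : Bˣ), fun a b hb hxb => ?_⟩
    obtain ⟨s, t, hs, hst⟩ := mo_ore φ hinj hfr b d hd
    have h1 : a * s = c * t := by
      apply hinj
      rw [map_mul, map_mul, ← hxb, ← hxd, mul_assoc, mul_assoc, ← map_mul, ← map_mul, hst]
    apply (hψ s hs).mul_right_cancel
    rw [mul_assoc, ← map_mul, hst, map_mul, ← hu, ← map_mul ψ a s, h1, map_mul]
    simp [mul_assoc]
  choose Ψ hΨ using key
  have huniq : ∀ x y a b, b ≠ 0 → x * φ b = φ a → y * ψ b = ψ a → Ψ x = y := by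
    intro x y a b hb h1 h2
    exact (hψ b hb).mul_right_cancel ((hΨ x a b hb h1).trans h2.symm)
  refine ⟨{ toFun := Ψ, map_one' := ?_, map_zero' := ?_, map_mul' := ?_, map_add' := ?_ }, ?_⟩
  · exact huniq 1 1 1 1 one_ne_zero (by simp) (by simp)
  · intro x y
    obtain ⟨a, b, hb, hy⟩ := hfr y
    obtain ⟨c, d, hd, hx⟩ := hfr x
    have hyb : y * φ b = φ a := by rw [hy, inv_mul_cancel_right₀ (hφ0 b hb)]
    have hxd : x * φ d = φ c := by rw [hx, inv_mul_cancel_right₀ (hφ0 d hd)]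
    obtain ⟨s, t, hs, hst⟩ := mo_ore φ hinj hfr a d hd
    refine huniq (x * y) _ (c * t) (b * s) (fun h0 => ?_) ?_ ?_
    · have : φ b * φ s = 0 := by rw [← map_mul, h0, map_zero]
      exact mul_ne_zero (hφ0 b hb) (hφ0 s hs) this
    · rw [map_mul, mul_assoc, ← mul_assoc y, hyb, ← map_mul, hst, map_mul, ← mul_assoc, hxd, map_mul]
    · rw [map_mul, mul_assoc, ← mul_assoc (Ψ y), hΨ y a b hb hyb, ← map_mul, hst, map_mul,
        ← mul_assoc, hΨ x c d hd hxd, map_mul]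
  · exact huniq 0 0 0 1 one_ne_zero (by simp) (by simp)
  · intro x y
    classical
    obtain ⟨b, hb, h⟩ := mo_common φ hinj hfr {x, y}
    obtain ⟨a, ha⟩ := h x (by simp)
    obtain ⟨c, hc⟩ := h y (by simp)
    refine huniq (x + y) _ (a + c) b hb (by rw [add_mul, ha, hc, map_add]) ?_
    rw [add_mul, hΨ x a b hb ha, hΨ y c b hb hc, map_add]
  · intro a
    exact huniq _ _ a 1 one_ne_zero (by simp) (by simp)

/-- extension of an injective endomorphism and of a twisted derivation -/
theorem mo_ext_aut (φ : A →+* D) (hinj : Function.Injective φ)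
    (hfr : ∀ x : D, ∃ a b : A, b ≠ 0 ∧ x = φ a * (φ b)⁻¹)
    (k : A →+* A) (hk : Function.Injective k) :
    ∃ κ : D →+* D, ∀ a, κ (φ a) = φ (k a) := by
  obtain ⟨Ψ, h⟩ := mo_ext φ hinj hfr (φ.comp k) (fun a ha => by
    rw [isUnit_iff_ne_zero]
    intro h0
    exact ha (hk (hinj (by simpa using h0))))
  exact ⟨Ψ, h⟩

theorem mo_ext_der (φ : A →+* D) (hinj : Function.Injective φ)
    (hfr : ∀ x : D, ∃ a b : A, b ≠ 0 ∧ x = φ a * (φ b)⁻¹)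
    (k : A →+* A) (δ : A →+ A) (hδ : ∀ x y, δ (x * y) = δ x * y + k x * δ y)
    (κ : D →+* D) (hκ : ∀ a, κ (φ a) = φ (k a)) :
    ∃ Δ : D →+ D, (∀ a, Δ (φ a) = φ (δ a)) ∧ ∀ x y, Δ (x * y) = Δ x * y + κ x * Δ y := by
  have hφ0 : ∀ x : A, x ≠ 0 → φ x ≠ 0 := fun x hx h => hx (hinj (by simpa using h))
  have hδ1 : δ 1 = 0 := by
    have := hδ 1 1
    simpa using this
  let ψ : A →+* Matrix (Fin 2) (Fin 2) D :=
    { toFun := fun a => !![φ (k a), φ (δ a); 0, φ a]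
      map_one' := by
        ext i j; fin_cases i <;> fin_cases j <;> simp [hδ1]
      map_zero' := by
        ext i j; fin_cases i <;> fin_cases j <;> simp
      map_mul' := by
        intro x y
        ext i j; fin_cases i <;> fin_cases j <;> simp [Matrix.mul_apply, Fin.sum_univ_two, hδ, add_comm]
      map_add' := by
        intro x y
        ext i j; fin_cases i <;> fin_cases j <;> simp }
  have hψ : ∀ a, a ≠ 0 → IsUnit (ψ a) := by
    intro a ha
    have h1 := hφ0 a ha
    have h2 : φ (k a) ≠ 0 := by
      rw [← hκ]; exact (map_ne_zero κ).2 h1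
    refine ⟨⟨ψ a, !![(φ (k a))⁻¹, -((φ (k a))⁻¹ * φ (δ a) * (φ a)⁻¹); 0, (φ a)⁻¹], ?_, ?_⟩, rfl⟩
    · ext i j; fin_cases i <;> fin_cases j <;>
        simp [ψ, Matrix.mul_apply, Fin.sum_univ_two, h1, h2, mul_assoc]
    · ext i j; fin_cases i <;> fin_cases j <;>
        simp [ψ, Matrix.mul_apply, Fin.sum_univ_two, h1, h2, mul_assoc]
  obtain ⟨Ψ, hΨ⟩ := mo_ext φ hinj hfr ψ hψ
  have e10 : ∀ x, Ψ x 1 0 = 0 ∧ Ψ x 1 1 = x ∧ Ψ x 0 0 = κ x := by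
    intro x
    obtain ⟨a, b, hb, hx⟩ := hfr x
    have hxb : x * φ b = φ a := by rw [hx, inv_mul_cancel_right₀ (hφ0 b hb)]
    have hM : Ψ x * ψ b = ψ a := by rw [← hΨ, ← hΨ, ← map_mul, hxb]
    have hkb : φ (k b) ≠ 0 := by
      rw [← hκ]; exact (map_ne_zero κ).2 (hφ0 b hb)
    have h10 := congrFun (congrFun hM 1) 0
    have h11 := congrFun (congrFun hM 1) 1
    have h00 := congrFun (congrFun hM 0) 0
    simp [ψ, Matrix.mul_apply, Fin.sum_univ_two] at h10 h11 h00
    have h10' : Ψ x 1 0 = 0 := by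
      rcases h10 with h | h
      · exact h
      · exact absurd h hkb
    refine ⟨h10', ?_, ?_⟩
    · rw [h10', zero_mul, zero_add, ← hxb] at h11
      exact mul_right_cancel₀ (hφ0 b hb) h11
    · rw [← hκ, ← hκ, ← hxb, map_mul] at h00
      rw [← hκ] at hkb
      exact mul_right_cancel₀ hkb h00
  refine ⟨{ toFun := fun x => Ψ x 0 1, map_zero' := by simp, map_add' := by simp }, ?_, ?_⟩
  · intro a
    simp [hΨ, ψ]
  · intro x y
    simp [Matrix.mul_apply, Fin.sum_univ_two, (e10 x).2.2, (e10 y).2.1, add_comm]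
end MOExt

/-- Gaussian binomial coefficients -/
def moC (s : ℂ) : ℕ → ℕ → ℂ
  | 0, 0 => 1
  | m + 1, 0 => moC s m 0
  | 0, k + 1 => moC s 0 k
  | m + 1, k + 1 => moC s m (k + 1) + s ^ (m + 1) * moC s (m + 1) k

theorem moC_zero_left (s : ℂ) (k : ℕ) : moC s 0 k = 1 := by
  induction k with
  | zero => simp [moC]
  | succ k ih => simp [moC, ih]

theorem moC_zero_right (s : ℂ) (k : ℕ) : moC s k 0 = 1 := by
  induction k with
  | zero => simp [moC]
  | succ k ih => simp [moC, ih]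

theorem moC_fac (s : ℂ) : ∀ N m k : ℕ, m + k = N →
    moC s m k * ((∏ j ∈ Finset.range m, (1 - s ^ (j + 1))) * ∏ j ∈ Finset.range k, (1 - s ^ (j + 1)))
      = ∏ j ∈ Finset.range (m + k), (1 - s ^ (j + 1)) := by
  intro N
  induction N with
  | zero =>
    intro m k h
    obtain ⟨rfl, rfl⟩ : m = 0 ∧ k = 0 := by omega
    simp [moC]
  | succ N ih =>
    intro m k h
    rcases m with _ | m
    · simp [moC_zero_left]
    rcases k with _ | k
    · simp [moC_zero_right]
    have h1 := ih m (k + 1) (by omega)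
    have h2 := ih (m + 1) k (by omega)
    have e1 : m + 1 + (k + 1) = (m + k + 1) + 1 := by omega
    have e2 : m + (k + 1) = m + k + 1 := by omega
    have e3 : m + 1 + k = m + k + 1 := by omega
    rw [e2] at h1
    rw [e3] at h2
    rw [e1, Finset.prod_range_succ _ (m + k + 1), moC]
    rw [Finset.prod_range_succ _ m] at h2 ⊢
    rw [Finset.prod_range_succ _ k] at h1 ⊢
    have e4 : s ^ (m + k + 1 + 1) = s ^ (m + 1) * s ^ (k + 1) := by rw [← pow_add]; congr 1; omega
    rw [e4]
    linear_combination (1 - s ^ (m + 1)) * h1 + s ^ (m + 1) * (1 - s ^ (k + 1)) * h2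

theorem moC_ne_zero (s : ℂ) (hs : ∀ j : ℕ, s ^ (j + 1) ≠ 1) (m k : ℕ) : moC s m k ≠ 0 := by
  intro h
  have := moC_fac s _ m k rfl
  rw [h, zero_mul] at this
  have h2 := Finset.prod_eq_zero_iff.1 this.symm
  obtain ⟨j, -, hj⟩ := h2
  exact hs j (sub_eq_zero.1 hj).symm

section MODer
variable {D : Type} [DivisionRing D] [Algebra ℂ D]

theorem mo_der_kappa (κ : D ≃ₐ[ℂ] D) (δ : D →ₗ[ℂ] D) (s : ℂ)
    (hκδ : ∀ x, δ (κ x) = s • κ (δ x)) (m : ℕ) (x : D) :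
    (δ ^ m) (κ x) = s ^ m • κ ((δ ^ m) x) := by
  induction m with
  | zero => simp
  | succ m ih =>
    rw [pow_succ', Module.End.mul_apply, ih, map_smul, hκδ, smul_smul, Module.End.mul_apply, pow_succ]

theorem mo_leib (κ : D ≃ₐ[ℂ] D) (δ : D →ₗ[ℂ] D) (s : ℂ)
    (hδ : ∀ x y, δ (x * y) = δ x * y + κ x * δ y)
    (hκδ : ∀ x, δ (κ x) = s • κ (δ x)) : ∀ N m k : ℕ, m + k = N → ∀ x y : D,
    (δ ^ (m + 1)) x = 0 → (δ ^ (k + 1)) y = 0 →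
    (δ ^ (m + k)) (x * y) = moC s m k • ((κ ^ k) ((δ ^ m) x) * (δ ^ k) y) ∧
      (δ ^ (m + k + 1)) (x * y) = 0 := by
  intro N
  induction N with
  | zero =>
    intro m k h x y hx hy
    obtain ⟨rfl, rfl⟩ : m = 0 ∧ k = 0 := by omega
    simp only [zero_add, pow_one] at hx hy
    simp [moC, hδ, hx, hy]
  | succ N ih =>
    intro m k h x y hx hy
    -- first summand
    have P1 : (δ ^ (m + k)) (δ x * y) = 0 ∧
        (∀ m', m = m' + 1 → (δ ^ (m' + k)) (δ x * y) =
          moC s m' k • ((κ ^ k) ((δ ^ m) x) * (δ ^ k) y)) := by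
      rcases m with _ | m
      · have : δ x = 0 := by simpa using hx
        refine ⟨by simp [this], fun m' hm' => by omega⟩
      · have hx' : (δ ^ (m + 1)) (δ x) = 0 := by
          rw [← Module.End.mul_apply, ← pow_succ]; exact hx
        obtain ⟨h1, h2⟩ := ih m k (by omega) (δ x) y hx' hy
        refine ⟨by rw [show m + 1 + k = m + k + 1 by omega]; exact h2, ?_⟩
        intro m' hm'
        obtain rfl : m = m' := by omega
        rw [h1, ← Module.End.mul_apply, ← pow_succ]
    have P2 : (δ ^ (m + k)) (κ x * δ y) = 0 ∧
        (∀ k', k = k' + 1 → (δ ^ (m + k')) (κ x * δ y) =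
          (s ^ m * moC s m k') • ((κ ^ k) ((δ ^ m) x) * (δ ^ k) y)) := by
      rcases k with _ | k
      · have : δ y = 0 := by simpa using hy
        refine ⟨by simp [this], fun m' hm' => by omega⟩
      · have hy' : (δ ^ (k + 1)) (δ y) = 0 := by
          rw [← Module.End.mul_apply, ← pow_succ]; exact hy
        have hx' : (δ ^ (m + 1)) (κ x) = 0 := by
          rw [mo_der_kappa κ δ s hκδ, hx]; simp
        obtain ⟨h1, h2⟩ := ih m k (by omega) (κ x) (δ y) hx' hy'
        refine ⟨h2, ?_⟩
        intro k' hk'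
        obtain rfl : k = k' := by omega
        rw [h1, mo_der_kappa κ δ s hκδ, map_smul, smul_mul_assoc, smul_smul, mul_comm (moC s m k),
          ← Module.End.mul_apply, ← pow_succ, pow_succ κ, AlgEquiv.mul_apply]
    constructor
    · rcases m with _ | m
      · rcases k with _ | k
        · omega
        · have := P2.2 k rfl
          have hx0 : δ x = 0 := by simpa using hx
          rw [show 0 + (k + 1) = (0 + k) + 1 by omega, pow_succ, Module.End.mul_apply, hδ, map_add, this,
            hx0]
          simp [moC]
      · rcases k with _ | k
        · have := P1.2 m rfl
          have hy0 : δ y = 0 := by simpa using hy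
          have e0 : (δ ^ (m + 1 + 0)) (x * y) = (δ ^ (m + 0)) (δ (x * y)) := by
            rw [show m + 1 + 0 = (m + 0) + 1 by omega, pow_succ, Module.End.mul_apply]; rfl
          rw [e0, hδ, map_add, this, hy0, mul_zero, map_zero, add_zero, moC_zero_right, moC_zero_right]
        · have e1 := P1.2 m rfl
          have e2 := P2.2 k rfl
          rw [show m + 1 + (k + 1) = (m + (k + 1)) + 1 by omega, pow_succ, Module.End.mul_apply, hδ,
            map_add, e1, show m + (k + 1) = m + 1 + k by omega, e2, ← add_smul]
          simp only [moC]
    · rw [pow_succ, Module.End.mul_apply, hδ, map_add, P1.1, P2.1, add_zero]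

theorem mo_pow_zero_of_le (δ : D →ₗ[ℂ] D) {m k : ℕ} (h : m ≤ k) {x : D} (hx : (δ ^ m) x = 0) :
    (δ ^ k) x = 0 := by
  obtain ⟨j, rfl⟩ := Nat.exists_eq_add_of_le h
  rw [add_comm, pow_add, Module.End.mul_apply, hx, map_zero]

/-- the subring of δ-nilpotent elements -/
def moNil (κ : D ≃ₐ[ℂ] D) (δ : D →ₗ[ℂ] D) (s : ℂ)
    (hδ : ∀ x y, δ (x * y) = δ x * y + κ x * δ y)
    (hκδ : ∀ x, δ (κ x) = s • κ (δ x)) : Subring D where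
  carrier := {x | ∃ m, (δ ^ m) x = 0}
  mul_mem' := by
    rintro x y ⟨m, hm⟩ ⟨k, hk⟩
    exact ⟨_, (mo_leib κ δ s hδ hκδ _ m k rfl x y (mo_pow_zero_of_le δ (by omega) hm)
      (mo_pow_zero_of_le δ (by omega) hk)).2⟩
  one_mem' := by
    refine ⟨1, ?_⟩
    have := hδ 1 1
    simpa using this
  add_mem' := by
    rintro x y ⟨m, hm⟩ ⟨k, hk⟩
    exact ⟨m + k, by rw [map_add, mo_pow_zero_of_le δ (by omega) hm,
      mo_pow_zero_of_le δ (by omega) hk, add_zero]⟩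
  zero_mem' := ⟨0, by simp⟩
  neg_mem' := by
    rintro x ⟨m, hm⟩
    exact ⟨m, by rw [map_neg, hm, neg_zero]⟩

open Classical in
/-- nilpotency degree -/
noncomputable def moDeg (δ : D →ₗ[ℂ] D) (x : D) : ℕ :=
  if h : ∃ m, (δ ^ (m + 1)) x = 0 then Nat.find h else 0

theorem moDeg_eq (δ : D →ₗ[ℂ] D) (x : D) (m : ℕ) (h1 : (δ ^ m) x ≠ 0) (h2 : (δ ^ (m + 1)) x = 0) :
    moDeg δ x = m := by
  classical
  have h : ∃ m, (δ ^ (m + 1)) x = 0 := ⟨m, h2⟩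
  unfold moDeg
  rw [dif_pos h]
  apply le_antisymm
  · exact Nat.find_min' h h2
  · by_contra hlt
    push Not at hlt
    exact h1 (mo_pow_zero_of_le δ (by omega) (Nat.find_spec h))

theorem moDeg_spec (δ : D →ₗ[ℂ] D) (x : D) (hx : x ≠ 0) (h : ∃ m, (δ ^ m) x = 0) :
    (δ ^ (moDeg δ x)) x ≠ 0 ∧ (δ ^ (moDeg δ x + 1)) x = 0 := by
  classical
  have h' : ∃ m, (δ ^ (m + 1)) x = 0 := by
    obtain ⟨m, hm⟩ := h
    exact ⟨m, mo_pow_zero_of_le δ (by omega) hm⟩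
  have hd : moDeg δ x = Nat.find h' := by unfold moDeg; rw [dif_pos h']
  rw [hd]
  refine ⟨?_, Nat.find_spec h'⟩
  rcases hk : Nat.find h' with _ | k
  · simpa using hx
  · exact Nat.find_min h' (by omega : k < Nat.find h')

variable (κ : D ≃ₐ[ℂ] D) (δ : D →ₗ[ℂ] D) (s : ℂ) (hs0 : s ≠ 0) (hs : ∀ j : ℕ, s ^ (j + 1) ≠ 1)
    (hδ : ∀ x y, δ (x * y) = δ x * y + κ x * δ y)
    (hκδ : ∀ x, δ (κ x) = s • κ (δ x))

include hs hδ hκδ in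
theorem moDeg_mul (x y : D) (hx : x ≠ 0) (hy : y ≠ 0) (hxn : ∃ m, (δ ^ m) x = 0)
    (hyn : ∃ m, (δ ^ m) y = 0) :
    moDeg δ (x * y) = moDeg δ x + moDeg δ y := by
  obtain ⟨h1, h2⟩ := moDeg_spec δ x hx hxn
  obtain ⟨h3, h4⟩ := moDeg_spec δ y hy hyn
  obtain ⟨h5, h6⟩ := mo_leib κ δ s hδ hκδ _ _ _ rfl x y h2 h4
  refine moDeg_eq δ _ _ ?_ h6
  rw [h5]
  refine smul_ne_zero (moC_ne_zero s hs _ _) (mul_ne_zero ?_ h3)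
  intro h0
  exact h1 ((κ ^ _).injective (by rw [h0, map_zero]))

include hs0 hκδ in
theorem mo_ker_symm (k : ℕ) (x : D) (hx : δ x = 0) : δ ((κ ^ k).symm x) = 0 := by
  set y := (κ ^ k).symm x with hy
  have hxy : x = (κ ^ k) y := by simp [hy]
  have : ∀ k : ℕ, ∀ y, δ ((κ ^ k) y) = s ^ k • (κ ^ k) (δ y) := by
    intro k
    induction k with
    | zero => intro y; simp
    | succ k ih =>
      intro y
      rw [pow_succ', AlgEquiv.mul_apply, hκδ, ih, map_smul, smul_smul, AlgEquiv.mul_apply, pow_succ, mul_comm]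
  rw [hxy, this] at hx
  have h2 := (smul_eq_zero.1 hx).resolve_left (pow_ne_zero _ hs0)
  exact (κ ^ k).injective (by rw [h2, map_zero])

include hs0 hδ hκδ in
/-- elements of each degree with given top -/
theorem mo_top (T : D) (m : ℕ) (hT : (δ ^ m) T ≠ 0) (hT' : (δ ^ (m + 1)) T = 0)
    (g : D) (hg : δ g = 0) : ∃ x, δ x = 0 ∧ (δ ^ m) (x * T) = g ∧ (δ ^ (m + 1)) (x * T) = 0 := by
  have hu : δ ((δ ^ m) T)⁻¹ = 0 := by
    have h1 : δ ((δ ^ m) T) = 0 := by rw [← Module.End.mul_apply, ← pow_succ']; exact hT'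
    have h0 : δ (1 : D) = 0 := by have := hδ 1 1; simpa using this
    have h2 := hδ ((δ ^ m) T) ((δ ^ m) T)⁻¹
    rw [mul_inv_cancel₀ hT, h0, h1, zero_mul, zero_add] at h2
    have h3 := mul_eq_zero.1 h2.symm
    rcases h3 with h3 | h3
    · exact absurd (κ.injective (by rw [h3, map_zero])) hT
    · exact h3
  refine ⟨(κ ^ m).symm (g * ((δ ^ m) T)⁻¹), mo_ker_symm κ δ s hs0 hκδ m _ (by rw [hδ, hg, hu]; simp), ?_⟩
  obtain ⟨h1, h2⟩ := mo_leib κ δ s hδ hκδ _ 0 m rfl ((κ ^ m).symm (g * ((δ ^ m) T)⁻¹)) T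
    (by
      rw [zero_add, pow_one]
      exact mo_ker_symm κ δ s hs0 hκδ m _ (by rw [hδ, hg, hu]; simp)) hT'
  rw [zero_add] at h1 h2
  refine ⟨?_, h2⟩
  rw [h1, moC_zero_left, one_smul, pow_zero, Module.End.one_apply, AlgEquiv.apply_symm_apply,
    inv_mul_cancel_right₀ hT]

variable (A : Subring D) (hAδ : ∀ x ∈ A, δ x ∈ A) (hAn : ∀ x ∈ A, ∃ m, (δ ^ m) x = 0)
  (ht : ∃ x ∈ A, δ x ≠ 0)
  (hfl : ∀ x : D, ∃ a ∈ A, ∃ b ∈ A, b ≠ 0 ∧ x = b⁻¹ * a)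

include hs hδ hκδ hAδ hAn ht in
theorem mo_exT (m : ℕ) : ∃ T ∈ A, (δ ^ m) T ≠ 0 ∧ (δ ^ (m + 1)) T = 0 := by
  obtain ⟨f, hf, hf1⟩ := ht
  have hpow : ∀ k, (δ ^ k) f ∈ A := by
    intro k
    induction k with
    | zero => simpa using hf
    | succ k ih => rw [pow_succ', Module.End.mul_apply]; exact hAδ _ ih
  have hf0 : f ≠ 0 := by rintro rfl; simp at hf1
  obtain ⟨h1, h2⟩ := moDeg_spec δ f hf0 (hAn f hf)
  obtain ⟨k, hk⟩ : ∃ k, moDeg δ f = k + 1 := by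
    rcases h : moDeg δ f with _ | k
    · rw [h] at h2; exact absurd (by simpa using h2) hf1
    · exact ⟨k, rfl⟩
  rw [hk] at h1 h2
  have ht0 : (δ ^ k) f ≠ 0 := by
    intro h0; exact h1 (mo_pow_zero_of_le δ (by omega) h0)
  have ht1 : moDeg δ ((δ ^ k) f) = 1 := by
    apply moDeg_eq
    · rw [← Module.End.mul_apply, ← pow_add, add_comm]; exact h1
    · rw [← Module.End.mul_apply, ← pow_add, add_comm]; exact h2
  have hpm : ((δ ^ k) f) ^ m ∈ A := A.pow_mem (hpow k) m
  have hdm : ∀ m, moDeg δ (((δ ^ k) f) ^ m) = m := by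
    intro m
    induction m with
    | zero =>
      apply moDeg_eq
      · simp
      · have := hδ 1 1; simpa using this
    | succ m ih =>
      rw [pow_succ, moDeg_mul κ δ s hs hδ hκδ _ _ (pow_ne_zero _ ht0) ht0
        (hAn _ (A.pow_mem (hpow k) m)) (hAn _ (hpow k)), ih, ht1]
  have := moDeg_spec δ _ (pow_ne_zero m ht0) (hAn _ hpm)
  rw [hdm] at this
  exact ⟨_, hpm, this⟩

include hs hδ hκδ hAδ hAn hfl in
theorem mo_den0 (y : D) (hy : δ y = 0) : ∃ c ∈ A, c ≠ 0 ∧ δ c = 0 ∧ c * y ∈ A := by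
  obtain ⟨a, ha, c, hc, hc0, hya⟩ := hfl y
  have hpow : ∀ x ∈ A, ∀ k, (δ ^ k) x ∈ A := by
    intro x hx k
    induction k with
    | zero => simpa using hx
    | succ k ih => rw [pow_succ', Module.End.mul_apply]; exact hAδ _ ih
  obtain ⟨h1, h2⟩ := moDeg_spec δ c hc0 (hAn c hc)
  refine ⟨(δ ^ (moDeg δ c)) c, hpow c hc _, h1, ?_, ?_⟩
  · rw [← Module.End.mul_apply, ← pow_succ']; exact h2
  · have h3 := (mo_leib κ δ s hδ hκδ _ (moDeg δ c) 0 rfl c y h2 (by simpa using hy)).1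
    have : c * y = a := by rw [hya, mul_inv_cancel_left₀ hc0]
    rw [this, moC_zero_right] at h3
    simp at h3
    rw [← h3]
    exact hpow a ha _

include hs0 hs hδ hκδ hAδ hAn hfl ht in
theorem mo_den (m : ℕ) : ∀ y : D, (δ ^ m) y = 0 → ∃ c ∈ A, c ≠ 0 ∧ δ c = 0 ∧ c * y ∈ A := by
  induction m with
  | zero =>
    intro y hy
    have : y = 0 := by simpa using hy
    exact ⟨1, A.one_mem, one_ne_zero, by have := hδ 1 1; simpa using this, by simp [this, A.zero_mem]⟩
  | succ m ih =>
    intro y hy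
    obtain ⟨T, hT, hT1, hT2⟩ := mo_exT κ δ s hs hδ hκδ A hAδ hAn ht m
    obtain ⟨g, hg, hg1, hg2⟩ := mo_top κ δ s hs0 hδ hκδ T m hT1 hT2 ((δ ^ m) y) (by
      rw [← Module.End.mul_apply, ← pow_succ']; exact hy)
    obtain ⟨c, hc, hc0, hcδ, hcy⟩ := ih (y - g * T) (by rw [map_sub, hg1, sub_self])
    obtain ⟨c', hc', hc'0, hc'δ, hc'g⟩ := mo_den0 κ δ s hs hδ hκδ A hAδ hAn hfl (c * g) (by
      rw [hδ, hcδ, hg]; simp)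
    refine ⟨c' * c, A.mul_mem hc' hc, mul_ne_zero hc'0 hc0, by rw [hδ, hcδ, hc'δ]; simp, ?_⟩
    have : c' * c * y = c' * (c * (y - g * T)) + c' * (c * g) * T := by
      simp only [mul_sub, mul_assoc]; abel
    rw [this]
    exact A.add_mem (A.mul_mem hc' hcy) (A.mul_mem hc'g hT)

include hs0 hs hδ hκδ hAδ hAn hfl ht in
theorem mo_nil_max (R : Subring D) (hAR : A ≤ R)
    (hfr : ∀ x : D, ∃ a ∈ A, ∃ b ∈ A, b ≠ 0 ∧ x = a * b⁻¹)
    (a b : D) (ha : a ≠ 0) (hb : b ≠ 0) (hab : ∀ x ∈ R, a * x * b ∈ A) :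
    ∀ x ∈ R, ∃ m, (δ ^ m) x = 0 := by
  have h01 : δ (1 : D) = 0 := by have := hδ 1 1; simpa using this
  have hinv : ∀ x, x ≠ 0 → δ x = 0 → δ x⁻¹ = 0 := by
    intro x hx hx1
    have h2 := hδ x x⁻¹
    rw [mul_inv_cancel₀ hx, h01, hx1, zero_mul, zero_add] at h2
    rcases mul_eq_zero.1 h2.symm with h3 | h3
    · exact absurd (κ.injective (by rw [h3, map_zero])) hx
    · exact h3
  have hlow : ∀ x : D, ∀ m, (δ ^ m) x = 0 → x = 0 ∨ moDeg δ x < m := by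
    intro x m hm
    by_cases hx : x = 0
    · exact Or.inl hx
    · right
      by_contra hlt
      push Not at hlt
      exact (moDeg_spec δ x hx ⟨m, hm⟩).1 (mo_pow_zero_of_le δ hlt hm)
  have := mo_euclid R (moNil κ δ s hδ hκδ) A (fun x hx => hAn x hx) hAR (moDeg δ)
    (fun x hx y hy hx0 hy0 => moDeg_mul κ δ s hs hδ hκδ x y hx0 hy0 hx hy)
    (fun x hx hx0 hd => ⟨1, by
      have := (moDeg_spec δ x hx0 hx).2
      rw [hd] at this
      simpa using hinv x hx0 (by simpa using this)⟩)
    (by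
      intro p hp h hh hp0 hh0 hle
      obtain ⟨h1, h2⟩ := moDeg_spec δ p hp0 hp
      obtain ⟨h3, h4⟩ := moDeg_spec δ h hh0 hh
      obtain ⟨j, hj⟩ := Nat.exists_eq_add_of_le hle
      obtain ⟨T, hT, hT1, hT2⟩ := mo_exT κ δ s hs hδ hκδ A hAδ hAn ht j
      have htoph : (κ ^ j) ((δ ^ moDeg δ h) h) ≠ 0 := by
        intro h0; exact h3 ((κ ^ j).injective (by rw [h0, map_zero]))
      have hkk : ∀ k : ℕ, ∀ y, δ y = 0 → δ ((κ ^ k) y) = 0 := by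
        intro k
        induction k with
        | zero => intro y hy; simpa using hy
        | succ k ih =>
          intro y hy
          rw [pow_succ', AlgEquiv.mul_apply, hκδ, ih y hy]; simp
      have hδtop : δ ((κ ^ j) ((δ ^ moDeg δ h) h)) = 0 := hkk j _ (by
        rw [← Module.End.mul_apply, ← pow_succ']; exact h4)
      obtain ⟨x, hx, hx1, hx2⟩ := mo_top κ δ s hs0 hδ hκδ T j hT1 hT2
        ((moC s (moDeg δ h) j)⁻¹ • (((κ ^ j) ((δ ^ moDeg δ h) h))⁻¹ * (δ ^ moDeg δ p) p)) (by
          rw [map_smul, hδ, hinv _ htoph hδtop, ← Module.End.mul_apply, ← pow_succ', h2]; simp)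
      refine ⟨x * T, ⟨_, hx2⟩, ?_⟩
      apply hlow
      obtain ⟨e1, e2⟩ := mo_leib κ δ s hδ hκδ _ (moDeg δ h) j rfl h (x * T) h4 hx2
      rw [← hj] at e1
      rw [map_sub, e1, hx1, mul_smul_comm, smul_smul, mul_inv_cancel₀ (moC_ne_zero s hs _ _),
        one_smul, mul_inv_cancel_left₀ htoph, sub_self])
    (by
      intro p hp h hh hp0 hh0 hle
      obtain ⟨h1, h2⟩ := moDeg_spec δ p hp0 hp
      obtain ⟨h3, h4⟩ := moDeg_spec δ h hh0 hh
      obtain ⟨j, hj⟩ := Nat.exists_eq_add_of_le hle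
      obtain ⟨T, hT, hT1, hT2⟩ := mo_exT κ δ s hs hδ hκδ A hAδ hAn ht j
      obtain ⟨x, hx, hx1, hx2⟩ := mo_top κ δ s hs0 hδ hκδ T j hT1 hT2
        ((κ ^ (moDeg δ h)).symm ((moC s j (moDeg δ h))⁻¹ • ((δ ^ moDeg δ p) p *
          ((δ ^ moDeg δ h) h)⁻¹))) (mo_ker_symm κ δ s hs0 hκδ _ _ (by
          rw [map_smul, hδ, ← Module.End.mul_apply, ← pow_succ', h2, hinv _ h3 (by
            rw [← Module.End.mul_apply, ← pow_succ']; exact h4)]; simp))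
      refine ⟨x * T, ⟨_, hx2⟩, ?_⟩
      apply hlow
      obtain ⟨e1, e2⟩ := mo_leib κ δ s hδ hκδ _ j (moDeg δ h) rfl (x * T) h hx2 h4
      rw [show j + moDeg δ h = moDeg δ p by omega] at e1
      rw [map_sub, e1, hx1, AlgEquiv.apply_symm_apply, smul_mul_assoc, smul_smul,
        mul_inv_cancel₀ (moC_ne_zero s hs _ _), one_smul, inv_mul_cancel_right₀ h3, sub_self])
    (by
      rintro p ⟨m, hm⟩
      obtain ⟨c, hc, hc0, hcδ, hcp⟩ := mo_den κ δ s hs0 hs hδ hκδ A hAδ hAn ht hfl m p hm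
      exact ⟨c, hc, hc0, ⟨1, by simpa using hinv c hc0 hcδ⟩, hcp⟩)
    hfr hfl a b ha hb hab
  exact fun x hx => this hx
end MODer
section MOLaur
open Polynomial
variable {D : Type} [DivisionRing D] [Algebra ℂ D]

/-- `x` is the value at one of `p`, whose `j`-th coefficient has weight `l + j` -/
def moRep (κ : D ≃ₐ[ℂ] D) (t : ℂ) (l : ℤ) (p : D[X]) (x : D) : Prop :=
  (∀ j : ℕ, κ (p.coeff j) = t ^ (l + j) • p.coeff j) ∧ p.eval 1 = x

theorem moEval_mul (p r : D[X]) : (p * r).eval 1 = p.eval 1 * r.eval 1 := by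
  have := Polynomial.eval₂_mul_noncomm (RingHom.id D) (1 : D) (p := p) (q := r)
    (fun k => Commute.one_right _)
  exact this

theorem moRep_mul {κ : D ≃ₐ[ℂ] D} {t : ℂ} (ht : t ≠ 0) {l l' : ℤ} {p p' : D[X]} {x x' : D}
    (h : moRep κ t l p x) (h' : moRep κ t l' p' x') : moRep κ t (l + l') (p * p') (x * x') := by
  refine ⟨fun j => ?_, by rw [moEval_mul, h.2, h'.2]⟩
  rw [Polynomial.coeff_mul, map_sum, Finset.smul_sum]
  refine Finset.sum_congr rfl fun ab hab => ?_
  rw [map_mul, h.1, h'.1, smul_mul_smul_comm, ← zpow_add₀ ht]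
  congr 2
  have := Finset.HasAntidiagonal.mem_antidiagonal.1 hab
  rw [← this]; push_cast; ring

theorem moRep_shift {κ : D ≃ₐ[ℂ] D} {t : ℂ} {l : ℤ} {p : D[X]} {x : D}
    (h : moRep κ t l p x) (k : ℕ) : moRep κ t (l - k) (p * X ^ k) x := by
  refine ⟨fun j => ?_, ?_⟩
  · rw [Polynomial.coeff_mul_X_pow']
    split_ifs with hk
    · rw [h.1]
      congr 2
      push_cast [Nat.cast_sub hk]; ring
    · simp
  · rw [Polynomial.eval_mul_X_pow, h.2, one_pow, mul_one]

theorem moRep_add {κ : D ≃ₐ[ℂ] D} {t : ℂ} {l : ℤ} {p p' : D[X]} {x x' : D}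
    (h : moRep κ t l p x) (h' : moRep κ t l p' x') : moRep κ t l (p + p') (x + x') := by
  refine ⟨fun j => ?_, by rw [Polynomial.eval_add, h.2, h'.2]⟩
  rw [Polynomial.coeff_add, map_add, h.1, h'.1, smul_add]

theorem moRep_neg {κ : D ≃ₐ[ℂ] D} {t : ℂ} {l : ℤ} {p : D[X]} {x : D}
    (h : moRep κ t l p x) : moRep κ t l (-p) (-x) := by
  refine ⟨fun j => ?_, by rw [Polynomial.eval_neg, h.2]⟩
  rw [Polynomial.coeff_neg, map_neg, h.1, smul_neg]

theorem moRep_C {κ : D ≃ₐ[ℂ] D} {t : ℂ} {l : ℤ} {x : D} (h : κ x = t ^ l • x) :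
    moRep κ t l (C x) x := by
  refine ⟨fun j => ?_, by simp⟩
  rw [Polynomial.coeff_C]
  split_ifs with hj
  · subst hj; simpa using h
  · simp

theorem mo_zpow_inj {t : ℂ} (ht : t ≠ 0) (hroot : ∀ j : ℕ, t ^ (j + 1) ≠ 1) {a b : ℤ}
    (h : t ^ a = t ^ b) : a = b := by
  have key : ∀ c : ℤ, 0 < c → t ^ c ≠ 1 := by
    intro c hc h1
    obtain ⟨m, rfl⟩ : ∃ m : ℕ, c = (m + 1 : ℕ) := ⟨(c - 1).toNat, by omega⟩
    rw [zpow_natCast] at h1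
    exact hroot m h1
  rcases lt_trichotomy a b with hlt | heq | hlt
  · exact absurd (by rw [zpow_sub₀ ht, h, div_self (zpow_ne_zero _ ht)]) (key (b - a) (by omega))
  · exact heq
  · exact absurd (by rw [zpow_sub₀ ht, h, div_self (zpow_ne_zero _ ht)]) (key (a - b) (by omega))

theorem moRep_zero {κ : D ≃ₐ[ℂ] D} {t : ℂ} (ht : t ≠ 0) (hroot : ∀ j : ℕ, t ^ (j + 1) ≠ 1)
    {l : ℤ} {p : D[X]} (h : moRep κ t l p 0) : p = 0 := by
  have hind := Module.End.eigenspaces_iSupIndep (κ.toLinearMap : Module.End ℂ D)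
  have hinj : Function.Injective (fun j : ℕ => t ^ (l + j)) := by
    intro i j hij
    have := mo_zpow_inj ht hroot hij
    omega
  have hind2 := hind.comp hinj
  rw [iSupIndep_iff_finsetSum_eq_zero_imp_eq_zero] at hind2
  have h2 := h.2
  rw [Polynomial.eval_eq_sum, Polynomial.sum] at h2
  have h3 := hind2 p.support p.coeff (fun j _ => by
    rw [Function.comp_apply, Module.End.mem_eigenspace_iff]; exact h.1 j) (by simpa using h2)
  ext j
  by_cases hj : j ∈ p.support
  · simpa using h3 j hj
  · simpa using hj

theorem moRep_unique {κ : D ≃ₐ[ℂ] D} {t : ℂ} (ht : t ≠ 0) (hroot : ∀ j : ℕ, t ^ (j + 1) ≠ 1)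
    {l : ℤ} {p p' : D[X]} {x : D} (h : moRep κ t l p x) (h' : moRep κ t l p' x) : p = p' := by
  have h3 := moRep_add h (moRep_neg h')
  rw [add_neg_cancel] at h3
  have := moRep_zero ht hroot h3
  rwa [add_neg_eq_zero] at this

/-- the subring of sums of weight vectors lying in `B` -/
def moGr (κ : D ≃ₐ[ℂ] D) (t : ℂ) (ht : t ≠ 0) (B : Subring D) : Subring D where
  carrier := {x | ∃ l p, moRep κ t l p x ∧ ∀ j, p.coeff j ∈ B}
  mul_mem' := by
    rintro x y ⟨l, p, h, hB⟩ ⟨l', p', h', hB'⟩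
    refine ⟨_, _, moRep_mul ht h h', fun j => ?_⟩
    rw [Polynomial.coeff_mul]
    exact B.sum_mem fun ab _ => B.mul_mem (hB _) (hB' _)
  one_mem' := ⟨0, C 1, moRep_C (by simp), fun j => by
    rw [Polynomial.coeff_C]; split_ifs
    · exact B.one_mem
    · exact B.zero_mem⟩
  add_mem' := by
    rintro x y ⟨l, p, h, hB⟩ ⟨l', p', h', hB'⟩
    have aux : ∀ (p : D[X]) (k : ℕ), (∀ j, p.coeff j ∈ B) → ∀ j, (p * X ^ k).coeff j ∈ B := by
      intro p k hp j
      rw [Polynomial.coeff_mul_X_pow']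
      split_ifs
      · exact hp _
      · exact B.zero_mem
    have h1 := moRep_shift h (l - min l l').toNat
    have h2 := moRep_shift h' (l' - min l l').toNat
    rw [show l - ((l - min l l').toNat : ℤ) = min l l' by omega] at h1
    rw [show l' - ((l' - min l l').toNat : ℤ) = min l l' by omega] at h2
    refine ⟨_, _, moRep_add h1 h2, fun j => ?_⟩
    rw [Polynomial.coeff_add]
    exact B.add_mem (aux _ _ hB _) (aux _ _ hB' _)
  zero_mem' := ⟨0, C 0, moRep_C (by simp), fun j => by
    rw [Polynomial.coeff_C]; split_ifs <;> exact B.zero_mem⟩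
  neg_mem' := by
    rintro x ⟨l, p, h, hB⟩
    exact ⟨_, _, moRep_neg h, fun j => by rw [Polynomial.coeff_neg]; exact B.neg_mem (hB j)⟩

theorem mo_gr_mem_of_wt {κ : D ≃ₐ[ℂ] D} {t : ℂ} (ht : t ≠ 0) {B : Subring D} {x : D} {l : ℤ}
    (hx : x ∈ B) (h : κ x = t ^ l • x) : x ∈ moGr κ t ht B :=
  ⟨l, C x, moRep_C h, fun j => by
    rw [Polynomial.coeff_C]; split_ifs
    · exact hx
    · exact B.zero_mem⟩

/-- normalised representation, with bounded degree -/
theorem moRep_norm {κ : D ≃ₐ[ℂ] D} {t : ℂ} : ∀ (N : ℕ) {l : ℤ} {p : D[X]} {x : D}, x ≠ 0 →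
    moRep κ t l p x → p.natDegree ≤ N → ∃ l' p', moRep κ t l' p' x ∧ p'.coeff 0 ≠ 0 ∧
      p'.natDegree ≤ N ∧ (p.coeff 0 = 0 → p'.natDegree < N) := by
  intro N
  induction N with
  | zero =>
    intro l p x hx h hN
    by_cases h0 : p.coeff 0 = 0
    · exfalso
      apply hx
      rw [← h.2, Polynomial.eq_C_of_natDegree_le_zero hN, h0]; simp
    · exact ⟨l, p, h, h0, hN, fun h => absurd h h0⟩
  | succ N ih =>
    intro l p x hx h hN
    by_cases h0 : p.coeff 0 = 0
    · have hp : p.divX * X = p := by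
        have := Polynomial.divX_mul_X_add p
        rwa [h0, C_0, add_zero] at this
      have h1 : moRep κ t (l + 1) p.divX x := by
        refine ⟨fun j => ?_, ?_⟩
        · rw [Polynomial.coeff_divX, h.1]
          congr 2
          push_cast; ring
        · have := h.2
          rw [← hp, Polynomial.eval_mul_X, mul_one] at this
          exact this
      obtain ⟨l', p', e1, e2, e3, e4⟩ := ih hx h1 (by rw [Polynomial.natDegree_divX_eq_natDegree_tsub_one]; omega)
      exact ⟨l', p', e1, e2, by omega, fun _ => by omega⟩
    · exact ⟨l, p, h, h0, hN, fun h => absurd h h0⟩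

theorem moRep_norm_unique {κ : D ≃ₐ[ℂ] D} {t : ℂ} (ht : t ≠ 0) (hroot : ∀ j : ℕ, t ^ (j + 1) ≠ 1)
    {l l' : ℤ} {p p' : D[X]} {x : D} (h : moRep κ t l p x) (h' : moRep κ t l' p' x)
    (h0 : p.coeff 0 ≠ 0) (h0' : p'.coeff 0 ≠ 0) : l = l' ∧ p = p' := by
  have key : ∀ {l l' : ℤ} {p p' : D[X]}, moRep κ t l p x → moRep κ t l' p' x →
    p.coeff 0 ≠ 0 → p'.coeff 0 ≠ 0 → l ≤ l' → l = l' := by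
    intro l l' p p' h h' h0 h0' hle
    have h1 := moRep_shift h' (l' - l).toNat
    rw [show l' - ((l' - l).toNat : ℤ) = l by omega] at h1
    have h2 := moRep_unique ht hroot h h1
    by_contra hne
    apply h0
    rw [h2, Polynomial.coeff_mul_X_pow', if_neg (by omega)]
  have hl : l = l' := by
    rcases le_total l l' with hle | hle
    · exact key h h' h0 h0' hle
    · exact (key h' h h0' h0 hle).symm
  subst hl
  exact ⟨rfl, moRep_unique ht hroot h h'⟩

open Classical in
/-- width of a sum of weight vectors -/
noncomputable def moWid (κ : D ≃ₐ[ℂ] D) (t : ℂ) (x : D) : ℕ :=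
  if h : ∃ N : ℕ, ∃ l p, moRep κ t l p x ∧ p.coeff 0 ≠ 0 ∧ p.natDegree = N then h.choose else 0

theorem moWid_eq {κ : D ≃ₐ[ℂ] D} {t : ℂ} (ht : t ≠ 0) (hroot : ∀ j : ℕ, t ^ (j + 1) ≠ 1)
    {l : ℤ} {p : D[X]} {x : D} (h : moRep κ t l p x) (h0 : p.coeff 0 ≠ 0) :
    moWid κ t x = p.natDegree := by
  have hex : ∃ N : ℕ, ∃ l p, moRep κ t l p x ∧ p.coeff 0 ≠ 0 ∧ p.natDegree = N :=
    ⟨_, l, p, h, h0, rfl⟩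
  unfold moWid
  rw [dif_pos hex]
  obtain ⟨l', p', h1, h2, h3⟩ := hex.choose_spec
  rw [← h3, (moRep_norm_unique ht hroot h h1 h0 h2).2]

theorem mo_wt_inv {κ : D ≃ₐ[ℂ] D} {t : ℂ} {x : D} {l : ℤ}
    (h : κ x = t ^ l • x) : κ x⁻¹ = t ^ (-l) • x⁻¹ := by
  rw [map_inv₀, h, zpow_neg]
  rcases eq_or_ne x 0 with rfl | hx
  · simp
  rcases eq_or_ne (t ^ l) 0 with h0 | h0
  · rw [h0]; simp
  apply inv_eq_of_mul_eq_one_left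
  rw [smul_mul_smul_comm, inv_mul_cancel₀ h0, inv_mul_cancel₀ hx, one_smul]

theorem mo_gr_max (κ : D ≃ₐ[ℂ] D) (t : ℂ) (ht : t ≠ 0) (hroot : ∀ j : ℕ, t ^ (j + 1) ≠ 1)
    (A R : Subring D) (hA : A ≤ moGr κ t ht A) (hAR : A ≤ R)
    (hfr : ∀ x : D, ∃ a ∈ A, ∃ b ∈ A, b ≠ 0 ∧ x = a * b⁻¹)
    (hfl : ∀ x : D, ∃ a ∈ A, ∃ b ∈ A, b ≠ 0 ∧ x = b⁻¹ * a)
    (a b : D) (ha : a ≠ 0) (hb : b ≠ 0) (hab : ∀ x ∈ R, a * x * b ∈ A) :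
    R ≤ moGr κ t ht ⊤ := by
  have hnorm : ∀ x ∈ moGr κ t ht ⊤, x ≠ 0 → ∃ l p, moRep κ t l p x ∧ p.coeff 0 ≠ 0 := by
    rintro x ⟨l, p, h, -⟩ hx
    obtain ⟨l', p', e1, e2, -⟩ := moRep_norm _ hx h le_rfl
    exact ⟨l', p', e1, e2⟩
  have hlow : ∀ {l : ℤ} {p : D[X]} {x : D} {N : ℕ}, moRep κ t l p x → p.coeff 0 = 0 →
      p.natDegree ≤ N → x = 0 ∨ moWid κ t x < N := by
    intro l p x N h h0 hN
    by_cases hx : x = 0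
    · exact Or.inl hx
    · right
      obtain ⟨l', p', e1, e2, e3, e4⟩ := moRep_norm N hx h hN
      rw [moWid_eq ht hroot e1 e2]
      exact e4 h0
  -- denominators for homogeneous elements
  have hden0 : ∀ y : D, ∀ m : ℤ, κ y = t ^ m • y → ∃ c ∈ A, c ≠ 0 ∧ (∃ l : ℤ, κ c = t ^ l • c) ∧
      c * y ∈ A := by
    intro y m hy
    obtain ⟨a, ha, c, hc, hc0, hya⟩ := hfl y
    have hcy : c * y = a := by rw [hya, mul_inv_cancel_left₀ hc0]
    obtain ⟨l, p, hp, hpA⟩ := hA hc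
    obtain ⟨l', p', hp', hpA'⟩ := hA ha
    have h1 := moRep_mul ht hp (moRep_C hy)
    rw [hcy] at h1
    have hp0 : p ≠ 0 := by
      rintro rfl
      apply hc0
      rw [← hp.2]; simp
    obtain ⟨j, hj⟩ : ∃ j, p.coeff j ≠ 0 := by
      by_contra hall
      push Not at hall
      exact hp0 (Polynomial.ext (by simpa using hall))
    refine ⟨p.coeff j, hpA j, hj, ⟨_, hp.1 j⟩, ?_⟩
    have hm : ∀ k l'' : ℕ, p * C y * X ^ k = p' * X ^ l'' → p.coeff j * y ∈ A := by
      intro k l'' he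
      have h5 := congrArg (fun r => Polynomial.coeff r (j + k)) he
      simp only [Polynomial.coeff_mul_X_pow, Polynomial.coeff_mul_C] at h5
      rw [h5, Polynomial.coeff_mul_X_pow']
      split_ifs
      · exact hpA' _
      · exact A.zero_mem
    have h3 := moRep_shift h1 (l + m - min (l + m) l').toNat
    have h4 := moRep_shift hp' (l' - min (l + m) l').toNat
    rw [show l + m - ((l + m - min (l + m) l').toNat : ℤ) = min (l + m) l' by omega] at h3
    rw [show l' - ((l' - min (l + m) l').toNat : ℤ) = min (l + m) l' by omega] at h4
    exact hm _ _ (moRep_unique ht hroot h3 h4)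
  refine mo_euclid R (moGr κ t ht ⊤) A (fun x hx => ?_) hAR (moWid κ t) ?_ ?_ ?_ ?_ ?_ hfr hfl a b ha hb hab
  · obtain ⟨l, p, h, -⟩ := hA hx
    exact ⟨l, p, h, fun _ => trivial⟩
  · intro x hx y hy hx0 hy0
    obtain ⟨l, p, h, h0⟩ := hnorm x hx hx0
    obtain ⟨l', p', h', h0'⟩ := hnorm y hy hy0
    rw [moWid_eq ht hroot h h0, moWid_eq ht hroot h' h0', moWid_eq ht hroot (moRep_mul ht h h') (by
      rw [Polynomial.mul_coeff_zero]; exact mul_ne_zero h0 h0'), Polynomial.natDegree_mul]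
    · rintro rfl; simp at h0
    · rintro rfl; simp at h0'
  · intro x hx hx0 hd
    obtain ⟨l, p, h, h0⟩ := hnorm x hx hx0
    rw [moWid_eq ht hroot h h0] at hd
    have hpx : p.coeff 0 = x := by
      rw [← h.2, Polynomial.eq_C_of_natDegree_eq_zero hd]; simp
    have h1 := h.1 0
    rw [hpx] at h1
    exact mo_gr_mem_of_wt ht trivial (mo_wt_inv h1)
  · intro x hx y hy hx0 hy0 hle
    obtain ⟨l, p, h, h0⟩ := hnorm x hx hx0
    obtain ⟨l', p', h', h0'⟩ := hnorm y hy hy0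
    rw [moWid_eq ht hroot h h0, moWid_eq ht hroot h' h0'] at hle
    rw [moWid_eq ht hroot h h0]
    have hr : κ ((p'.coeff 0)⁻¹ * p.coeff 0) = t ^ (-l' + l) • ((p'.coeff 0)⁻¹ * p.coeff 0) := by
      have e1 := mo_wt_inv (h'.1 0)
      have e2 := h.1 0
      rw [map_mul, e1, e2, smul_mul_smul_comm, ← zpow_add₀ ht]
      simp
    refine ⟨_, mo_gr_mem_of_wt ht trivial hr, ?_⟩
    have h3 := moRep_mul ht h' (moRep_C hr)
    rw [show l' + (-l' + l) = l by ring] at h3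
    have h4 := moRep_add h (moRep_neg h3)
    rw [← sub_eq_add_neg x] at h4
    refine hlow h4 ?_ ?_
    · simp [mul_inv_cancel_left₀ h0']
    · refine (Polynomial.natDegree_add_le _ _).trans ?_
      rw [Polynomial.natDegree_neg]
      refine max_le le_rfl ((Polynomial.natDegree_mul_C_le _ _).trans hle)
  · intro x hx y hy hx0 hy0 hle
    obtain ⟨l, p, h, h0⟩ := hnorm x hx hx0
    obtain ⟨l', p', h', h0'⟩ := hnorm y hy hy0
    rw [moWid_eq ht hroot h h0, moWid_eq ht hroot h' h0'] at hle
    rw [moWid_eq ht hroot h h0]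
    have hr : κ (p.coeff 0 * (p'.coeff 0)⁻¹) = t ^ (l + -l') • (p.coeff 0 * (p'.coeff 0)⁻¹) := by
      have e1 := mo_wt_inv (h'.1 0)
      have e2 := h.1 0
      rw [map_mul, e1, e2, smul_mul_smul_comm, ← zpow_add₀ ht]
      simp
    refine ⟨_, mo_gr_mem_of_wt ht trivial hr, ?_⟩
    have h3 := moRep_mul ht (moRep_C hr) h'
    rw [show l + -l' + l' = l by ring] at h3
    have h4 := moRep_add h (moRep_neg h3)
    rw [← sub_eq_add_neg x] at h4
    refine hlow h4 ?_ ?_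
    · simp [inv_mul_cancel_right₀ h0']
    · refine (Polynomial.natDegree_add_le _ _).trans ?_
      rw [Polynomial.natDegree_neg]
      refine max_le le_rfl ((Polynomial.natDegree_C_mul_le _ _).trans hle)
  · rintro x ⟨l, p, h, -⟩
    have key : ∀ s : Finset ℕ, ∃ c ∈ A, c ≠ 0 ∧ (∃ l : ℤ, κ c = t ^ l • c) ∧
        c * (∑ j ∈ s, p.coeff j) ∈ A := by
      intro s
      induction s using Finset.induction_on with
      | empty => exact ⟨1, A.one_mem, one_ne_zero, ⟨0, by simp⟩, by simp [A.zero_mem]⟩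
      | insert i s his ih =>
        obtain ⟨c, hc, hc0, ⟨m, hm⟩, hcs⟩ := ih
        obtain ⟨c', hc', hc'0, ⟨m', hm'⟩, hcs'⟩ := hden0 (c * p.coeff i) (m + (l + i)) (by
          rw [map_mul, hm, h.1, smul_mul_smul_comm, ← zpow_add₀ ht])
        refine ⟨c' * c, A.mul_mem hc' hc, mul_ne_zero hc'0 hc0, ⟨m' + m, by
          rw [map_mul, hm, hm', smul_mul_smul_comm, ← zpow_add₀ ht]⟩, ?_⟩
        rw [Finset.sum_insert his, mul_add, mul_assoc, mul_assoc]
        exact A.add_mem hcs' (A.mul_mem hc' hcs)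
    obtain ⟨c, hc, hc0, ⟨m, hm⟩, hcs⟩ := key p.support
    refine ⟨c, hc, hc0, mo_gr_mem_of_wt ht trivial (mo_wt_inv hm), ?_⟩
    have : x = ∑ j ∈ p.support, p.coeff j := by
      rw [← h.2, Polynomial.eval_eq_sum, Polynomial.sum]; simp
    rw [this]; exact hcs

/-- components of a sum of weight vectors stay in a stable subspace -/
theorem mo_gr_comp (κ : D ≃ₐ[ℂ] D) (t : ℂ) (ht : t ≠ 0) (hroot : ∀ j : ℕ, t ^ (j + 1) ≠ 1)
    (L : Submodule ℂ D) (hL : ∀ x ∈ L, κ x ∈ L) (x : D) (hx : x ∈ L) (hxg : x ∈ moGr κ t ht ⊤) :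
    x ∈ Submodule.span ℂ {z | z ∈ L ∧ ∃ m : ℤ, κ z = t ^ m • z} := by
  obtain ⟨l, p, h, -⟩ := hxg
  have key : ∀ s : Finset ℕ, ∀ y : ℕ → D, (∀ j ∈ s, κ (y j) = t ^ (l + j) • y j) →
      ∑ j ∈ s, y j ∈ L → ∀ j ∈ s, y j ∈ L := by
    intro s
    induction s using Finset.induction_on with
    | empty => simp
    | insert i s his ih =>
      intro y hy hyL
      have h1 : ∑ j ∈ s, (t ^ (l + j) - t ^ (l + i)) • y j ∈ L := by
        have h2 := L.sub_mem (hL _ hyL) (L.smul_mem (t ^ (l + i)) hyL)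
        rw [map_sum, Finset.smul_sum, ← Finset.sum_sub_distrib, Finset.sum_insert his,
          hy i (Finset.mem_insert_self _ _), sub_self, zero_add] at h2
        convert h2 using 1
        refine Finset.sum_congr rfl fun j hj => ?_
        rw [hy j (Finset.mem_insert_of_mem hj), sub_smul]
      have h3 := ih (fun j => (t ^ (l + j) - t ^ (l + i)) • y j) (fun j hj => by
        rw [map_smul, hy j (Finset.mem_insert_of_mem hj), smul_comm]) h1
      have h4 : ∀ j ∈ s, y j ∈ L := by
        intro j hj
        have hne : t ^ (l + j) - t ^ (l + i) ≠ 0 := by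
          intro h0
          have := mo_zpow_inj ht hroot (sub_eq_zero.1 h0)
          have : j = i := by omega
          exact his (this ▸ hj)
        have := L.smul_mem (t ^ (l + j) - t ^ (l + i))⁻¹ (h3 j hj)
        simpa [smul_smul, inv_mul_cancel₀ hne] using this
      intro j hj
      rcases Finset.mem_insert.1 hj with rfl | hj
      · rw [Finset.sum_insert his] at hyL
        have := L.sub_mem hyL (L.sum_mem h4)
        simpa using this
      · exact h4 j hj
  have hxs : x = ∑ j ∈ p.support, p.coeff j := by
    rw [← h.2, Polynomial.eval_eq_sum, Polynomial.sum]; simp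
  rw [hxs] at hx ⊢
  refine Submodule.sum_mem _ fun j hj => Submodule.subset_span ⟨?_, _, h.1 j⟩
  exact key p.support p.coeff (fun j _ => h.1 j) hx j hj

end MOLaur
section MOCart
variable {n : ℕ}

/-- Cartan matrix acting on root coordinates -/
def moA (a : Fin n → Fin n → ℤ) : (Fin n → ℤ) →ₗ[ℤ] (Fin n → ℤ) :=
  Matrix.mulVecLin (Matrix.of a)

/-- pairing of weights and root coordinates -/
def moIn (d : Fin n → ℕ) : (Fin n → ℤ) →ₗ[ℤ] (Fin n → ℤ) →ₗ[ℤ] ℤ :=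
  LinearMap.mk₂ ℤ (fun ν β => ∑ i, (d i : ℤ) * ν i * β i)
    (fun x y z => by rw [← Finset.sum_add_distrib]; exact Finset.sum_congr rfl fun i _ => by simp; ring)
    (fun c x z => by rw [Finset.smul_sum]; exact Finset.sum_congr rfl fun i _ => by simp; ring)
    (fun x y z => by rw [← Finset.sum_add_distrib]; exact Finset.sum_congr rfl fun i _ => by simp; ring)
    (fun c x z => by rw [Finset.smul_sum]; exact Finset.sum_congr rfl fun i _ => by simp; ring)

theorem moA_apply (a : Fin n → Fin n → ℤ) (β : Fin n → ℤ) (i : Fin n) :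
    moA a β i = ∑ j, a i j * β j := rfl

theorem moIn_apply (d : Fin n → ℕ) (ν β : Fin n → ℤ) :
    moIn d ν β = ∑ i, (d i : ℤ) * ν i * β i := rfl

theorem moA_single (a : Fin n → Fin n → ℤ) (i : Fin n) :
    moA a (Pi.single i 1) = fun j => a j i := by
  funext j
  simp [moA_apply, Pi.single_apply]

theorem moIn_single (d : Fin n → ℕ) (ν : Fin n → ℤ) (i : Fin n) :
    moIn d ν (Pi.single i 1) = d i * ν i := by
  simp [moIn_apply, Pi.single_apply]

theorem moIn_symm {a : Fin n → Fin n → ℤ} {d : Fin n → ℕ}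
    (hs : ∀ i j, (d i : ℤ) * a i j = (d j : ℤ) * a j i) (β γ : Fin n → ℤ) :
    moIn d (moA a β) γ = moIn d (moA a γ) β := by
  simp only [moIn_apply, moA_apply, Finset.mul_sum, Finset.sum_mul]
  rw [Finset.sum_comm]
  refine Finset.sum_congr rfl fun i _ => Finset.sum_congr rfl fun j _ => ?_
  linear_combination (β i * γ j) * hs j i

/-- the quadratic function attached to a weight -/
def moF (a : Fin n → Fin n → ℤ) (d : Fin n → ℕ) (μ β : Fin n → ℤ) : ℤ :=
  moIn d (moA a β) β + 2 * moIn d μ β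

theorem moF_sub {a : Fin n → Fin n → ℤ} {d : Fin n → ℕ}
    (hs : ∀ i j, (d i : ℤ) * a i j = (d j : ℤ) * a j i) (μ β γ : Fin n → ℤ) :
    moF a d μ (β - γ) = moF a d μ β - 2 * moIn d (μ + moA a β) γ + moIn d (moA a γ) γ := by
  simp only [moF, map_sub, map_add, LinearMap.sub_apply, LinearMap.add_apply]
  rw [moIn_symm hs γ β]
  ring

theorem moF_refl {a : Fin n → Fin n → ℤ} {d : Fin n → ℕ} (h2 : ∀ i, a i i = 2)
    (hs : ∀ i j, (d i : ℤ) * a i j = (d j : ℤ) * a j i) (μ β : Fin n → ℤ) (i : Fin n) :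
    moF a d μ (β - (μ + moA a β) i • Pi.single i 1) = moF a d μ β := by
  rw [moF_sub hs]
  simp only [map_smul, LinearMap.smul_apply, moIn_single, moA_single, smul_eq_mul, h2]
  ring

/-- simple reflection on weights -/
def moS (a : Fin n → Fin n → ℤ) (i : Fin n) (ν : Fin n → ℤ) : Fin n → ℤ :=
  ν - ν i • moA a (Pi.single i 1)

theorem moS_add (a : Fin n → Fin n → ℤ) (i : Fin n) (μ β : Fin n → ℤ) :
    moS a i (μ + moA a β) = μ + moA a (β - (μ + moA a β) i • Pi.single i 1) := by
  rw [moS, map_sub, map_smul, add_sub]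

/-- simple reflection on root coordinates -/
def moR (a : Fin n → Fin n → ℤ) (i : Fin n) (β : Fin n → ℤ) : Fin n → ℤ :=
  β - (moA a β) i • Pi.single i 1

theorem moIn_refl {a : Fin n → Fin n → ℤ} {d : Fin n → ℕ}
    (hs : ∀ i j, (d i : ℤ) * a i j = (d j : ℤ) * a j i) (ν β : Fin n → ℤ) (i : Fin n) :
    moIn d (moS a i ν) β = moIn d ν (moR a i β) := by
  simp only [moS, moR, map_sub, map_smul, LinearMap.sub_apply, LinearMap.smul_apply, moIn_single,
    moIn_symm hs (Pi.single i 1) β, smul_eq_mul]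
  ring

theorem moR_inj {a : Fin n → Fin n → ℤ} (h2 : ∀ i, a i i = 2) (i : Fin n) :
    Function.Injective (moR a i) := by
  have : Function.LeftInverse (moR a i) (moR a i) := by
    intro β
    have : moA a (moR a i β) i = - moA a β i := by
      simp only [moR, map_sub, map_smul, Pi.sub_apply, Pi.smul_apply, moA_single, smul_eq_mul, h2]
      ring
    rw [moR, this, moR]
    simp
  exact this.injective

/-- `r` strict reflections lead from `ν` to `ν'` -/
inductive MoRed (a : Fin n → Fin n → ℤ) : ℕ → (Fin n → ℤ) → (Fin n → ℤ) → Prop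
  | refl (ν) : MoRed a 0 ν ν
  | step (r ν ν' i) : 0 < ν i → MoRed a r (moS a i ν) ν' → MoRed a (r + 1) ν ν'

/-- the consequences of finite type we use -/
structure MoPos (a : Fin n → Fin n → ℤ) (d : Fin n → ℕ) (b : Fin n → ℤ) : Prop where
  h2 : ∀ i, a i i = 2
  hoff : ∀ i j, i ≠ j → a i j ≤ 0
  hd : ∀ i, 0 < d i
  hs : ∀ i j, (d i : ℤ) * a i j = (d j : ℤ) * a j i
  hb : ∀ i, 0 < b i
  hA : ∀ i, 0 < moA a b i

variable {a : Fin n → Fin n → ℤ} {d : Fin n → ℕ} {b : Fin n → ℤ}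

theorem MoPos.pos (h : MoPos a d b) (β : Fin n → ℤ) :
    ∑ i, (β i : ℚ) ^ 2 ≤ (∑ i, (b i : ℚ)) * (moIn d (moA a β) β : ℚ) := by
  have hb : ∀ i, (0 : ℚ) < b i := fun i => by exact_mod_cast h.hb i
  set M := ∑ i, (b i : ℚ) with hM
  have hMb : ∀ i, (b i : ℚ) ≤ M := fun i =>
    Finset.single_le_sum (fun j _ => (hb j).le) (Finset.mem_univ i)
  set x : Fin n → ℚ := fun i => β i / b i with hx
  have hβ : ∀ i, (β i : ℚ) = x i * b i := fun i => by rw [hx]; field_simp [(hb i).ne']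
  have e1 : (moIn d (moA a β) β : ℚ) = ∑ i, ∑ j, ((d i : ℚ) * a i j) * b i * b j * (x i * x j) := by
    rw [moIn_apply]
    push_cast
    refine Finset.sum_congr rfl fun i _ => ?_
    rw [moA_apply]
    push_cast
    rw [Finset.mul_sum, Finset.sum_mul]
    refine Finset.sum_congr rfl fun j _ => ?_
    rw [hβ i, hβ j]; ring
  have e2 : (∑ i, ∑ j, ((d i : ℚ) * a i j) * b i * b j * (x i * x j))
      = ∑ i, ∑ j, ((d i : ℚ) * a i j) * b i * b j * x i ^ 2
        + ∑ i, ∑ j, (-((d i : ℚ) * a i j)) * b i * b j * (x i - x j) ^ 2 / 2 := by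
    have e3 : ∑ i, ∑ j, ((d i : ℚ) * a i j) * b i * b j * x i ^ 2 =
        ∑ i, ∑ j, ((d i : ℚ) * a i j) * b i * b j * ((x i ^ 2 + x j ^ 2) / 2) := by
      have e4 : ∑ i, ∑ j, ((d i : ℚ) * a i j) * b i * b j * x i ^ 2 =
        ∑ i, ∑ j, ((d i : ℚ) * a i j) * b i * b j * x j ^ 2 := by
        rw [Finset.sum_comm]
        refine Finset.sum_congr rfl fun i _ => Finset.sum_congr rfl fun j _ => ?_
        have : (d i : ℚ) * a i j = d j * a j i := by exact_mod_cast h.hs i j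
        rw [this]; ring
      have e5 : ∀ S T : ℚ, S = T → S = (S + T) / 2 := fun S T h => by rw [h]; ring
      rw [e5 _ _ e4, ← Finset.sum_add_distrib, Finset.sum_div]
      refine Finset.sum_congr rfl fun i _ => ?_
      rw [← Finset.sum_add_distrib, Finset.sum_div]
      refine Finset.sum_congr rfl fun j _ => ?_
      ring
    rw [e3, ← Finset.sum_add_distrib]
    refine Finset.sum_congr rfl fun i _ => ?_
    rw [← Finset.sum_add_distrib]
    refine Finset.sum_congr rfl fun j _ => ?_
    ring
  have e6 : 0 ≤ ∑ i, ∑ j, (-((d i : ℚ) * a i j)) * b i * b j * (x i - x j) ^ 2 / 2 := by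
    refine Finset.sum_nonneg fun i _ => Finset.sum_nonneg fun j _ => ?_
    rcases eq_or_ne i j with rfl | hij
    · simp
    · have h1 : (a i j : ℚ) ≤ 0 := by exact_mod_cast h.hoff i j hij
      have h2 : (0 : ℚ) ≤ -((d i : ℚ) * a i j) := by
        have : (0 : ℚ) ≤ d i := by positivity
        nlinarith
      have := (hb i).le
      have := (hb j).le
      positivity
  have e7 : ∀ i, (β i : ℚ) ^ 2 ≤ M * ∑ j, ((d i : ℚ) * a i j) * b i * b j * x i ^ 2 := by
    intro i
    have e8 : ∑ j, ((d i : ℚ) * a i j) * b i * b j * x i ^ 2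
        = d i * (moA a b i : ℚ) * b i * x i ^ 2 := by
      rw [moA_apply]
      push_cast
      rw [Finset.mul_sum, Finset.sum_mul, Finset.sum_mul]
      refine Finset.sum_congr rfl fun j _ => ?_
      ring
    rw [e8, hβ i]
    have h1 : (1 : ℚ) ≤ d i := by exact_mod_cast h.hd i
    have h3 : (1 : ℚ) ≤ (moA a b i : ℚ) := by exact_mod_cast h.hA i
    have h4 : (1 : ℚ) ≤ d i * (moA a b i : ℚ) := by nlinarith
    have h5 := hMb i
    have h6 := hb i
    have h7 : (b i : ℚ) ≤ M * (d i * (moA a b i : ℚ)) := by nlinarith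
    have h8 : (0 : ℚ) ≤ b i * x i ^ 2 := by positivity
    nlinarith
  have hM0 : 0 ≤ M := Finset.sum_nonneg fun i _ => (hb i).le
  calc ∑ i, (β i : ℚ) ^ 2 ≤ ∑ i, M * ∑ j, ((d i : ℚ) * a i j) * b i * b j * x i ^ 2 :=
        Finset.sum_le_sum fun i _ => e7 i
    _ = M * ∑ i, ∑ j, ((d i : ℚ) * a i j) * b i * b j * x i ^ 2 := by rw [Finset.mul_sum]
    _ ≤ M * (moIn d (moA a β) β : ℚ) := by
        rw [e1, e2]
        exact mul_le_mul_of_nonneg_left (le_add_of_nonneg_right e6) hM0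

theorem MoPos.nonneg (h : MoPos a d b) (β : Fin n → ℤ) : 0 ≤ moIn d (moA a β) β := by
  have h1 := h.pos β
  by_contra hlt
  push Not at hlt
  have h2 : (moIn d (moA a β) β : ℚ) < 0 := by exact_mod_cast hlt
  have h3 : 0 ≤ ∑ i, (β i : ℚ) ^ 2 := Finset.sum_nonneg fun i _ => sq_nonneg _
  have h4 : (0 : ℚ) ≤ ∑ i, (b i : ℚ) := Finset.sum_nonneg fun i _ => by exact_mod_cast (h.hb i).le
  have h5 : ∑ i, (β i : ℚ) ^ 2 = 0 := le_antisymm (by nlinarith) h3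
  rw [Finset.sum_eq_zero_iff_of_nonneg (fun i _ => sq_nonneg _)] at h5
  have h6 : β = 0 := by
    funext i
    have := h5 i (Finset.mem_univ i)
    simpa using this
  rw [h6] at hlt
  simp at hlt

theorem MoPos.inj (h : MoPos a d b) : Function.Injective (moA a) := by
  rw [← LinearMap.ker_eq_bot, LinearMap.ker_eq_bot']
  intro β hβ
  have h1 := h.pos β
  rw [hβ] at h1
  simp only [map_zero, LinearMap.zero_apply, Int.cast_zero, mul_zero] at h1
  have h5 : ∑ i, (β i : ℚ) ^ 2 = 0 := le_antisymm h1 (Finset.sum_nonneg fun i _ => sq_nonneg _)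
  rw [Finset.sum_eq_zero_iff_of_nonneg (fun i _ => sq_nonneg _)] at h5
  funext i
  have := h5 i (Finset.mem_univ i)
  simpa using this

theorem MoPos.finite (h : MoPos a d b) (μ : Fin n → ℤ) (C : ℤ) :
    {β : Fin n → ℤ | moF a d μ β ≤ C}.Finite := by
  set M : ℤ := ∑ i, b i with hM
  have hM0 : 0 ≤ M := Finset.sum_nonneg fun i _ => (h.hb i).le
  set B : ℤ := M * C + ∑ i, (M * (d i * μ i)) ^ 2 with hB
  refine (Set.finite_Icc (fun i => -M * (d i * μ i) - (B + 1)) (fun i => -M * (d i * μ i) + (B + 1))).subset ?_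
  intro β hβ
  have h1 : ∑ i, β i ^ 2 ≤ M * moIn d (moA a β) β := by
    have := h.pos β
    exact_mod_cast this
  have h2 : M * moF a d μ β ≤ M * C := mul_le_mul_of_nonneg_left hβ hM0
  have h3 : ∑ i, (β i + M * (d i * μ i)) ^ 2 ≤ B := by
    have : ∑ i, (β i + M * (d i * μ i)) ^ 2 = ∑ i, β i ^ 2 + 2 * M * moIn d μ β
        + ∑ i, (M * (d i * μ i)) ^ 2 := by
      rw [moIn_apply, Finset.mul_sum, ← Finset.sum_add_distrib, ← Finset.sum_add_distrib]
      refine Finset.sum_congr rfl fun i _ => ?_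
      ring
    rw [this, hB]
    unfold moF at h2
    linarith
  have h4 : ∀ i, (β i + M * (d i * μ i)) ^ 2 ≤ B := fun i =>
    (Finset.single_le_sum (f := fun i => (β i + M * (d i * μ i)) ^ 2)
      (fun j _ => sq_nonneg _) (Finset.mem_univ i)).trans h3
  have h5 : ∀ i, |β i + M * (d i * μ i)| ≤ B + 1 := by
    intro i
    have := h4 i
    rw [abs_le]
    constructor <;> nlinarith [sq_nonneg (β i + M * (d i * μ i) - 1), sq_nonneg (β i + M * (d i * μ i) + 1)]
  constructor
  · intro i
    have := (abs_le.1 (h5 i)).1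
    show -M * (d i * μ i) - (B + 1) ≤ β i
    linarith
  · intro i
    have := (abs_le.1 (h5 i)).2
    show β i ≤ -M * (d i * μ i) + (B + 1)
    linarith

theorem MoPos.chain (h : MoPos a d b) : ∃ N : ℕ, ∀ r ν ν', MoRed a r ν ν' → r < N := by
  classical
  have hfin := h.finite 0 (moF a d 0 b)
  refine ⟨hfin.toFinset.card, fun r ν ν' hr => ?_⟩
  have key : ∃ G : Finset (Fin n → ℤ), (∀ g ∈ G, moF a d 0 g = moF a d 0 b ∧ moIn d ν g ≤ moIn d ν b)
      ∧ G.card = r + 1 := by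
    induction hr with
    | refl ν => exact ⟨{b}, by simp, by simp⟩
    | step r ν ν' i hi _ ih =>
      obtain ⟨G, hG, hc⟩ := ih
      have hlt : ∀ g ∈ G, moIn d ν (moR a i g) < moIn d ν b := by
        intro g hg
        have h1 := (hG g hg).2
        rw [moIn_refl h.hs, moIn_refl h.hs] at h1
        refine lt_of_le_of_lt h1 ?_
        rw [moR, map_sub, map_smul, moIn_single, smul_eq_mul]
        have h3 := h.hA i
        have h4 : (0 : ℤ) < d i := by exact_mod_cast h.hd i
        have : 0 < moA a b i * (d i * ν i) := by positivity
        linarith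
      refine ⟨insert b (G.image (moR a i)), ?_, ?_⟩
      · intro g hg
        rcases Finset.mem_insert.1 hg with rfl | hg
        · exact ⟨rfl, le_rfl⟩
        · obtain ⟨g', hg', rfl⟩ := Finset.mem_image.1 hg
          refine ⟨?_, (hlt g' hg').le⟩
          rw [← (hG g' hg').1]
          have := moF_refl h.h2 h.hs 0 g' i
          rw [zero_add] at this
          exact this
      · rw [Finset.card_insert_of_notMem, Finset.card_image_of_injective _ (moR_inj h.h2 i), hc]
        intro hb
        obtain ⟨g', hg', hgb⟩ := Finset.mem_image.1 hb
        have := hlt g' hg'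
        rw [hgb] at this
        exact lt_irrefl _ this
  obtain ⟨G, hG, hc⟩ := key
  have : G ⊆ hfin.toFinset := fun g hg => by
    rw [Set.Finite.mem_toFinset]
    exact (hG g hg).1.le
  have := Finset.card_le_card this
  omega

theorem MoRed.exists_anti (N : ℕ) : ∀ ν, (∀ r ν', MoRed a r ν ν' → r < N) →
    ∃ r ν', r ≤ N ∧ MoRed a r ν ν' ∧ ∀ i, ν' i ≤ 0 := by
  induction N with
  | zero => intro ν hν; exact absurd (hν 0 ν (.refl ν)) (by omega)
  | succ N ih =>
    intro ν hν
    by_cases hall : ∀ i, ν i ≤ 0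
    · exact ⟨0, ν, by omega, .refl ν, hall⟩
    · push Not at hall
      obtain ⟨i, hi⟩ := hall
      obtain ⟨r, ν', hr, hred, hanti⟩ := ih (moS a i ν) (fun r ν' hr => by
        have := hν _ _ (MoRed.step r ν ν' i hi hr)
        omega)
      exact ⟨r + 1, ν', by omega, .step r ν ν' i hi hred, hanti⟩

end MOCart
section MOMod
variable {n : ℕ}

/-- abstract integrable weight modules -/
structure MoMod (a : Fin n → Fin n → ℤ) (M : Type) [AddCommGroup M] [Module ℂ M] where
  W : (Fin n → ℤ) → Submodule ℂ M
  e : Fin n → Module.End ℂ M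
  f : Fin n → Module.End ℂ M
  c : Fin n → ℤ → ℂ
  ind : iSupIndep W
  eW : ∀ i ν z, z ∈ W ν → e i z ∈ W (ν + moA a (Pi.single i 1))
  fW : ∀ i ν z, z ∈ W ν → f i z ∈ W (ν - moA a (Pi.single i 1))
  enil : ∀ i ν z, z ∈ W ν → ∃ N : ℕ, (e i ^ N) z = 0
  fnil : ∀ i ν z, z ∈ W ν → ∃ N : ℕ, (f i ^ N) z = 0
  comm : ∀ i j ν z, i ≠ j → z ∈ W ν → e i (f j z) = f j (e i z)
  comm' : ∀ i ν z, z ∈ W ν → e i (f i z) = f i (e i z) + c i (ν i) • z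
  cne : ∀ i m, m ≠ 0 → c i m ≠ 0
  c0 : ∀ i, c i 0 = 0
  cneg : ∀ i m, c i (-m) = - c i m
  cid : ∀ i (ν : ℤ) (N : ℕ), c i (ν + 2 * N) + c i N * c i (ν + N - 1) = c i (N + 1) * c i (ν + N)

variable {a : Fin n → Fin n → ℤ} {M : Type} [AddCommGroup M] [Module ℂ M]

/-- exchange the roles of `e` and `f` -/
def MoMod.swap (P : MoMod a M) : MoMod a M where
  W ν := P.W (-ν)
  e := P.f
  f := P.e
  c := P.c
  ind := P.ind.comp neg_injective
  eW i ν z hz := by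
    have := P.fW i _ z hz
    rwa [neg_add, ← sub_eq_add_neg]
  fW i ν z hz := by
    have := P.eW i _ z hz
    rwa [neg_sub, ← neg_add_eq_sub]
  enil i ν z hz := P.fnil i _ z hz
  fnil i ν z hz := P.enil i _ z hz
  comm i j ν z hij hz := (P.comm j i _ z hij.symm hz).symm
  comm' i ν z hz := by
    have := P.comm' i _ z hz
    rw [Pi.neg_apply, P.cneg] at this
    rw [this, add_assoc, ← add_smul]; simp
  cne := P.cne
  c0 := P.c0
  cneg := P.cneg
  cid := P.cid

namespace MoMod
variable (P : MoMod a M)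

theorem epow (i : Fin n) (ν) (z : M) (hz : z ∈ P.W ν) (k : ℕ) :
    (P.e i ^ k) z ∈ P.W (ν + (k : ℤ) • moA a (Pi.single i 1)) := by
  induction k with
  | zero => simpa using hz
  | succ k ih =>
    rw [pow_succ', Module.End.mul_apply]
    have := P.eW i _ _ ih
    rw [add_assoc] at this
    rwa [Nat.cast_succ, add_smul, one_smul]

theorem fpow (i : Fin n) (ν) (z : M) (hz : z ∈ P.W ν) (k : ℕ) :
    (P.f i ^ k) z ∈ P.W (ν - (k : ℤ) • moA a (Pi.single i 1)) := by
  have := P.swap.epow i (-ν) z (by simpa [swap] using hz) k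
  simp only [swap, neg_add, neg_neg] at this
  rwa [sub_eq_add_neg]

theorem sl2 (h2 : ∀ i, a i i = 2) (i : Fin n) (ν) (z : M) (hz : z ∈ P.W ν) (N : ℕ) :
    (P.e i ^ (N + 1)) (P.f i z) = P.f i ((P.e i ^ (N + 1)) z)
      + (P.c i (N + 1) * P.c i (ν i + N)) • (P.e i ^ N) z := by
  induction N with
  | zero =>
    have h1 := P.cid i (ν i) 0
    simp only [Nat.cast_zero, mul_zero, add_zero, P.c0, zero_mul] at h1
    simp only [zero_add, pow_one, Nat.cast_zero, add_zero, pow_zero, Module.End.one_apply]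
    rw [P.comm' i ν z hz]
    rw [zero_add] at h1
    rw [← h1]
  | succ N ih =>
    have e1 : ∀ y k, P.e i ((P.e i ^ k) y) = (P.e i ^ (k + 1)) y := by
      intro y k
      rw [pow_succ' _ k, Module.End.mul_apply]
    rw [← e1 (P.f i z) (N + 1), ih, map_add, map_smul,
      P.comm' i _ _ (P.epow i ν z hz (N + 1)), e1, e1, add_assoc, ← add_smul]
    congr 2
    have h3 := P.cid i (ν i) (N + 1)
    simp only [Pi.add_apply, Pi.smul_apply, moA_single, h2, smul_eq_mul]
    push_cast at h3 ⊢
    rw [show ν i + ((N : ℤ) + 1) * 2 = ν i + 2 * ((N : ℤ) + 1) by ring, ← h3]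
    rw [show ν i + ((N : ℤ) + 1) - 1 = ν i + N by ring]

theorem sl2_ne (h2 : ∀ i, a i i = 2) (i : Fin n) (ν) (z : M) (hz : z ∈ P.W ν) (p : ℕ)
    (h0 : (P.e i ^ (p + 1)) z = 0) (h1 : (P.e i ^ p) z ≠ 0) (j : ℕ)
    (hj : ∀ l < j, ν i + p - l ≠ 0) :
    (P.e i ^ (p + j)) ((P.f i ^ j) z) ≠ 0 ∧ (P.e i ^ (p + j + 1)) ((P.f i ^ j) z) = 0 := by
  induction j with
  | zero => simpa using ⟨h1, h0⟩
  | succ j ih =>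
    obtain ⟨e1, e2⟩ := ih (fun l hl => hj l (by omega))
    have hw := P.fpow i ν z hz j
    have hwi : (ν - (j : ℤ) • moA a (Pi.single i 1)) i = ν i - 2 * j := by
      simp only [Pi.sub_apply, Pi.smul_apply, moA_single, h2, smul_eq_mul]; ring
    rw [pow_succ' (P.f i), Module.End.mul_apply]
    constructor
    · rw [← add_assoc, P.sl2 h2 i _ _ hw, e2, map_zero, zero_add, hwi]
      refine smul_ne_zero (mul_ne_zero (P.cne i _ (by omega)) (P.cne i _ ?_)) e1
      have := hj j (by omega)
      push_cast
      intro h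
      apply this
      linarith
    · rw [← add_assoc, P.sl2 h2 i _ _ hw, e2, pow_succ', Module.End.mul_apply, e2]
      simp

theorem exists_top (i : Fin n) (ν) (z : M) (hz : z ∈ P.W ν) (hz0 : z ≠ 0) :
    ∃ p, (P.e i ^ p) z ≠ 0 ∧ (P.e i ^ (p + 1)) z = 0 := by
  by_contra hcon
  push Not at hcon
  obtain ⟨N, hN⟩ := P.enil i ν z hz
  have : ∀ p, (P.e i ^ p) z ≠ 0 := by
    intro p
    induction p with
    | zero => simpa using hz0
    | succ p ih => exact hcon p ih
  exact this N hN

theorem refl_ne (h2 : ∀ i, a i i = 2) (i : Fin n) (ν) (z : M) (hz : z ∈ P.W ν) (hz0 : z ≠ 0)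
    (hi : 0 ≤ ν i) : (P.f i ^ (ν i).toNat) z ≠ 0 ∧ (P.f i ^ (ν i).toNat) z ∈ P.W (moS a i ν) := by
  obtain ⟨p, hp, hp'⟩ := P.exists_top i ν z hz hz0
  constructor
  · intro h
    apply (P.sl2_ne h2 i ν z hz p hp' hp (ν i).toNat (fun l hl => by omega)).1
    rw [h, map_zero]
  · have := P.fpow i ν z hz (ν i).toNat
    rwa [Int.toNat_of_nonneg hi] at this

/-- highest weights are dominant -/
theorem dominant (h2 : ∀ i, a i i = 2) (i : Fin n) (ν) (z : M) (hz : z ∈ P.W ν) (hz0 : z ≠ 0)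
    (he : P.e i z = 0) : 0 ≤ ν i := by
  by_contra hlt
  push Not at hlt
  obtain ⟨N, hN⟩ := P.fnil i ν z hz
  apply (P.sl2_ne h2 i ν z hz 0 (by simpa using he) (by simpa using hz0) N (fun l hl => by omega)).1
  rw [hN, map_zero]

/-- words -/
def ew (l : List (Fin n)) (z : M) : M := l.foldr (fun i y => P.e i y) z

/-- content of a word -/
def cnt (l : List (Fin n)) : Fin n → ℤ := l.foldr (fun i y => y + Pi.single i 1) 0

theorem ew_mem (l : List (Fin n)) (ν) (z : M) (hz : z ∈ P.W ν) :
    P.ew l z ∈ P.W (ν + moA a (cnt l)) := by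
  induction l with
  | nil => simpa [ew, cnt] using hz
  | cons i l ih =>
    have := P.eW i _ _ ih
    rwa [add_assoc, ← map_add] at this

theorem cnt_nonneg (l : List (Fin n)) (i : Fin n) : 0 ≤ cnt l i := by
  induction l with
  | nil => simp [cnt]
  | cons j l ih =>
    have : cnt (j :: l) i = cnt l i + (Pi.single j 1 : Fin n → ℤ) i := rfl
    rw [this, Pi.single_apply]
    split_ifs <;> omega

theorem cnt_sum (l : List (Fin n)) : ∑ i, cnt l i = l.length := by
  induction l with
  | nil => simp [cnt]
  | cons j l ih =>
    have : cnt (j :: l) = cnt l + Pi.single j 1 := rfl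
    rw [this]
    simp [Finset.sum_add_distrib, ih]

/-- the span of raised vectors -/
def up (S : Set M) : Submodule ℂ M := Submodule.span ℂ {y | ∃ l, ∃ s ∈ S, y = P.ew l s}

theorem subset_up {S : Set M} {s : M} (hs : s ∈ S) : s ∈ P.up S :=
  Submodule.subset_span ⟨[], s, hs, rfl⟩

theorem up_mono {S T : Set M} (h : S ⊆ T) : P.up S ≤ P.up T :=
  Submodule.span_mono (by rintro y ⟨l, s, hs, rfl⟩; exact ⟨l, s, h hs, rfl⟩)

theorem up_e {S : Set M} (i : Fin n) {y : M} (hy : y ∈ P.up S) : P.e i y ∈ P.up S := by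
  induction hy using Submodule.span_induction with
  | mem x hx =>
    obtain ⟨l, s, hs, rfl⟩ := hx
    exact Submodule.subset_span ⟨i :: l, s, hs, rfl⟩
  | zero => simp
  | add x y _ _ hx hy => rw [map_add]; exact Submodule.add_mem _ hx hy
  | smul c x _ hx => rw [map_smul]; exact Submodule.smul_mem _ _ hx

theorem up_f {S : Set M} (hS : ∀ s ∈ S, ∃ ν, s ∈ P.W ν) (i : Fin n)
    (hi : ∀ s ∈ S, P.f i s ∈ P.up S) {y : M} (hy : y ∈ P.up S) : P.f i y ∈ P.up S := by
  induction hy using Submodule.span_induction with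
  | mem x hx =>
    obtain ⟨l, s, hs, rfl⟩ := hx
    obtain ⟨ν, hν⟩ := hS s hs
    induction l with
    | nil => exact hi s hs
    | cons j l ih =>
      have hw := P.ew_mem l ν s hν
      show P.f i (P.e j (P.ew l s)) ∈ _
      rcases eq_or_ne j i with rfl | hji
      · have h1 := P.comm' j _ _ hw
        rw [← sub_eq_iff_eq_add] at h1
        rw [← h1]
        exact Submodule.sub_mem _ (P.up_e _ ih)
          (Submodule.smul_mem _ _ (Submodule.subset_span ⟨l, s, hs, rfl⟩))
      · rw [← P.comm j i _ _ hji hw]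
        exact P.up_e _ ih
  | zero => simp
  | add x y _ _ hx hy => rw [map_add]; exact Submodule.add_mem _ hx hy
  | smul c x _ hx => rw [map_smul]; exact Submodule.smul_mem _ _ hx

theorem wt_in {T : Set M} {Ω : Set (Fin n → ℤ)} (hT : ∀ t ∈ T, ∃ ω ∈ Ω, t ∈ P.W ω) {z : M} {ν}
    (hz : z ∈ P.W ν) (hz0 : z ≠ 0) (hzT : z ∈ Submodule.span ℂ T) : ν ∈ Ω := by
  by_contra hν
  apply hz0
  have h1 : Submodule.span ℂ T ≤ ⨆ j, ⨆ _ : j ≠ ν, P.W j := by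
    rw [Submodule.span_le]
    intro t ht
    obtain ⟨ω, hω, htω⟩ := hT t ht
    have hne : ω ≠ ν := by rintro rfl; exact hν hω
    exact (le_iSup₂_of_le (f := fun j (_ : j ≠ ν) => P.W j) ω hne le_rfl) htω
  exact Submodule.disjoint_def.1 (P.ind ν) z hz (h1 hzT)

/-- iterated lowering of a set -/
def low (x : M) : ℕ → Set M
  | 0 => {x}
  | k + 1 => low x k ∪ {y | ∃ i, ∃ m : ℕ, ∃ s ∈ low x k, y = (P.f i ^ m) s}

theorem low_mono (x : M) {k k' : ℕ} (h : k ≤ k') : P.low x k ⊆ P.low x k' := by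
  induction h with
  | refl => exact subset_rfl
  | step _ ih => exact ih.trans Set.subset_union_left

theorem low_wt (x : M) (μ) (hx : x ∈ P.W μ) (k : ℕ) : ∀ s ∈ P.low x k, ∃ κ, s ∈ P.W (μ - moA a κ) := by
  induction k with
  | zero =>
    rintro s rfl
    exact ⟨0, by simpa using hx⟩
  | succ k ih =>
    rintro s (hs | ⟨i, m, s, hs, rfl⟩)
    · exact ih s hs
    · obtain ⟨κ, hκ⟩ := ih s hs
      refine ⟨κ + (m : ℤ) • Pi.single i 1, ?_⟩
      have := P.fpow i _ s hκ m
      rwa [sub_sub, ← map_smul, ← map_add] at this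

theorem low_fin (x : M) (μ) (hx : x ∈ P.W μ) (k : ℕ) : (P.low x k).Finite := by
  induction k with
  | zero => exact Set.finite_singleton x
  | succ k ih =>
    refine ih.union ?_
    have : {y | ∃ i, ∃ m : ℕ, ∃ s ∈ P.low x k, y = (P.f i ^ m) s}
        ⊆ ⋃ i, ⋃ s ∈ P.low x k, Set.range (fun m : ℕ => (P.f i ^ m) s) := by
      rintro y ⟨i, m, s, hs, rfl⟩
      simp only [Set.mem_iUnion]
      exact ⟨i, s, hs, m, rfl⟩
    refine (Set.finite_iUnion fun i => ih.biUnion fun s hs => ?_).subset this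
    obtain ⟨κ, hκ⟩ := P.low_wt x μ hx k s hs
    obtain ⟨N, hN⟩ := P.fnil i _ s hκ
    refine (((Finset.range N).finite_toSet.image (fun m : ℕ => (P.f i ^ m) s)).union
      (Set.finite_singleton 0)).subset ?_
    rintro y ⟨m, rfl⟩
    rcases lt_or_ge m N with hm | hm
    · exact Or.inl ⟨m, by simpa using hm, rfl⟩
    · right
      obtain ⟨j, rfl⟩ := Nat.exists_eq_add_of_le hm
      show (P.f i ^ (N + j)) s = 0
      rw [add_comm, pow_add, Module.End.mul_apply, hN, map_zero]

theorem low_step (x : M) (μ) (hx : x ∈ P.W μ) (k : ℕ) (i : Fin n) (m : ℕ) (y : M)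
    (hy : y ∈ P.up (P.low x k)) : (P.f i ^ m) y ∈ P.up (P.low x (k + 1)) := by
  set S' : Set M := {y | ∃ m : ℕ, ∃ s ∈ P.low x k, y = (P.f i ^ m) s} with hS'
  have h1 : P.low x k ⊆ S' := fun s hs => ⟨0, s, hs, by simp⟩
  have h2 : S' ⊆ P.low x (k + 1) := by
    rintro y ⟨m, s, hs, rfl⟩
    exact Or.inr ⟨i, m, s, hs, rfl⟩
  have h3 : ∀ y ∈ P.up S', P.f i y ∈ P.up S' := by
    intro y hy
    refine P.up_f (fun s hs => ?_) i ?_ hy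
    · obtain ⟨κ, hκ⟩ := P.low_wt x μ hx (k + 1) s (h2 hs)
      exact ⟨_, hκ⟩
    · rintro _ ⟨m, s, hs, rfl⟩
      refine P.subset_up ⟨m + 1, s, hs, ?_⟩
      rw [pow_succ', Module.End.mul_apply]
  refine P.up_mono h2 ?_
  induction m with
  | zero => simpa using P.up_mono h1 hy
  | succ m ih => rw [pow_succ', Module.End.mul_apply]; exact h3 _ ih

theorem reach {d : Fin n → ℕ} {b : Fin n → ℤ} (H : MoPos a d b) (x : M) (μ) (hx : x ∈ P.W μ)
    (r : ℕ) (ν ν') (hr : MoRed a r ν ν') : ∀ (k : ℕ) (β : Fin n → ℤ) (z : M), ν = μ + moA a β →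
      z ∈ P.W ν → z ≠ 0 → z ∈ P.up (P.low x k) → ∃ β' z', ν' = μ + moA a β' ∧
        moF a d μ β' = moF a d μ β ∧ z' ∈ P.W ν' ∧ z' ≠ 0 ∧ z' ∈ P.up (P.low x (k + r)) := by
  induction hr with
  | refl ν =>
    intro k β z hν hz hz0 hzk
    exact ⟨β, z, hν, rfl, hz, hz0, hzk⟩
  | step r ν ν' i hi _ ih =>
    intro k β z hν hz hz0 hzk
    obtain ⟨e1, e2⟩ := P.refl_ne H.h2 i ν z hz hz0 hi.le
    obtain ⟨β', z', h1, h2, h3, h4, h5⟩ := ih (k + 1) (β - (μ + moA a β) i • Pi.single i 1) _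
      (by rw [hν]; exact moS_add a i μ β) e2 e1 (P.low_step x μ hx k i _ z hzk)
    refine ⟨β', z', h1, by rw [h2]; exact moF_refl H.h2 H.hs μ β i, h3, h4, ?_⟩
    rwa [show k + (r + 1) = k + 1 + r by omega]

theorem up_fd {d : Fin n → ℕ} {b : Fin n → ℤ} (H : MoPos a d b) (x : M) (μ) (hx : x ∈ P.W μ) :
    ∃ L : ℕ, ∀ l, L < l.length → P.ew l x = 0 := by
  obtain ⟨N, hN⟩ := H.chain
  choose! κ hκ using P.low_wt x μ hx N
  obtain ⟨C, hC⟩ := ((P.low_fin x μ hx N).image (fun s => moF a d μ (-κ s))).bddAbove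
  have key : ∀ l, P.ew l x ≠ 0 → moF a d μ (cnt l) ≤ C := by
    intro l hl
    have hw := P.ew_mem l μ x hx
    obtain ⟨r, ν', hrN, hred, hanti⟩ := MoRed.exists_anti (a := a) N (μ + moA a (cnt l))
      (fun r ν' h => hN r _ ν' h)
    obtain ⟨β', z', h1, h2, h3, h4, h5⟩ := P.reach H x μ hx r _ ν' hred 0 (cnt l) (P.ew l x) rfl hw hl
      (Submodule.subset_span ⟨l, x, rfl, rfl⟩)
    have h6 := P.up_mono (P.low_mono x (show 0 + r ≤ N by omega)) h5
    have h7 := P.wt_in (Ω := {ω | ∃ s ∈ P.low x N, ∃ l, ω = μ - moA a (κ s) + moA a (cnt l)}) (by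
      rintro _ ⟨l, s, hs, rfl⟩
      exact ⟨_, ⟨s, hs, l, rfl⟩, P.ew_mem l _ s (hκ s hs)⟩) h3 h4 h6
    obtain ⟨s, hs, l', hl'⟩ := h7
    have h8 : β' - cnt l' = - κ s := by
      apply H.inj
      rw [map_sub, map_neg]
      rw [h1] at hl'
      have : moA a β' = -moA a (κ s) + moA a (cnt l') := by
        have := congrArg (fun t => t - μ) hl'
        simp only [add_sub_cancel_left] at this
        rw [this]; abel
      rw [this]; abel
    have h9 := moF_sub H.hs μ β' (cnt l')
    rw [h8, ← h1] at h9
    have h10 : moIn d ν' (cnt l') ≤ 0 := by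
      rw [moIn_apply]
      refine Finset.sum_nonpos fun i _ => ?_
      have e1 := hanti i
      have e2 := cnt_nonneg l' i
      have e3 : (0 : ℤ) ≤ d i := by positivity
      have e4 : (d i : ℤ) * ν' i ≤ 0 := by nlinarith
      nlinarith
    have h11 := H.nonneg (cnt l')
    have h12 : moF a d μ (-κ s) ≤ C := hC ⟨s, hs, rfl⟩
    rw [← h2]
    linarith
  have hfin := H.finite μ C
  obtain ⟨L, hL⟩ := (hfin.image (fun β => ∑ i, β i)).bddAbove
  refine ⟨L.toNat, fun l hl => ?_⟩
  by_contra hne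
  have h1 : ∑ i, cnt l i ≤ L := hL ⟨cnt l, key l hne, rfl⟩
  rw [cnt_sum] at h1
  omega

theorem finite_words (L : ℕ) : {l : List (Fin n) | l.length ≤ L}.Finite :=
  List.finite_length_le _ L

theorem exists_fd {d : Fin n → ℕ} {b : Fin n → ℤ} (H : MoPos a d b) (x : M) (μ) (hx : x ∈ P.W μ) :
    ∃ T : Set M, T.Finite ∧ (∀ t ∈ T, ∃ ω, t ∈ P.W ω) ∧ x ∈ Submodule.span ℂ T ∧
      (∀ i, ∀ y ∈ Submodule.span ℂ T, P.e i y ∈ Submodule.span ℂ T) ∧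
      (∀ i, ∀ y ∈ Submodule.span ℂ T, P.f i y ∈ Submodule.span ℂ T) := by
  obtain ⟨L, hL⟩ := P.up_fd H x μ hx
  set S : Set M := (fun l => P.ew l x) '' {l : List (Fin n) | l.length ≤ L} with hS
  have hSf : S.Finite := (finite_words L).image _
  have hSw : ∀ s ∈ S, ∃ ω, s ∈ P.W ω := by
    rintro _ ⟨l, -, rfl⟩
    exact ⟨_, P.ew_mem l μ x hx⟩
  have hSw' : ∀ s ∈ S, ∃ ω, s ∈ P.swap.W ω := by
    intro s hs
    obtain ⟨ω, h⟩ := hSw s hs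
    exact ⟨-ω, by simpa [swap] using h⟩
  have hSe : ∀ i, ∀ s ∈ S, P.e i s ∈ P.swap.up S := by
    rintro i _ ⟨l, hl, rfl⟩
    by_cases hlen : l.length + 1 ≤ L
    · exact P.swap.subset_up ⟨i :: l, by simpa using hlen, rfl⟩
    · have : P.e i (P.ew l x) = 0 := hL (i :: l) (by simp; omega)
      simp only [this, Submodule.zero_mem]
  have hb : ∀ s ∈ S, ∃ L' : ℕ, ∀ l, L' < l.length → P.swap.ew l s = 0 := by
    intro s hs
    obtain ⟨ω, h⟩ := hSw' s hs
    exact P.swap.up_fd H s ω h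
  choose! L' hL' using hb
  set T : Set M := ⋃ s ∈ S, (fun l => P.swap.ew l s) '' {l : List (Fin n) | l.length ≤ L' s} with hT
  have hTs : Submodule.span ℂ T = P.swap.up S := by
    apply le_antisymm
    · apply Submodule.span_mono
      intro t ht
      simp only [hT, Set.mem_iUnion] at ht
      obtain ⟨s, hs, l, -, rfl⟩ := ht
      exact ⟨l, s, hs, rfl⟩
    · rw [up, Submodule.span_le]
      rintro _ ⟨l, s, hs, rfl⟩
      by_cases hl : l.length ≤ L' s
      · apply Submodule.subset_span
        simp only [hT, Set.mem_iUnion]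
        exact ⟨s, hs, l, hl, rfl⟩
      · rw [hL' s hs l (by omega)]
        exact Submodule.zero_mem _
  refine ⟨T, ?_, ?_, ?_, ?_, ?_⟩
  · exact hSf.biUnion fun s _ => (finite_words _).image _
  · intro t ht
    simp only [hT, Set.mem_iUnion] at ht
    obtain ⟨s, hs, l, -, rfl⟩ := ht
    obtain ⟨ω, h⟩ := hSw' s hs
    exact ⟨_, P.swap.ew_mem l ω s h⟩
  · rw [hTs]
    exact P.swap.subset_up ⟨[], by simp, rfl⟩
  · rw [hTs]
    intro i y hy
    exact P.swap.up_f hSw' i (hSe i) hy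
  · rw [hTs]
    intro i y hy
    exact P.swap.up_e i hy

end MoMod
end MOMod
section MOBuild

theorem mo_transc_root {q : ℂ} (hq : Transcendental ℚ q) : q ≠ 0 ∧ ∀ j : ℕ, q ^ (j + 1) ≠ 1 := by
  refine ⟨fun h => hq (h ▸ isAlgebraic_zero), fun j h => ?_⟩
  have h2 : Transcendental ℚ (q ^ (j + 1)) := hq.pow (Nat.succ_pos j)
  rw [h] at h2
  exact h2 isAlgebraic_one

theorem mo_pow_root {q : ℂ} (h : ∀ j : ℕ, q ^ (j + 1) ≠ 1) {m : ℕ} (hm : 0 < m) :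
    ∀ j : ℕ, (q ^ (m : ℤ)) ^ (j + 1) ≠ 1 := by
  intro j
  obtain ⟨m, rfl⟩ := Nat.exists_eq_succ_of_ne_zero hm.ne'
  rw [zpow_natCast, ← pow_mul]
  have := h (m * (j + 1) + j)
  convert this using 2
  simp only [Nat.succ_eq_add_one]; ring

/-- quantum integers -/
noncomputable def moQn (t : ℂ) (m : ℤ) : ℂ := (t - t⁻¹)⁻¹ * (t ^ m - t ^ (-m))

theorem mo_sub_inv_ne {t : ℂ} (h0 : t ≠ 0) (h : ∀ j : ℕ, t ^ (j + 1) ≠ 1) : t - t⁻¹ ≠ 0 := by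
  intro h1
  have := @mo_zpow_inj t h0 h 1 (-1) (by simpa [sub_eq_zero] using h1)
  omega

theorem moQn_ne {t : ℂ} (h0 : t ≠ 0) (h : ∀ j : ℕ, t ^ (j + 1) ≠ 1) (m : ℤ) (hm : m ≠ 0) :
    moQn t m ≠ 0 := by
  refine mul_ne_zero (inv_ne_zero (mo_sub_inv_ne h0 h)) ?_
  intro h1
  have := mo_zpow_inj h0 h (sub_eq_zero.1 h1)
  omega

theorem moQn_id {t : ℂ} (h0 : t ≠ 0) (h : ∀ j : ℕ, t ^ (j + 1) ≠ 1) (ν N : ℤ) :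
    moQn t (ν + 2 * N) + moQn t N * moQn t (ν + N - 1) = moQn t (N + 1) * moQn t (ν + N) := by
  have h1 := mo_sub_inv_ne h0 h
  have key : (t - t⁻¹) * (t ^ (ν + 2 * N) - t ^ (-(ν + 2 * N))) +
    (t ^ N - t ^ (-N)) * (t ^ (ν + N - 1) - t ^ (-(ν + N - 1))) =
    (t ^ (N + 1) - t ^ (-(N + 1))) * (t ^ (ν + N) - t ^ (-(ν + N))) := by
    have e1 : t ^ (ν + 2 * N) = t ^ ν * t ^ N * t ^ N := by rw [two_mul, zpow_add₀ h0, zpow_add₀ h0]; ring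
    have e2 : t ^ (ν + N - 1) = t ^ ν * t ^ N * t⁻¹ := by rw [zpow_sub₀ h0, zpow_add₀ h0]; simp [div_eq_mul_inv]
    have e3 : t ^ (ν + N) = t ^ ν * t ^ N := by rw [zpow_add₀ h0]
    have e4 : t ^ (N + 1) = t ^ N * t := by rw [zpow_add₀ h0]; simp
    simp only [zpow_neg, e1, e2, e3, e4]
    have : t ^ ν ≠ 0 := zpow_ne_zero _ h0
    have : t ^ N ≠ 0 := zpow_ne_zero _ h0
    field_simp
    ring
  unfold moQn
  calc _ = (t - t⁻¹)⁻¹ * (t - t⁻¹)⁻¹ * ((t - t⁻¹) * (t ^ (ν + 2 * N) - t ^ (-(ν + 2 * N))) +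
    (t ^ N - t ^ (-N)) * (t ^ (ν + N - 1) - t ^ (-(ν + N - 1)))) := by
        rw [mul_add, mul_assoc _ _ ((t - t⁻¹) * _), inv_mul_cancel_left₀ h1]; ring
    _ = _ := by rw [key]; ring

variable {n : ℕ}

/-- joint eigenspaces -/
noncomputable def moW (q : ℂ) (d : Fin n → ℕ) {M : Type} [AddCommGroup M] [Module ℂ M]
    (κ : Fin n → Module.End ℂ M) (ν : Fin n → ℤ) : Submodule ℂ M :=
  ⨅ i, LinearMap.ker (κ i - (q ^ (ν i * (d i : ℤ))) • (1 : Module.End ℂ M))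

theorem mem_moW {q : ℂ} {d : Fin n → ℕ} {M : Type} [AddCommGroup M] [Module ℂ M]
    {κ : Fin n → Module.End ℂ M} {ν : Fin n → ℤ} {z : M} :
    z ∈ moW q d κ ν ↔ ∀ i, κ i z = q ^ (ν i * (d i : ℤ)) • z := by
  simp [moW, Submodule.mem_iInf, sub_eq_zero]

theorem moW_ind {q : ℂ} (h0 : q ≠ 0) (hr : ∀ j : ℕ, q ^ (j + 1) ≠ 1) {d : Fin n → ℕ}
    (hd : ∀ i, 0 < d i) {M : Type} [AddCommGroup M] [Module ℂ M]
    (κ : Fin n → Module.End ℂ M) (hκ : ∀ i j, κ i * κ j = κ j * κ i) : iSupIndep (moW q d κ) := by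
  have h1 := Module.End.independent_iInf_maxGenEigenspace_of_forall_mapsTo κ
    (fun i j φ => Module.End.mapsTo_maxGenEigenspace_of_comm (hκ j i) φ)
  have h2 : Function.Injective (fun (ν : Fin n → ℤ) (i : Fin n) => q ^ (ν i * (d i : ℤ))) := by
    intro ν ν' h
    funext i
    have := mo_zpow_inj h0 hr (congrFun h i)
    have hdi := hd i
    exact mul_right_cancel₀ (by exact_mod_cast hdi.ne') this
  refine (h1.comp h2).mono fun ν => ?_
  refine iInf_mono fun i => ?_
  exact Module.End.eigenspace_le_maxGenEigenspace.trans' (le_of_eq (by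
    ext z; simp [sub_eq_zero]))

/-- builder for integrable modules -/
noncomputable def moBuild {q : ℂ} (h0 : q ≠ 0) (hr : ∀ j : ℕ, q ^ (j + 1) ≠ 1)
    {a : Fin n → Fin n → ℤ} {d : Fin n → ℕ} (hd : ∀ i, 0 < d i) {M : Type} [AddCommGroup M]
    [Module ℂ M] (κ κ' e f : Fin n → Module.End ℂ M) (L : Submodule ℂ M)
    (hκ : ∀ i j, κ i * κ j = κ j * κ i) (hκ' : ∀ i, κ' i * κ i = 1)
    (hκe : ∀ i j z, κ i (e j z) = q ^ ((d i : ℤ) * a i j) • e j (κ i z))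
    (hκf : ∀ i j z, κ i (f j z) = q ^ (-((d i : ℤ) * a i j)) • f j (κ i z))
    (hef : ∀ i j z, e i (f j z) - f j (e i z) = if i = j then
      (q ^ (d i : ℤ) - q ^ (-(d i : ℤ)))⁻¹ • (κ i z - κ' i z) else 0)
    (hLe : ∀ i, ∀ z ∈ L, e i z ∈ L) (hLf : ∀ i, ∀ z ∈ L, f i z ∈ L)
    (hen : ∀ i ν z, z ∈ L → z ∈ moW q d κ ν → ∃ N : ℕ, (e i ^ N) z = 0)
    (hfn : ∀ i ν z, z ∈ L → z ∈ moW q d κ ν → ∃ N : ℕ, (f i ^ N) z = 0) : MoMod a M where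
  W ν := L ⊓ moW q d κ ν
  e := e
  f := f
  c i m := moQn (q ^ (d i : ℤ)) m
  ind := (moW_ind h0 hr hd κ hκ).mono fun ν => inf_le_right
  eW i ν z hz := by
    refine ⟨hLe i z hz.1, ?_⟩
    have h2 := mem_moW.1 hz.2
    refine mem_moW.2 ?_
    intro j
    rw [hκe, h2, map_smul, smul_smul, ← zpow_add₀ h0, moA_single]
    congr 2
    simp only [Pi.add_apply]; ring
  fW i ν z hz := by
    refine ⟨hLf i z hz.1, ?_⟩
    have h2 := mem_moW.1 hz.2
    refine mem_moW.2 ?_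
    intro j
    rw [hκf, h2, map_smul, smul_smul, ← zpow_add₀ h0, moA_single]
    congr 2
    simp only [Pi.sub_apply]; ring
  enil i ν z hz := hen i ν z hz.1 hz.2
  fnil i ν z hz := hfn i ν z hz.1 hz.2
  comm i j ν z hij hz := by
    have := hef i j z
    rw [if_neg hij] at this
    exact sub_eq_zero.1 this
  comm' i ν z hz := by
    have h := hef i i z
    rw [if_pos rfl, sub_eq_iff_eq_add'] at h
    rw [h]
    congr 1
    have h2 := mem_moW.1 hz.2 i
    have h3 : κ' i z = q ^ (-(ν i * (d i : ℤ))) • z := by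
      have h4 : κ' i (κ i z) = z := by rw [← Module.End.mul_apply, hκ' i, Module.End.one_apply]
      rw [h2, map_smul] at h4
      rw [zpow_neg, eq_inv_smul_iff₀ (zpow_ne_zero _ h0), h4]
    rw [h2, h3, ← sub_smul, smul_smul]
    congr 1
    unfold moQn
    rw [← zpow_mul, ← zpow_mul, zpow_neg q (d i : ℤ)]
    rw [show (d i : ℤ) * ν i = ν i * (d i : ℤ) by ring,
      show (d i : ℤ) * -ν i = -(ν i * (d i : ℤ)) by ring]
  cne i m hm := moQn_ne (zpow_ne_zero _ h0) (mo_pow_root hr (hd i)) m hm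
  c0 i := by simp [moQn]
  cneg i m := by simp only [moQn, neg_neg]; ring
  cid i ν N := by
    have := moQn_id (zpow_ne_zero (d i : ℤ) h0) (mo_pow_root hr (hd i)) ν N
    exact_mod_cast this

end MOBuild
section MORep

/-- numerical context -/
structure MoCtx (q : ℂ) {n : ℕ} (a : Fin n → Fin n → ℤ) (d : Fin n → ℕ) : Prop where
  h0 : q ≠ 0
  hr : ∀ j : ℕ, q ^ (j + 1) ≠ 1
  h2 : ∀ i, a i i = 2
  hoff : ∀ i j, i ≠ j → a i j ≤ 0
  hd : ∀ i, 0 < d i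
  hs : ∀ i j, (d i : ℤ) * a i j = (d j : ℤ) * a j i

variable {q : ℂ} {n : ℕ} {a : Fin n → Fin n → ℤ} {d : Fin n → ℕ} (C : MoCtx q a d)
include C

theorem mo_wt_shift (i : Fin n) (ν : Fin n → ℤ) :
    Function.Injective (fun k : ℕ => ν + (k : ℤ) • moA a (Pi.single i 1)) := by
  intro k l h
  have := congrFun h i
  simp only [moA_single, Pi.add_apply, Pi.smul_apply, C.h2, smul_eq_mul] at this
  omega

theorem mo_fd_nil {M : Type} [AddCommGroup M] [Module ℂ M] [FiniteDimensional ℂ M]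
    (W : (Fin n → ℤ) → Submodule ℂ M) (hW : iSupIndep W) (i : Fin n) (s : ℤ) (hs : s ≠ 0)
    (e : Module.End ℂ M)
    (he : ∀ ν z, z ∈ W ν → e z ∈ W (ν + s • moA a (Pi.single i 1))) (ν z) (hz : z ∈ W ν) :
    ∃ N : ℕ, (e ^ N) z = 0 := by
  by_contra hcon
  push Not at hcon
  have h1 : ∀ k : ℕ, (e ^ k) z ∈ W (ν + ((k : ℤ) * s) • moA a (Pi.single i 1)) := by
    intro k
    induction k with
    | zero => simpa using hz
    | succ k ih =>
      rw [pow_succ', Module.End.mul_apply]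
      have := he _ _ ih
      rw [add_assoc, ← add_smul] at this
      convert this using 3
      push_cast; ring
  have hfin : {ν | W ν ≠ ⊥}.Finite := WellFoundedGT.finite_ne_bot_of_iSupIndep hW
  have hinj : Function.Injective (fun k : ℕ => ν + ((k : ℤ) * s) • moA a (Pi.single i 1)) := by
    intro k l h
    have := congrFun h i
    simp only [moA_single, Pi.add_apply, Pi.smul_apply, C.h2, smul_eq_mul, add_right_inj] at this
    have h3 := mul_right_cancel₀ hs (mul_right_cancel₀ two_ne_zero this)
    exact_mod_cast h3
  have h2 : Set.range (fun k : ℕ => ν + ((k : ℤ) * s) • moA a (Pi.single i 1)) ⊆ {ν | W ν ≠ ⊥} := by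
    rintro _ ⟨k, rfl⟩ hbot
    have := h1 k
    simp only at hbot
    rw [hbot, Submodule.mem_bot] at this
    exact hcon k this
  exact Set.infinite_range_of_injective hinj (hfin.subset h2)

theorem mo_hef {U : Type} [Ring U] [Algebra ℂ U] {E F : Fin n → U} {K : Fin n → Uˣ}
    (hrel : UqRels q a d U E F K) {X : Type} [AddCommGroup X] [Module ℂ X]
    (ρ : U →ₐ[ℂ] Module.End ℂ X) (i j : Fin n) (z : X) :
    ρ (E i) (ρ (F j) z) - ρ (F j) (ρ (E i) z) = if i = j then
      (q ^ (d i : ℤ) - q ^ (-(d i : ℤ)))⁻¹ • (ρ (K i : U) z - ρ ((K i)⁻¹ : Uˣ) z) else 0 := by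
  have h := congrArg (fun u => ρ u z) (hrel.2.2.2.1 i j)
  simp only [map_sub, map_mul, LinearMap.sub_apply, Module.End.mul_apply] at h
  rw [h]
  split_ifs <;> simp

theorem mo_hκe {U : Type} [Ring U] [Algebra ℂ U] {E F : Fin n → U} {K : Fin n → Uˣ}
    (hrel : UqRels q a d U E F K) {X : Type} [AddCommGroup X] [Module ℂ X]
    (ρ : U →ₐ[ℂ] Module.End ℂ X) (i j : Fin n) (z : X) :
    ρ (K i : U) (ρ (E j) z) = q ^ ((d i : ℤ) * a i j) • ρ (E j) (ρ (K i : U) z) := by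
  have h := congrArg (fun u => ρ u z) (hrel.2.1 i j)
  simpa only [map_smul, map_mul, LinearMap.smul_apply, Module.End.mul_apply] using h

theorem mo_hκf {U : Type} [Ring U] [Algebra ℂ U] {E F : Fin n → U} {K : Fin n → Uˣ}
    (hrel : UqRels q a d U E F K) {X : Type} [AddCommGroup X] [Module ℂ X]
    (ρ : U →ₐ[ℂ] Module.End ℂ X) (i j : Fin n) (z : X) :
    ρ (K i : U) (ρ (F j) z) = q ^ (-((d i : ℤ) * a i j)) • ρ (F j) (ρ (K i : U) z) := by
  have h := congrArg (fun u => ρ u z) (hrel.2.2.1 i j)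
  simpa only [map_smul, map_mul, LinearMap.smul_apply, Module.End.mul_apply] using h

/-- finite-dimensional representations give integrable modules -/
noncomputable def moRepMod {U : Type} [Ring U] [Algebra ℂ U] {E F : Fin n → U} {K : Fin n → Uˣ}
    (hrel : UqRels q a d U E F K) {X : Type} [AddCommGroup X] [Module ℂ X] [FiniteDimensional ℂ X]
    (ρ : U →ₐ[ℂ] Module.End ℂ X) : MoMod a X := by
  have hκ : ∀ i j, ρ (K i : U) * ρ (K j : U) = ρ (K j : U) * ρ (K i : U) := fun i j => by
    rw [← map_mul, hrel.1 i j, map_mul]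
  have hind := moW_ind C.h0 C.hr C.hd (fun i => ρ (K i : U)) hκ
  exact moBuild C.h0 C.hr C.hd (fun i => ρ (K i : U)) (fun i => ρ ((K i)⁻¹ : Uˣ)) (fun i => ρ (E i))
    (fun i => ρ (F i)) ⊤ hκ (fun i => by rw [← map_mul]; simp)
    (mo_hκe C hrel ρ) (mo_hκf C hrel ρ) (mo_hef C hrel ρ) (fun _ _ _ => trivial) (fun _ _ _ => trivial)
    (fun i ν z _ hz => mo_fd_nil C _ hind i 1 one_ne_zero (ρ (E i)) (by
      intro ν z hz
      have h2 := mem_moW.1 hz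
      refine mem_moW.2 fun j => ?_
      rw [mo_hκe C hrel ρ, h2, map_smul, smul_smul, ← zpow_add₀ C.h0, moA_single]
      congr 2
      simp only [Pi.add_apply, Pi.smul_apply, smul_eq_mul]; ring) ν z hz)
    (fun i ν z _ hz => mo_fd_nil C _ hind i (-1) (by norm_num) (ρ (F i)) (by
      intro ν z hz
      have h2 := mem_moW.1 hz
      refine mem_moW.2 fun j => ?_
      rw [mo_hκf C hrel ρ, h2, map_smul, smul_smul, ← zpow_add₀ C.h0, moA_single]
      congr 2
      simp only [Pi.add_apply, Pi.smul_apply, smul_eq_mul]; ring) ν z hz)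

theorem moRepMod_W {U : Type} [Ring U] [Algebra ℂ U] {E F : Fin n → U} {K : Fin n → Uˣ}
    (hrel : UqRels q a d U E F K) {X : Type} [AddCommGroup X] [Module ℂ X] [FiniteDimensional ℂ X]
    (ρ : U →ₐ[ℂ] Module.End ℂ X) (ν) : (moRepMod C hrel ρ).W ν = wtSp q d K ρ ν := top_inf_eq _

theorem moRepMod_e {U : Type} [Ring U] [Algebra ℂ U] {E F : Fin n → U} {K : Fin n → Uˣ}
    (hrel : UqRels q a d U E F K) {X : Type} [AddCommGroup X] [Module ℂ X] [FiniteDimensional ℂ X]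
    (ρ : U →ₐ[ℂ] Module.End ℂ X) (i) : (moRepMod C hrel ρ).e i = ρ (E i) := rfl

theorem moRepMod_f {U : Type} [Ring U] [Algebra ℂ U] {E F : Fin n → U} {K : Fin n → Uˣ}
    (hrel : UqRels q a d U E F K) {X : Type} [AddCommGroup X] [Module ℂ X] [FiniteDimensional ℂ X]
    (ρ : U →ₐ[ℂ] Module.End ℂ X) (i) : (moRepMod C hrel ρ).f i = ρ (F i) := rfl

/-- existence of a strictly positive vector -/
theorem mo_exists_pos {M : Type} [AddCommGroup M] [Module ℂ M] [FiniteDimensional ℂ M]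
    (P : MoMod a M) (v : M) (hv : v ≠ 0) (hvW : v ∈ P.W (fun _ => 1)) : ∃ b, MoPos a d b := by
  classical
  set S : Set (Fin n → ℤ) := {β | (∀ i, 0 ≤ β i) ∧ moF a d (fun _ => -1) β = 0 ∧
    ∃ z ≠ 0, z ∈ P.W ((fun _ => 1) - moA a β)} with hS
  set g : (Fin n → ℤ) → ℤ := fun β => moIn d (fun _ => 1) β with hg
  set w : (Fin n → ℤ) → (Fin n → ℤ) := fun β => (fun _ => 1) - moA a β with hw
  have hneg : ∀ β, moIn d (fun _ => -1) β = - moIn d (fun _ => 1) β := fun β => by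
    simp [moIn_apply]
  have hgw : ∀ β ∈ S, ∀ β' ∈ S, w β = w β' → g β = g β' := by
    intro β hβ β' hβ' h
    have h1 : moA a β = moA a β' := by simpa [hw] using h
    have e1 := hβ.2.1
    have e2 := hβ'.2.1
    simp only [moF, hneg] at e1 e2
    have e3 : moIn d (moA a β) β = moIn d (moA a β') β' := by
      rw [h1, moIn_symm C.hs, h1]
    simp only [hg]
    linarith
  have hΩ : {ν | P.W ν ≠ ⊥}.Finite := WellFoundedGT.finite_ne_bot_of_iSupIndep P.ind
  have hwS : (w '' S).Finite := by
    refine hΩ.subset ?_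
    rintro _ ⟨β, hβ, rfl⟩ hbot
    obtain ⟨z, hz, hzW⟩ := hβ.2.2
    rw [hbot] at hzW
    exact hz (by simpa using hzW)
  have hgS : (g '' S).Finite := by
    refine (hwS.image (fun ν => if h : ∃ β ∈ S, w β = ν then g h.choose else 0)).subset ?_
    rintro _ ⟨β, hβ, rfl⟩
    refine ⟨w β, ⟨β, hβ, rfl⟩, ?_⟩
    have hex : ∃ β' ∈ S, w β' = w β := ⟨β, hβ, rfl⟩
    simp only
    rw [dif_pos hex]
    exact hgw _ hex.choose_spec.1 _ hβ hex.choose_spec.2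
  have h0S : (0 : Fin n → ℤ) ∈ S := ⟨fun i => le_rfl, by simp [moF], v, hv, by simpa using hvW⟩
  obtain ⟨_, ⟨β, hβ, rfl⟩, hmax⟩ := Set.exists_max_image (g '' S) id hgS ⟨_, 0, h0S, rfl⟩
  have hanti : ∀ i, w β i ≤ 0 := by
    intro i
    by_contra hi
    push Not at hi
    obtain ⟨z, hz, hzW⟩ := hβ.2.2
    have hr := P.refl_ne C.h2 i _ z hzW hz hi.le
    have hmem : β + w β i • Pi.single i 1 ∈ S := by
      refine ⟨fun j => ?_, ?_, _, hr.1, ?_⟩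
      · have h1 := hβ.1 j
        rcases eq_or_ne j i with rfl | hji
        · simp; linarith
        · simp [hji, h1]
      · have := moF_refl C.h2 C.hs (fun _ => -1) β i
        rw [hβ.2.1] at this
        rw [← this]
        congr 1
        rw [sub_eq_add_neg, ← neg_smul]
        congr 2
        simp only [hw, Pi.sub_apply, Pi.add_apply]; ring
      · convert hr.2 using 2
        simp only [moS, map_add, map_smul]
        rw [sub_add_eq_sub_sub]
    have := hmax _ ⟨_, hmem, rfl⟩
    simp only [id, hg, map_add, map_smul, moIn_single, smul_eq_mul] at this
    have hdi := C.hd i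
    have : 0 < w β i * ((d i : ℤ) * 1) := by positivity
    linarith
  have hA1 : ∀ i, 1 ≤ moA a β i := fun i => by
    have := hanti i
    simp only [hw, Pi.sub_apply] at this
    linarith
  refine ⟨β, C.h2, C.hoff, C.hd, C.hs, fun i => ?_, fun i => by have := hA1 i; omega⟩
  by_contra hi
  have h0 : β i = 0 := le_antisymm (not_lt.1 hi) (hβ.1 i)
  have h1 := hA1 i
  rw [moA_apply] at h1
  have : ∑ j, a i j * β j ≤ 0 := Finset.sum_nonpos fun j _ => by
    rcases eq_or_ne i j with rfl | hij
    · simp [h0]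
    · exact mul_nonpos_of_nonpos_of_nonneg (C.hoff i j hij) (hβ.1 j)
  omega

end MORep
open scoped TensorProduct
section MOAntipode

theorem mo_tri (a b : ℕ) : (a + b).choose 2 = a.choose 2 + b.choose 2 + a * b := by
  induction b with
  | zero => simp
  | succ b ih =>
    rw [← add_assoc, Nat.choose_succ_succ' (a + b) 1, Nat.choose_succ_succ' b 1, ih]
    simp only [Nat.choose_one_right]
    ring

section serre
variable {B : Type} [Ring B] [Algebra ℂ B]

theorem mo_qc_pow {x g : B} {s : ℂ} (h : x * g = s • (g * x)) (k : ℕ) :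
    x * g ^ k = s ^ k • (g ^ k * x) := by
  induction k with
  | zero => simp
  | succ k ih =>
    rw [pow_succ, ← mul_assoc, ih, smul_mul_assoc, mul_assoc, h, mul_smul_comm, smul_smul,
      ← pow_succ, mul_assoc]

theorem mo_qc_pow' {x g : B} {s : ℂ} (h : x * g = s • (g * x)) (k : ℕ) :
    x ^ k * g = s ^ k • (g * x ^ k) := by
  induction k with
  | zero => simp
  | succ k ih =>
    rw [pow_succ' x, mul_assoc, ih, mul_smul_comm, ← mul_assoc, h, smul_mul_assoc, smul_smul,
      ← pow_succ, mul_assoc]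

theorem mo_gx_pow {x g : B} {s : ℂ} (h : x * g = s • (g * x)) (k : ℕ) :
    (g * x) ^ k = s ^ (k.choose 2) • (g ^ k * x ^ k) := by
  induction k with
  | zero => simp
  | succ k ih =>
    rw [pow_succ, ih, smul_mul_assoc]
    have e : g ^ k * x ^ k * (g * x) = s ^ k • (g ^ (k + 1) * x ^ (k + 1)) := by
      calc g ^ k * x ^ k * (g * x) = g ^ k * (x ^ k * g) * x := by simp only [mul_assoc]
        _ = _ := by
          rw [mo_qc_pow' h, mul_smul_comm, smul_mul_assoc, pow_succ, pow_succ]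
          simp only [mul_assoc]
    rw [e, smul_smul, ← pow_add]
    congr 2
    rw [mo_tri]; simp

theorem mo_gx_word {x g y h : B} {s r : ℂ} (h1 : x * g = s • (g * x)) (h2 : x * h = r • (h * x))
    (h3 : y * g = r • (g * y)) (h4 : h * g = g * h) (k l : ℕ) :
    (g * x) ^ k * (h * y) * (g * x) ^ l =
      (s ^ ((k + l).choose 2) * r ^ (k + l)) • (g ^ (k + l) * h * (x ^ k * y * x ^ l)) := by
  have hgh : h * g ^ l = g ^ l * h := (Commute.pow_right (show Commute h g from h4) l).eq
  have e5 : x ^ k * g ^ l = s ^ (k * l) • (g ^ l * x ^ k) := by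
    rw [mo_qc_pow' (mo_qc_pow h1 l) k, ← pow_mul, mul_comm l k]
  rw [mo_gx_pow h1, mo_gx_pow h1]
  simp only [smul_mul_assoc, mul_smul_comm]
  have : g ^ k * x ^ k * (h * y) * (g ^ l * x ^ l) = (r ^ k * (r ^ l * s ^ (k * l))) •
      (g ^ (k + l) * h * (x ^ k * y * x ^ l)) := by
    calc g ^ k * x ^ k * (h * y) * (g ^ l * x ^ l) = g ^ k * (x ^ k * h) * (y * g ^ l) * x ^ l := by
          simp only [mul_assoc]
      _ = (r ^ k * r ^ l) • (g ^ k * h * (x ^ k * g ^ l) * y * x ^ l) := by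
          rw [mo_qc_pow' h2, mo_qc_pow h3]
          simp only [smul_mul_assoc, mul_smul_comm, smul_smul, mul_assoc]
          congr 1; ring
      _ = (r ^ k * (r ^ l * s ^ (k * l))) • (g ^ k * (h * g ^ l) * x ^ k * y * x ^ l) := by
          rw [e5]
          simp only [smul_mul_assoc, mul_smul_comm, smul_smul, mul_assoc]
      _ = _ := by
          rw [hgh, pow_add]
          simp only [mul_assoc]
  rw [this, smul_smul, smul_smul]
  congr 1
  rw [mo_tri, pow_add, pow_add, pow_add]
  ring

theorem mo_qbinom_symm (t : ℂ) {m k : ℕ} (hk : k ≤ m) : qbinom t m (m - k) = qbinom t m k := by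
  unfold qbinom
  rw [Nat.sub_sub_self hk, mul_comm]

/-- the Serre relation transfers to the reversed words in `c • g x`. -/
theorem mo_serre {x g y h : B} {s r c c' t : ℂ} (h1 : x * g = s • (g * x)) (h2 : x * h = r • (h * x))
    (h3 : y * g = r • (g * y)) (h4 : h * g = g * h) (m : ℕ)
    (hs : ∑ k ∈ Finset.range (m + 1), ((-1 : ℂ) ^ k * qbinom t m k) • (x ^ (m - k) * y * x ^ k) = 0) :
    ∑ k ∈ Finset.range (m + 1), ((-1 : ℂ) ^ k * qbinom t m k) •
      ((c • (g * x)) ^ k * (c' • (h * y)) * (c • (g * x)) ^ (m - k)) = 0 := by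
  rw [← Finset.sum_range_reflect]
  have : ∀ k ∈ Finset.range (m + 1), ((-1 : ℂ) ^ (m + 1 - 1 - k) * qbinom t m (m + 1 - 1 - k)) •
      ((c • (g * x)) ^ (m + 1 - 1 - k) * (c' • (h * y)) * (c • (g * x)) ^ (m - (m + 1 - 1 - k)))
      = ((-1) ^ m * c ^ m * c' * (s ^ (m.choose 2) * r ^ m)) • (g ^ m * h * (((-1 : ℂ) ^ k * qbinom t m k) •
        (x ^ (m - k) * y * x ^ k))) := by
    intro k hk
    have hk' : k ≤ m := Nat.lt_succ_iff.1 (Finset.mem_range.1 hk)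
    rw [Nat.add_sub_cancel, Nat.sub_sub_self hk', mo_qbinom_symm t hk', smul_pow, smul_pow]
    have hw := mo_gx_word h1 h2 h3 h4 (m - k) k
    rw [Nat.sub_add_cancel hk'] at hw
    simp only [smul_mul_assoc, mul_smul_comm, smul_smul]
    rw [hw, smul_smul]
    congr 1
    have e1 : (-1 : ℂ) ^ m * (-1) ^ k = (-1) ^ (m - k) := by
      obtain ⟨l, rfl⟩ := Nat.exists_eq_add_of_le hk'
      rw [Nat.add_sub_cancel_left, pow_add, mul_right_comm, ← mul_pow]; simp
    have e2 : c ^ m = c ^ (m - k) * c ^ k := by rw [← pow_add, Nat.sub_add_cancel hk']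
    rw [e2, ← e1]
    ring
  rw [Finset.sum_congr rfl this, ← Finset.smul_sum, ← Finset.mul_sum, hs]
  simp

end serre

variable {q : ℂ} {n : ℕ} {a : Fin n → Fin n → ℤ} {d : Fin n → ℕ} (C : MoCtx q a d)
variable {U : Type} [Ring U] [Algebra ℂ U] {E F : Fin n → U} {K : Fin n → Uˣ}

theorem mo_rel_sub (hrel : UqRels q a d U E F K) (S : Subalgebra ℂ U) (hE : ∀ i, E i ∈ S)
    (hF : ∀ i, F i ∈ S) (hK : ∀ i, (K i : U) ∈ S) (hK' : ∀ i, ((K i)⁻¹ : Uˣ) ∈ (S : Set U).preimage (fun u : Uˣ => (u : U))) :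
    UqRels q a d S (fun i => ⟨E i, hE i⟩) (fun i => ⟨F i, hF i⟩)
      (fun i => ⟨⟨(K i : U), hK i⟩, ⟨((K i)⁻¹ : Uˣ), hK' i⟩, Subtype.ext (by simp), Subtype.ext (by simp)⟩) := by
  obtain ⟨r1, r2, r3, r4, r5, r6⟩ := hrel
  refine ⟨fun i j => Subtype.ext (r1 i j), fun i j => Subtype.ext (r2 i j),
    fun i j => Subtype.ext (r3 i j), fun i j => Subtype.ext ?_, fun i j hij => Subtype.ext ?_,
    fun i j hij => Subtype.ext ?_⟩
  · have := r4 i j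
    split_ifs at this ⊢ with h
    · exact this
    · exact this
  · have := r5 i j hij
    simpa using this
  · have := r6 i j hij
    simpa using this

theorem mo_U_gen (hrel : UqRels q a d U E F K)
    (hUuniv : ∀ (B : Type) [Ring B] [Algebra ℂ B] (E' F' : Fin n → B) (K' : Fin n → Bˣ),
      UqRels q a d B E' F' K' → ∃! φ : U →ₐ[ℂ] B,
        (∀ i, φ (E i) = E' i) ∧ (∀ i, φ (F i) = F' i) ∧ (∀ i, φ (K i : U) = (K' i : B)))
    (S : Subalgebra ℂ U) (hE : ∀ i, E i ∈ S)
    (hF : ∀ i, F i ∈ S) (hK : ∀ i, (K i : U) ∈ S) (hK' : ∀ i, (((K i)⁻¹ : Uˣ) : U) ∈ S) (u : U) : u ∈ S := by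
  obtain ⟨ψ, ⟨h1, h2, h3⟩, -⟩ := hUuniv S _ _ _ (mo_rel_sub hrel S hE hF hK hK')
  obtain ⟨χ, -, huniq⟩ := hUuniv U E F K hrel
  have e1 := huniq (AlgHom.id ℂ U) ⟨fun _ => rfl, fun _ => rfl, fun _ => rfl⟩
  have e2 := huniq (S.val.comp ψ) ⟨fun i => by simp [h1], fun i => by simp [h2], fun i => by simp [h3]⟩
  have : u = S.val (ψ u) := by
    have := congrArg (fun f : U →ₐ[ℂ] U => f u) (e1.trans e2.symm)
    exact this
  rw [this]
  exact (ψ u).2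

include C
theorem mo_rel_op (hrel : UqRels q a d U E F K) :
    UqRels q a d Uᵐᵒᵖ (fun i => MulOpposite.op ((-1 : ℂ) • ((((K i)⁻¹ : Uˣ) : U) * E i)))
      (fun i => MulOpposite.op ((-1 : ℂ) • (F i * (K i : U))))
      (fun i => ⟨MulOpposite.op (((K i)⁻¹ : Uˣ) : U), MulOpposite.op (K i : U),
        by rw [← MulOpposite.op_mul]; simp, by rw [← MulOpposite.op_mul]; simp⟩) := by
  have h0 := C.h0
  obtain ⟨r1, r2, r3, r4, r5, r6⟩ := hrel
  have cK : ∀ i (x : U), (((K i)⁻¹ : Uˣ) : U) * ((K i : U) * x) = x := fun i x => by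
    rw [← mul_assoc]; simp
  have cK' : ∀ i (x : U), (K i : U) * ((((K i)⁻¹ : Uˣ) : U) * x) = x := fun i x => by
    rw [← mul_assoc]; simp
  have m1 : ∀ i j, E j * (((K i)⁻¹ : Uˣ) : U) = q ^ ((d i : ℤ) * a i j) • ((((K i)⁻¹ : Uˣ) : U) * E j) := by
    intro i j
    have := congrArg (fun x => (((K i)⁻¹ : Uˣ) : U) * x * (((K i)⁻¹ : Uˣ) : U)) (r2 i j)
    simp only [mul_assoc, cK, smul_mul_assoc, mul_smul_comm, Units.mul_inv, mul_one] at this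
    exact this
  have m2 : ∀ i j, F j * (K i : U) = q ^ ((d i : ℤ) * a i j) • ((K i : U) * F j) := by
    intro i j
    rw [r3, smul_smul, ← zpow_add₀ h0]; simp
  have c1 : ∀ i j, (((K j)⁻¹ : Uˣ) : U) * (((K i)⁻¹ : Uˣ) : U) = (((K i)⁻¹ : Uˣ) : U) * (((K j)⁻¹ : Uˣ) : U) := by
    intro i j
    rw [← Units.val_mul, ← Units.val_mul, ← mul_inv_rev, ← mul_inv_rev]
    congr 2
    ext
    exact r1 i j
  have c2 : ∀ i j, (K j : U) * (((K i)⁻¹ : Uˣ) : U) = (((K i)⁻¹ : Uˣ) : U) * (K j : U) := by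
    intro i j
    have := congrArg (fun x => (((K i)⁻¹ : Uˣ) : U) * x * (((K i)⁻¹ : Uˣ) : U)) (r1 i j)
    simp only [mul_assoc, cK, Units.mul_inv, mul_one] at this
    exact this
  have m3 : ∀ i j, F j * (((K i)⁻¹ : Uˣ) : U) = q ^ (-((d i : ℤ) * a i j)) • ((((K i)⁻¹ : Uˣ) : U) * F j) := by
    intro i j
    have := congrArg (fun x => (((K i)⁻¹ : Uˣ) : U) * x * (((K i)⁻¹ : Uˣ) : U)) (r3 i j)
    simp only [mul_assoc, cK, smul_mul_assoc, mul_smul_comm, Units.mul_inv, mul_one] at this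
    exact this
  refine ⟨fun i j => ?_, fun i j => ?_, fun i j => ?_, fun i j => ?_, fun i j hij => ?_, fun i j hij => ?_⟩
  · simp only [← MulOpposite.op_mul, c1 i j]
  · simp only [← MulOpposite.op_mul, ← MulOpposite.op_smul]
    congr 1
    simp only [smul_mul_assoc, mul_smul_comm, mul_assoc, m1]
    rw [← mul_assoc, c1 i j, mul_assoc, smul_comm]
  · simp only [← MulOpposite.op_mul, ← MulOpposite.op_smul]
    congr 1
    simp only [smul_mul_assoc, mul_smul_comm, mul_assoc, c2]
    rw [← mul_assoc, m3, smul_mul_assoc, mul_assoc, smul_comm]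
  · simp only [← MulOpposite.op_mul, ← MulOpposite.op_sub, Units.inv_mk, ← MulOpposite.op_smul]
    have e1 : F j * (K j : U) * ((((K i)⁻¹ : Uˣ) : U) * E i) = (((K i)⁻¹ : Uˣ) : U) * (F j * E i) * (K j : U) := by
      calc _ = F j * ((K j : U) * (((K i)⁻¹ : Uˣ) : U)) * E i := by simp only [mul_assoc]
        _ = F j * (((K i)⁻¹ : Uˣ) : U) * ((K j : U) * E i) := by rw [c2]; simp only [mul_assoc]
        _ = _ := by
          rw [m3, r2]
          simp only [smul_mul_assoc, mul_smul_comm, smul_smul, mul_assoc]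
          rw [← zpow_add₀ h0, C.hs i j]; simp
    have e2 : (F j * (K j : U)) * ((((K i)⁻¹ : Uˣ) : U) * E i) - ((((K i)⁻¹ : Uˣ) : U) * E i) * (F j * (K j : U))
        = - ((((K i)⁻¹ : Uˣ) : U) * (E i * F j - F j * E i) * (K j : U)) := by
      rw [e1]; noncomm_ring
    simp only [smul_mul_assoc, mul_smul_comm, smul_smul]
    norm_num only
    simp only [one_smul]
    rw [e2, r4]
    split_ifs with h
    · subst h
      congr 1
      simp only [smul_mul_assoc, mul_smul_comm, mul_assoc, mul_sub, sub_mul, cK]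
      rw [← smul_neg]; simp
    · simp
  · have := mo_serre (c := -1) (c' := -1) (m1 i i) (h := (((K j)⁻¹ : Uˣ) : U)) (y := E j)
      (by rw [m1 j i, ← C.hs i j]) (m1 i j) (c1 i j) _ (r5 i j hij)
    rw [← MulOpposite.op_eq_zero_iff] at this
    rw [← this, Finset.op_sum]
    refine Finset.sum_congr rfl fun k _ => ?_
    simp only [MulOpposite.op_smul, MulOpposite.op_mul, MulOpposite.op_pow, mul_assoc]
  · have := mo_serre (c := -q ^ ((d i : ℤ) * a i i)) (c' := -q ^ ((d j : ℤ) * a j j)) (m2 i i) (h := (K j : U)) (y := F j)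
      (by rw [m2 j i, ← C.hs i j]) (m2 i j) (r1 j i) _ (r6 i j hij)
    rw [← MulOpposite.op_eq_zero_iff] at this
    rw [← this, Finset.op_sum]
    refine Finset.sum_congr rfl fun k _ => ?_
    simp only [m2, smul_smul, neg_one_mul]
    simp only [MulOpposite.op_smul, MulOpposite.op_mul, MulOpposite.op_pow, mul_assoc]

omit C in
theorem mo_Mmul (S : U →ₗ[ℂ] U) (hSm : ∀ u v, S (u * v) = S v * S u) (t w : U ⊗[ℂ] U) (e : ℂ)
    (hw : LinearMap.mul' ℂ U (TensorProduct.map LinearMap.id S w) = e • 1) :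
    LinearMap.mul' ℂ U (TensorProduct.map LinearMap.id S (t * w)) =
      e • LinearMap.mul' ℂ U (TensorProduct.map LinearMap.id S t) := by
  have key : ∀ x y w, LinearMap.mul' ℂ U (TensorProduct.map LinearMap.id S ((x ⊗ₜ y) * w)) =
      x * LinearMap.mul' ℂ U (TensorProduct.map LinearMap.id S w) * S y := by
    intro x y w
    induction w using TensorProduct.induction_on with
    | zero => simp
    | tmul x' y' => simp [hSm, mul_assoc]
    | add w w' h h' => simp only [mul_add, map_add, h, h', add_mul]
  induction t using TensorProduct.induction_on with
  | zero => simp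
  | tmul x y => rw [key, hw]; simp
  | add w w' h h' => simp only [add_mul, map_add, h, h', smul_add]

omit C in
theorem mo_Gmul (S : U →ₗ[ℂ] U) (hSm : ∀ u v, S (u * v) = S v * S u) (t w : U ⊗[ℂ] U) :
    TensorProduct.comm ℂ U U (TensorProduct.map S S (t * w)) =
      TensorProduct.comm ℂ U U (TensorProduct.map S S w) *
        TensorProduct.comm ℂ U U (TensorProduct.map S S t) := by
  induction t using TensorProduct.induction_on with
  | zero => simp
  | tmul x y =>
    induction w using TensorProduct.induction_on with
    | zero => simp
    | tmul x' y' => simp [hSm]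
    | add w w' h h' => simp only [mul_add, map_add, h, h', add_mul]
  | add w w' h h' => simp only [add_mul, map_add, h, h', mul_add]

theorem mo_antipode (hrel : UqRels q a d U E F K)
    (hUuniv : ∀ (B : Type) [Ring B] [Algebra ℂ B] (E' F' : Fin n → B) (K' : Fin n → Bˣ),
      UqRels q a d B E' F' K' → ∃! φ : U →ₐ[ℂ] B,
        (∀ i, φ (E i) = E' i) ∧ (∀ i, φ (F i) = F' i) ∧ (∀ i, φ (K i : U) = (K' i : B)))
    (Δ : U →ₐ[ℂ] U ⊗[ℂ] U) (ε : U →ₐ[ℂ] ℂ)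
    (hΔE : ∀ i, Δ (E i) = E i ⊗ₜ 1 + (K i : U) ⊗ₜ E i)
    (hΔF : ∀ i, Δ (F i) = F i ⊗ₜ (((K i)⁻¹ : Uˣ) : U) + 1 ⊗ₜ F i)
    (hΔK : ∀ i, Δ (K i : U) = (K i : U) ⊗ₜ (K i : U))
    (hΔK' : ∀ i, Δ (((K i)⁻¹ : Uˣ) : U) = (((K i)⁻¹ : Uˣ) : U) ⊗ₜ (((K i)⁻¹ : Uˣ) : U))
    (hεE : ∀ i, ε (E i) = 0) (hεF : ∀ i, ε (F i) = 0) (hεK : ∀ i, ε (K i : U) = 1)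
    (hεK' : ∀ i, ε (((K i)⁻¹ : Uˣ) : U) = 1) :
    ∃ S : U →ₗ[ℂ] U, S 1 = 1 ∧ (∀ u v, S (u * v) = S v * S u) ∧
      (∀ i, S (K i : U) = (((K i)⁻¹ : Uˣ) : U)) ∧ (∀ i, S (((K i)⁻¹ : Uˣ) : U) = (K i : U)) ∧
      (∀ u, LinearMap.mul' ℂ U (TensorProduct.map LinearMap.id S (Δ u)) = ε u • 1) ∧
      (∀ u, Δ (S u) = TensorProduct.comm ℂ U U (TensorProduct.map S S (Δ u))) ∧
      (∀ u, ε (S u) = ε u) ∧ Function.Surjective S := by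
  obtain ⟨ψ, ⟨s1, s2, s3⟩, -⟩ := hUuniv _ _ _ _ (mo_rel_op C hrel)
  set S : U →ₗ[ℂ] U := (MulOpposite.opLinearEquiv ℂ).symm.toLinearMap ∘ₗ ψ.toLinearMap with hS
  have hSu : ∀ u, S u = MulOpposite.unop (ψ u) := fun u => rfl
  have hS1 : S 1 = 1 := by simp [hSu]
  have hSm : ∀ u v, S (u * v) = S v * S u := fun u v => by simp [hSu]
  have hSE : ∀ i, S (E i) = - ((((K i)⁻¹ : Uˣ) : U) * E i) := fun i => by simp [hSu, s1]
  have hSF : ∀ i, S (F i) = - (F i * (K i : U)) := fun i => by simp [hSu, s2]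
  have hSK : ∀ i, S (K i : U) = (((K i)⁻¹ : Uˣ) : U) := fun i => by simp [hSu, s3]
  have hSK' : ∀ i, S (((K i)⁻¹ : Uˣ) : U) = (K i : U) := fun i => by
    have h := hSm (K i : U) (((K i)⁻¹ : Uˣ) : U)
    rw [Units.mul_inv, hS1, hSK] at h
    calc S (((K i)⁻¹ : Uˣ) : U) = S (((K i)⁻¹ : Uˣ) : U) * (((K i)⁻¹ : Uˣ) : U) * (K i : U) := by
          rw [mul_assoc]; simp
      _ = _ := by rw [← h, one_mul]
  refine ⟨S, hS1, hSm, hSK, hSK', fun u => ?_, fun u => ?_, fun u => ?_, fun u => ?_⟩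
  · let T : Subalgebra ℂ U :=
      { carrier := {u | LinearMap.mul' ℂ U (TensorProduct.map LinearMap.id S (Δ u)) = ε u • 1}
        mul_mem' := fun {u v} hu hv => by
          simp only [Set.mem_ofPred_eq] at hu hv ⊢
          rw [map_mul, mo_Mmul S hSm _ _ _ hv, hu, smul_smul, map_mul, mul_comm]
        add_mem' := fun {u v} hu hv => by
          simp only [Set.mem_ofPred_eq] at hu hv ⊢
          simp only [map_add, hu, hv, add_smul]
        algebraMap_mem' := fun r => by
          simp only [Set.mem_ofPred_eq, AlgHom.commutes, Algebra.TensorProduct.algebraMap_apply,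
            TensorProduct.map_tmul, LinearMap.mul'_apply, hS1]
          simp [Algebra.smul_def] }
    refine mo_U_gen hrel hUuniv T (fun i => ?_) (fun i => ?_) (fun i => ?_) (fun i => ?_) u
    · show LinearMap.mul' ℂ U (TensorProduct.map LinearMap.id S (Δ (E i))) = ε (E i) • 1
      rw [hΔE, hεE]; simp [hSE, hS1]
    · show LinearMap.mul' ℂ U (TensorProduct.map LinearMap.id S (Δ (F i))) = ε (F i) • 1
      rw [hΔF, hεF]; simp [hSF, hSK']
    · show LinearMap.mul' ℂ U (TensorProduct.map LinearMap.id S (Δ (K i : U))) = ε (K i : U) • 1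
      rw [hΔK, hεK]; simp [hSK]
    · show LinearMap.mul' ℂ U (TensorProduct.map LinearMap.id S (Δ (((K i)⁻¹ : Uˣ) : U))) = ε (((K i)⁻¹ : Uˣ) : U) • 1
      rw [hΔK', hεK']; simp [hSK']
  · let T : Subalgebra ℂ U :=
      { carrier := {u | Δ (S u) = TensorProduct.comm ℂ U U (TensorProduct.map S S (Δ u))}
        mul_mem' := fun {u v} hu hv => by
          simp only [Set.mem_ofPred_eq] at hu hv ⊢
          rw [hSm, map_mul, map_mul, mo_Gmul S hSm, hu, hv]
        add_mem' := fun {u v} hu hv => by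
          simp only [Set.mem_ofPred_eq] at hu hv ⊢
          simp only [map_add, hu, hv]
        algebraMap_mem' := fun r => by
          simp only [Set.mem_ofPred_eq]
          rw [Algebra.algebraMap_eq_smul_one]
          simp [hS1, Algebra.TensorProduct.one_def] }
    refine mo_U_gen hrel hUuniv T (fun i => ?_) (fun i => ?_) (fun i => ?_) (fun i => ?_) u
    · show Δ (S (E i)) = TensorProduct.comm ℂ U U (TensorProduct.map S S (Δ (E i)))
      rw [hSE, map_neg, map_mul, hΔK', hΔE]
      simp [hSE, hS1, hSK, mul_add, TensorProduct.neg_tmul, TensorProduct.tmul_neg]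
    · show Δ (S (F i)) = TensorProduct.comm ℂ U U (TensorProduct.map S S (Δ (F i)))
      rw [hSF, map_neg, map_mul, hΔK, hΔF]
      simp [hSF, hS1, hSK', add_mul, TensorProduct.neg_tmul, TensorProduct.tmul_neg]
    · show Δ (S (K i : U)) = TensorProduct.comm ℂ U U (TensorProduct.map S S (Δ (K i : U)))
      rw [hSK, hΔK', hΔK]; simp [hSK]
    · show Δ (S (((K i)⁻¹ : Uˣ) : U)) = TensorProduct.comm ℂ U U (TensorProduct.map S S (Δ (((K i)⁻¹ : Uˣ) : U)))
      rw [hSK', hΔK', hΔK]; simp [hSK']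
  · let T : Subalgebra ℂ U :=
      { carrier := {u | ε (S u) = ε u}
        mul_mem' := fun {u v} hu hv => by
          simp only [Set.mem_ofPred_eq] at hu hv ⊢
          rw [hSm, map_mul, map_mul, hu, hv, mul_comm]
        add_mem' := fun {u v} hu hv => by
          simp only [Set.mem_ofPred_eq] at hu hv ⊢
          simp only [map_add, hu, hv]
        algebraMap_mem' := fun r => by
          simp only [Set.mem_ofPred_eq]
          rw [Algebra.algebraMap_eq_smul_one]
          simp [hS1] }
    refine mo_U_gen hrel hUuniv T (fun i => ?_) (fun i => ?_) (fun i => ?_) (fun i => ?_) u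
    · show ε (S (E i)) = ε (E i)
      rw [hSE]; simp [hεE]
    · show ε (S (F i)) = ε (F i)
      rw [hSF]; simp [hεF]
    · show ε (S (K i : U)) = ε (K i : U)
      rw [hSK, hεK', hεK]
    · show ε (S (((K i)⁻¹ : Uˣ) : U)) = ε (((K i)⁻¹ : Uˣ) : U)
      rw [hSK', hεK', hεK]
  · let T : Subalgebra ℂ U :=
      { carrier := {u | ∃ v, S v = u}
        mul_mem' := fun {u v} hu hv => by
          obtain ⟨x, rfl⟩ := hu
          obtain ⟨y, rfl⟩ := hv
          exact ⟨y * x, hSm _ _⟩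
        add_mem' := fun {u v} hu hv => by
          obtain ⟨x, rfl⟩ := hu
          obtain ⟨y, rfl⟩ := hv
          exact ⟨x + y, map_add _ _ _⟩
        algebraMap_mem' := fun r => ⟨r • 1, by
          rw [map_smul, hS1, Algebra.algebraMap_eq_smul_one]⟩ }
    refine mo_U_gen hrel hUuniv T (fun i => ?_) (fun i => ?_) (fun i => ?_) (fun i => ?_) u
    · refine ⟨- (E i * (((K i)⁻¹ : Uˣ) : U)), ?_⟩
      rw [map_neg, hSm, hSE, hSK', mul_neg, neg_neg, ← mul_assoc]; simp
    · refine ⟨- ((K i : U) * F i), ?_⟩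
      rw [map_neg, hSm, hSF, hSK, neg_mul, neg_neg, mul_assoc]; simp
    · exact ⟨_, hSK' i⟩
    · exact ⟨_, hSK i⟩

end MOAntipode
open scoped TensorProduct
section MOCoef

variable {q : ℂ} {n : ℕ} {a : Fin n → Fin n → ℤ} {d : Fin n → ℕ} (C : MoCtx q a d)
variable {U : Type} [Ring U] [Algebra ℂ U] {E F : Fin n → U} {K : Fin n → Uˣ}

/-- generation of `U` -/
def MoGen (E F : Fin n → U) (K : Fin n → Uˣ) : Prop :=
  ∀ S : Subalgebra ℂ U, (∀ i, E i ∈ S) → (∀ i, F i ∈ S) → (∀ i, (K i : U) ∈ S) →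
    (∀ i, (((K i)⁻¹ : Uˣ) : U) ∈ S) → ∀ u, u ∈ S

theorem mo_stable (hgen : MoGen E F K) {X : Type} [AddCommGroup X] [Module ℂ X]
    (σ : U →ₐ[ℂ] Module.End ℂ X) (N : Submodule ℂ X) (hE : ∀ i, ∀ x ∈ N, σ (E i) x ∈ N)
    (hF : ∀ i, ∀ x ∈ N, σ (F i) x ∈ N) (hK : ∀ i, ∀ x ∈ N, σ (K i : U) x ∈ N)
    (hK' : ∀ i, ∀ x ∈ N, σ (((K i)⁻¹ : Uˣ) : U) x ∈ N) (u : U) : ∀ x ∈ N, σ u x ∈ N := by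
  let T : Subalgebra ℂ U :=
    { carrier := {u | ∀ x ∈ N, σ u x ∈ N}
      mul_mem' := fun {u v} hu hv x hx => by
        rw [map_mul, Module.End.mul_apply]; exact hu _ (hv x hx)
      add_mem' := fun {u v} hu hv x hx => by
        rw [map_add, LinearMap.add_apply]; exact N.add_mem (hu x hx) (hv x hx)
      algebraMap_mem' := fun r x hx => by
        rw [AlgHom.commutes, Module.algebraMap_end_apply]; exact N.smul_mem _ hx }
  exact hgen T hE hF hK hK' u

theorem mo_Kinv (hq0 : q ≠ 0) {X : Type} [AddCommGroup X] [Module ℂ X]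
    (σ : U →ₐ[ℂ] Module.End ℂ X) {ν : Fin n → ℤ} {x : X} (hx : x ∈ wtSp q d K σ ν) (i : Fin n) :
    σ (((K i)⁻¹ : Uˣ) : U) x = q ^ (-(ν i * (d i : ℤ))) • x := by
  have h2 : σ (K i : U) x = _ := mem_moW.1 hx i
  have h4 : σ (((K i)⁻¹ : Uˣ) : U) (σ (K i : U) x) = x := by
    rw [← Module.End.mul_apply, ← map_mul]; simp
  rw [h2, map_smul] at h4
  rw [zpow_neg, eq_inv_smul_iff₀ (zpow_ne_zero _ hq0), h4]

theorem mo_stable' (hq0 : q ≠ 0) (hgen : MoGen E F K) {X : Type} [AddCommGroup X] [Module ℂ X]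
    (σ : U →ₐ[ℂ] Module.End ℂ X) (T : Set X) (hT : ∀ t ∈ T, ∃ ν, t ∈ wtSp q d K σ ν)
    (hE : ∀ i, ∀ x ∈ Submodule.span ℂ T, σ (E i) x ∈ Submodule.span ℂ T)
    (hF : ∀ i, ∀ x ∈ Submodule.span ℂ T, σ (F i) x ∈ Submodule.span ℂ T) (u : U) :
    ∀ x ∈ Submodule.span ℂ T, σ u x ∈ Submodule.span ℂ T := by
  refine mo_stable hgen σ _ hE hF (fun i x hx => ?_) (fun i x hx => ?_) u
  · induction hx using Submodule.span_induction with
    | mem x hx =>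
      obtain ⟨ν, hν⟩ := hT x hx
      rw [show σ (K i : U) x = _ from mem_moW.1 hν i]
      exact Submodule.smul_mem _ _ (Submodule.subset_span hx)
    | zero => simp
    | add x y _ _ hx hy => rw [map_add]; exact Submodule.add_mem _ hx hy
    | smul c x _ hx => rw [map_smul]; exact Submodule.smul_mem _ _ hx
  · induction hx using Submodule.span_induction with
    | mem x hx =>
      obtain ⟨ν, hν⟩ := hT x hx
      rw [mo_Kinv hq0 σ hν i]
      exact Submodule.smul_mem _ _ (Submodule.subset_span hx)
    | zero => simp
    | add x y _ _ hx hy => rw [map_add]; exact Submodule.add_mem _ hx hy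
    | smul c x _ hx => rw [map_smul]; exact Submodule.smul_mem _ _ hx

/-- highest weight vectors -/
theorem mo_exists_hw {b : Fin n → ℤ} (H : MoPos a d b) {M : Type} [AddCommGroup M] [Module ℂ M]
    [FiniteDimensional ℂ M] [Nontrivial M] (P : MoMod a M) (htop : ⨆ ν, P.W ν = ⊤) :
    ∃ c : Fin n → ℕ, ∃ x ≠ 0, x ∈ P.W (fun i => (c i : ℤ)) ∧ ∀ i, P.e i x = 0 := by
  have hΩ : {ν | P.W ν ≠ ⊥}.Finite := WellFoundedGT.finite_ne_bot_of_iSupIndep P.ind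
  have hne : {ν | P.W ν ≠ ⊥}.Nonempty := by
    by_contra hcon
    rw [Set.not_nonempty_iff_eq_empty] at hcon
    have : ∀ ν, P.W ν = ⊥ := by
      intro ν
      by_contra h
      have : ν ∈ {ν | P.W ν ≠ ⊥} := h
      rw [hcon] at this
      exact this
    simp [this] at htop
  obtain ⟨ν, hν, hmax⟩ := Set.exists_max_image _ (fun ν => moIn d ν b) hΩ hne
  obtain ⟨x, hx, hx0⟩ := (Submodule.ne_bot_iff _).1 hν
  have he : ∀ i, P.e i x = 0 := by
    intro i
    by_contra h
    have h1 := P.eW i ν x hx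
    have h2 := hmax (ν + moA a (Pi.single i 1)) (fun hbot => h (by rw [hbot] at h1; simpa using h1))
    simp only [map_add, LinearMap.add_apply] at h2
    rw [moIn_symm H.hs, moIn_single] at h2
    have h3 := H.hA i
    have h4 := H.hd i
    have : 0 < (d i : ℤ) * moA a b i := by positivity
    linarith
  refine ⟨fun i => (ν i).toNat, x, hx0, ?_, he⟩
  have : (fun i => ((ν i).toNat : ℤ)) = ν := by
    funext i
    exact Int.toNat_of_nonneg (P.dominant H.h2 i ν x hx hx0 (he i))
  rw [this]
  exact hx

/-- the product of two representations -/
def moProd {X Y : Type} [AddCommGroup X] [Module ℂ X] [AddCommGroup Y] [Module ℂ Y]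
    (σ : U →ₐ[ℂ] Module.End ℂ X) (τ : U →ₐ[ℂ] Module.End ℂ Y) : U →ₐ[ℂ] Module.End ℂ (X × Y) where
  toFun u := LinearMap.prodMap (σ u) (τ u)
  map_one' := by ext <;> simp
  map_mul' u v := by ext <;> simp
  map_zero' := by ext <;> simp
  map_add' u v := by ext <;> simp
  commutes' r := by ext <;> simp [Module.algebraMap_end_apply]

include C in
theorem mo_hw_ker {b : Fin n → ℤ} (H : MoPos a d b) (hrel : UqRels q a d U E F K)
    (hgen : MoGen E F K)
    {X Y : Type} [AddCommGroup X] [Module ℂ X] [AddCommGroup Y] [Module ℂ Y]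
    [FiniteDimensional ℂ X] [FiniteDimensional ℂ Y]
    (σ : U →ₐ[ℂ] Module.End ℂ X) (τ : U →ₐ[ℂ] Module.End ℂ Y)
    (hsimple : ∀ N : Submodule ℂ Y, (∀ (u : U), ∀ v ∈ N, τ u v ∈ N) → N = ⊥ ∨ N = ⊤)
    (μ : Fin n → ℤ) (v : X) (hv0 : v ≠ 0) (hv : v ∈ wtSp q d K σ μ) (hve : ∀ i, σ (E i) v = 0)
    (x : Y) (hx0 : x ≠ 0) (hx : x ∈ wtSp q d K τ μ) (hxe : ∀ i, τ (E i) x = 0)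
    (u : U) (hu : σ u v = 0) : τ u x = 0 := by
  set P := moRepMod C hrel (moProd σ τ) with hP
  have hap : ∀ w z, moProd σ τ w z = (σ w z.1, τ w z.2) := fun w z => rfl
  have hW : ∀ z, z ∈ P.W μ ↔ z.1 ∈ wtSp q d K σ μ ∧ z.2 ∈ wtSp q d K τ μ := by
    intro z
    rw [hP, moRepMod_W]
    constructor
    · intro h
      have h' := mem_moW.1 h
      constructor
      · exact mem_moW.2 fun i => congrArg Prod.fst (h' i)
      · exact mem_moW.2 fun i => congrArg Prod.snd (h' i)
    · rintro ⟨h, h'⟩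
      exact mem_moW.2 fun i => Prod.ext (mem_moW.1 h i) (mem_moW.1 h' i)
  set y : X × Y := (v, x) with hy
  have hyW : y ∈ P.W μ := (hW y).2 ⟨hv, hx⟩
  have hye : ∀ i, P.e i y = 0 := fun i => Prod.ext (hve i) (hxe i)
  have hySW : ∀ s ∈ ({y} : Set (X × Y)), ∃ ν, s ∈ P.swap.W ν := by
    rintro _ rfl
    exact ⟨-μ, by simpa [MoMod.swap] using hyW⟩
  set N := P.swap.up {y} with hN
  have hNf : ∀ i, ∀ z ∈ N, moProd σ τ (F i) z ∈ N := fun i z hz => P.swap.up_e i hz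
  have hNe : ∀ i, ∀ z ∈ N, moProd σ τ (E i) z ∈ N := fun i z hz => by
    refine P.swap.up_f hySW i ?_ hz
    rintro _ rfl
    show P.e i y ∈ _
    rw [hye]; exact Submodule.zero_mem _
  have hNU : ∀ w, ∀ z ∈ N, moProd σ τ w z ∈ N := fun w => by
    refine mo_stable' (d := d) C.h0 hgen (moProd σ τ) _ ?_ hNe hNf w
    rintro _ ⟨l, s, hs, rfl⟩
    obtain ⟨ν, hν⟩ := hySW s hs
    refine ⟨-(ν + moA a (MoMod.cnt l)), ?_⟩
    rw [← moRepMod_W C hrel]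
    exact P.swap.ew_mem l ν s hν
  by_contra hne
  have hmem : ((0 : X), τ u x) ∈ N := by
    have := hNU u y (P.swap.subset_up rfl)
    rwa [hap, hy, hu] at this
  have hx' : ((0 : X), x) ∈ N := by
    set N' : Submodule ℂ Y := N.comap (LinearMap.inr ℂ X Y) with hN'
    rcases hsimple N' (fun w z hz => by
      have := hNU w _ hz
      rw [hap] at this
      simpa [hN'] using this) with h | h
    · exfalso
      have : τ u x ∈ N' := hmem
      rw [h] at this
      exact hne (by simpa using this)
    · have : x ∈ N' := by rw [h]; trivial
      exact this
  set T : Set (X × Y) := {z | ∃ i l, z = P.swap.ew (i :: l) y} with hT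
  have hle : N ≤ Submodule.span ℂ {y} ⊔ Submodule.span ℂ T := by
    rw [hN, MoMod.up, Submodule.span_le]
    rintro _ ⟨l, s, hs, rfl⟩
    rw [Set.mem_singleton_iff] at hs
    subst hs
    cases l with
    | nil => exact Submodule.mem_sup_left (Submodule.mem_span_singleton_self _)
    | cons i l => exact Submodule.mem_sup_right (Submodule.subset_span ⟨i, l, rfl⟩)
  obtain ⟨y1, hy1, r, hr, hsum⟩ := Submodule.mem_sup.1 (hle hx')
  obtain ⟨c, rfl⟩ := Submodule.mem_span_singleton.1 hy1
  have hrW : r ∈ P.W μ := by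
    have : r = ((0 : X), x) - c • y := by rw [← hsum]; simp
    rw [this]
    exact Submodule.sub_mem _ ((hW _).2 ⟨Submodule.zero_mem _, hx⟩) (Submodule.smul_mem _ _ hyW)
  have hr0 : r = 0 := by
    by_contra hr0
    have := P.wt_in (T := T) (Ω := {ω | ω ≠ μ}) ?_ hrW hr0 hr
    · exact this rfl
    · rintro _ ⟨i, l, rfl⟩
      refine ⟨-(-μ + moA a (MoMod.cnt (i :: l))), ?_, P.swap.ew_mem (i :: l) (-μ) y (by simpa [MoMod.swap] using hyW)⟩
      intro h
      have h1 : moA a (MoMod.cnt (i :: l)) = 0 := by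
        have h2 := congrArg Neg.neg h
        rw [neg_neg] at h2
        simpa using h2
      have h3 := H.inj (h1.trans (map_zero _).symm)
      have h4 := MoMod.cnt_sum (i :: l)
      rw [h3] at h4
      simp at h4
      omega
  rw [hr0, add_zero] at hsum
  have e1 : c • v = 0 := congrArg Prod.fst hsum
  have e2 : c • x = x := congrArg Prod.snd hsum
  rcases smul_eq_zero.1 e1 with h | h
  · rw [h, zero_smul] at e2
    exact hx0 e2.symm
  · exact hv0 h

include C in
/-- matrix coefficients of simple weight modules are coefficients of the `V c` -/
theorem mo_coef {b : Fin n → ℤ} (H : MoPos a d b) (hrel : UqRels q a d U E F K)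
    (hgen : MoGen E F K)
    (V : (Fin n → ℕ) → Type) [∀ c, AddCommGroup (V c)] [∀ c, Module ℂ (V c)]
    (ρ : ∀ c, U →ₐ[ℂ] Module.End ℂ (V c))
    (hfd : ∀ c, FiniteDimensional ℂ (V c))
    (hhw : ∀ c, ∃ v : V c, v ≠ 0 ∧ v ∈ wtSp q d K (ρ c) (fun i => (c i : ℤ)) ∧
      ∀ i, ρ c (E i) v = 0)
    {Y : Type} [AddCommGroup Y] [Module ℂ Y] [FiniteDimensional ℂ Y]
    (τ : U →ₐ[ℂ] Module.End ℂ Y)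
    (hsimple : ∀ N : Submodule ℂ Y, (∀ (u : U), ∀ v ∈ N, τ u v ∈ N) → N = ⊥ ∨ N = ⊤)
    (hwt : (⨆ μ : Fin n → ℤ, wtSp q d K τ μ) = ⊤) (η : Module.Dual ℂ Y) (y : Y) (hy : y ≠ 0) :
    ∃ c, ∃ ξ : Module.Dual ℂ (V c), ∃ v : V c, ∀ u, η (τ u y) = ξ (ρ c u v) := by
  have : Nontrivial Y := ⟨⟨y, 0, hy⟩⟩
  obtain ⟨c, x, hx0, hx, hxe⟩ := mo_exists_hw H (moRepMod C hrel τ) (by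
    simp only [moRepMod_W]; exact hwt)
  rw [moRepMod_W] at hx
  obtain ⟨v, hv0, hv, hve⟩ := hhw c
  have := hfd c
  have hker := mo_hw_ker C H hrel hgen (ρ c) τ hsimple _ v hv0 hv hve x hx0 hx hxe
  set f : U →ₗ[ℂ] V c := (LinearMap.applyₗ v) ∘ₗ (ρ c).toLinearMap with hf
  set g : U →ₗ[ℂ] Y := (LinearMap.applyₗ x) ∘ₗ τ.toLinearMap with hg
  have h1 : η ∘ₗ g ∈ LinearMap.range f.dualMap := by
    rw [LinearMap.range_dualMap_eq_dualAnnihilator_ker, Submodule.mem_dualAnnihilator]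
    intro u hu
    have : τ u x = 0 := hker u hu
    show η (τ u x) = 0
    rw [this, map_zero]
  obtain ⟨ξ, hξ⟩ := h1
  have hξ' : ∀ u, ξ (ρ c u v) = η (τ u x) := fun u => congrArg (fun l : Module.Dual ℂ U => l u) hξ
  have h2 : LinearMap.range g = ⊤ := by
    rcases hsimple (LinearMap.range g) (by
      rintro u _ ⟨w, rfl⟩
      exact ⟨u * w, by simp [hg]⟩) with h | h
    · exfalso
      have : x ∈ LinearMap.range g := ⟨1, by simp [hg]⟩
      rw [h] at this
      exact hx0 (by simpa using this)
    · exact h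
  have h3 : y ∈ LinearMap.range g := by rw [h2]; trivial
  obtain ⟨u0, hu0⟩ := h3
  refine ⟨c, ξ, ρ c u0 v, fun u => ?_⟩
  have e1 := hξ' (u * u0)
  rw [map_mul, map_mul, Module.End.mul_apply, Module.End.mul_apply] at e1
  rw [e1, ← hu0]
  rfl

end MOCoef
open scoped TensorProduct
section MODual

variable {q : ℂ} {n : ℕ} {a : Fin n → Fin n → ℤ} {d : Fin n → ℕ} (C : MoCtx q a d)
variable {U : Type} [Ring U] [Algebra ℂ U] {E F : Fin n → U} {K : Fin n → Uˣ}

/-- the dual representation -/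
noncomputable def moDual (S : U →ₗ[ℂ] U) (hS1 : S 1 = 1) (hSm : ∀ u v, S (u * v) = S v * S u)
    {X : Type} [AddCommGroup X] [Module ℂ X]
    (σ : U →ₐ[ℂ] Module.End ℂ X) : U →ₐ[ℂ] Module.End ℂ (Module.Dual ℂ X) where
  toFun u := (σ (S u)).dualMap
  map_one' := by ext; simp [hS1]
  map_mul' u v := by ext; simp [hSm]
  map_zero' := by ext; simp
  map_add' u v := by ext; simp
  commutes' r := by
    ext; simp [Algebra.algebraMap_eq_smul_one, hS1]

theorem moDual_apply (S : U →ₗ[ℂ] U) (hS1 : S 1 = 1) (hSm : ∀ u v, S (u * v) = S v * S u)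
    {X : Type} [AddCommGroup X] [Module ℂ X]
    (σ : U →ₐ[ℂ] Module.End ℂ X) (u : U) (ξ : Module.Dual ℂ X) (x : X) :
    moDual S hS1 hSm σ u ξ x = ξ (σ (S u) x) := rfl

theorem moDual_simple (S : U →ₗ[ℂ] U) (hS1 : S 1 = 1) (hSm : ∀ u v, S (u * v) = S v * S u)
    (hsurj : Function.Surjective S)
    {X : Type} [AddCommGroup X] [Module ℂ X] [FiniteDimensional ℂ X]
    (σ : U →ₐ[ℂ] Module.End ℂ X)
    (hsimple : ∀ N : Submodule ℂ X, (∀ (u : U), ∀ v ∈ N, σ u v ∈ N) → N = ⊥ ∨ N = ⊤)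
    (N : Submodule ℂ (Module.Dual ℂ X)) (hN : ∀ (u : U), ∀ v ∈ N, moDual S hS1 hSm σ u v ∈ N) :
    N = ⊥ ∨ N = ⊤ := by
  have h1 : N.dualCoannihilator.dualAnnihilator = N := Subspace.dualCoannihilator_dualAnnihilator_eq
  rcases hsimple N.dualCoannihilator (by
    intro u x hx
    obtain ⟨w, rfl⟩ := hsurj u
    rw [Submodule.mem_dualCoannihilator] at hx ⊢
    intro ξ hξ
    exact hx _ (hN w ξ hξ)) with h | h
  · right; rw [← h1, h]; simp
  · left; rw [← h1, h]; simp

include C in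
theorem moDual_wt (hrel : UqRels q a d U E F K) (hgen : MoGen E F K)
    (S : U →ₗ[ℂ] U) (hS1 : S 1 = 1) (hSm : ∀ u v, S (u * v) = S v * S u)
    (hSK : ∀ i, S (K i : U) = (((K i)⁻¹ : Uˣ) : U))
    (hsurj : Function.Surjective S)
    {X : Type} [AddCommGroup X] [Module ℂ X] [FiniteDimensional ℂ X] [Nontrivial X]
    (σ : U →ₐ[ℂ] Module.End ℂ X)
    (hsimple : ∀ N : Submodule ℂ X, (∀ (u : U), ∀ v ∈ N, σ u v ∈ N) → N = ⊥ ∨ N = ⊤)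
    (hwt : (⨆ μ : Fin n → ℤ, wtSp q d K σ μ) = ⊤) :
    (⨆ μ : Fin n → ℤ, wtSp q d K (moDual S hS1 hSm σ) μ) = ⊤ := by
  set τ := moDual S hS1 hSm σ with hτ
  set P := moRepMod C hrel τ with hP
  set T : Set (Module.Dual ℂ X) := {t | ∃ ν, t ∈ wtSp q d K τ ν} with hT
  have hTs : Submodule.span ℂ T = ⨆ μ : Fin n → ℤ, wtSp q d K τ μ := by
    apply le_antisymm
    · rw [Submodule.span_le]
      rintro t ⟨ν, hν⟩
      exact (le_iSup (fun μ => wtSp q d K τ μ) ν) hν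
    · exact iSup_le fun ν t ht => Submodule.subset_span ⟨ν, ht⟩
  have hmap : ∀ (f : Module.End ℂ (Module.Dual ℂ X)), (∀ t ∈ T, f t ∈ T) →
      ∀ x ∈ Submodule.span ℂ T, f x ∈ Submodule.span ℂ T := by
    intro f hf x hx
    induction hx using Submodule.span_induction with
    | mem x hx => exact Submodule.subset_span (hf x hx)
    | zero => simp
    | add x y _ _ hx hy => rw [map_add]; exact Submodule.add_mem _ hx hy
    | smul c x _ hx => rw [map_smul]; exact Submodule.smul_mem _ _ hx
  rw [← hTs]
  rcases moDual_simple S hS1 hSm hsurj σ hsimple (Submodule.span ℂ T)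
    (fun u => mo_stable' (d := d) C.h0 hgen τ T (fun t ht => ht) (fun i => hmap _ (by
      rintro t ⟨ν, hν⟩
      rw [← moRepMod_W C hrel] at hν
      exact ⟨_, (moRepMod_W C hrel τ _) ▸ P.eW i ν t hν⟩)) (fun i => hmap _ (by
      rintro t ⟨ν, hν⟩
      rw [← moRepMod_W C hrel] at hν
      exact ⟨_, (moRepMod_W C hrel τ _) ▸ P.fW i ν t hν⟩)) u) with h | h
  · exfalso
    have hind : iSupIndep (wtSp q d K σ) := by
      have := (moRepMod C hrel σ).ind
      rwa [show (moRepMod C hrel σ).W = wtSp q d K σ from funext (moRepMod_W C hrel σ)] at this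
    obtain ⟨ν, hν⟩ : ∃ ν, wtSp q d K σ ν ≠ ⊥ := by
      by_contra hcon
      push Not at hcon
      simp [hcon] at hwt
    have hlt : (⨆ j, ⨆ _ : j ≠ ν, wtSp q d K σ j) < ⊤ := by
      rw [lt_top_iff_ne_top]
      intro htop
      have := hind ν
      rw [htop, disjoint_top] at this
      exact hν this
    obtain ⟨ξ, hξ0, hξ⟩ := Submodule.exists_le_ker_of_lt_top _ hlt
    have hmem : ξ ∈ T := by
      refine ⟨-ν, mem_moW.2 fun i => ?_⟩
      have : (⊤ : Submodule ℂ X) ≤ LinearMap.ker (τ (K i : U) ξ - (q ^ ((-ν) i * (d i : ℤ))) • ξ) := by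
        rw [← hwt]
        refine iSup_le fun μ x hx => ?_
        rw [LinearMap.mem_ker, LinearMap.sub_apply, LinearMap.smul_apply, hτ, moDual_apply, hSK,
          mo_Kinv C.h0 σ hx i, map_smul]
        rcases eq_or_ne μ ν with rfl | hne
        · simp
        · have : ξ x = 0 := hξ ((le_iSup₂ (f := fun j (_ : j ≠ ν) => wtSp q d K σ j) μ hne) hx)
          rw [this]; simp
      ext x
      have := this (x := x) trivial
      rw [LinearMap.mem_ker, LinearMap.sub_apply, sub_eq_zero] at this
      exact this
    have := Submodule.subset_span (R := ℂ) hmem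
    rw [h] at this
    exact hξ0 (by simpa using this)
  · exact h

end MODual

section MOA
variable {U : Type} [Ring U] [Algebra ℂ U]
/-- evaluation of a pair of functionals on a tensor -/
noncomputable def moμ (f g : U →ₗ[ℂ] ℂ) : U ⊗[ℂ] U →ₗ[ℂ] ℂ :=
  (TensorProduct.lid ℂ ℂ).toLinearMap ∘ₗ (TensorProduct.map f g)

@[simp] theorem moμ_tmul (f g : U →ₗ[ℂ] ℂ) (x y : U) : moμ f g (x ⊗ₜ y) = f x * g y := by
  simp [moμ]

theorem moμ_comm (f g : U →ₗ[ℂ] ℂ) (S : U →ₗ[ℂ] U) (t : U ⊗[ℂ] U) :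
    moμ f g (TensorProduct.comm ℂ U U (TensorProduct.map S S t)) = moμ (g ∘ₗ S) (f ∘ₗ S) t := by
  induction t using TensorProduct.induction_on with
  | zero => simp
  | tmul x y => simp [mul_comm]
  | add x y hx hy => simp only [map_add, hx, hy]

theorem moμ_mul_right (f g f' g' : U →ₗ[ℂ] ℂ) (x z : U) (hf : ∀ y, f' y = f (y * x))
    (hg : ∀ y, g' y = g (y * z)) (t : U ⊗[ℂ] U) :
    moμ f g (t * (x ⊗ₜ z)) = moμ f' g' t := by
  induction t using TensorProduct.induction_on with
  | zero => simp
  | tmul x y => simp [hf, hg]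
  | add x y hx hy => simp only [add_mul, map_add, hx, hy]

theorem moμ_split {ι₁ ι₂ : Type} [Fintype ι₁] [Fintype ι₂] (f g : U →ₗ[ℂ] ℂ)
    (a b : ι₁ → U →ₗ[ℂ] ℂ) (a' b' : ι₂ → U →ₗ[ℂ] ℂ)
    (hf : ∀ y u, f (y * u) = ∑ k, a k y * b k u) (hg : ∀ y u, g (y * u) = ∑ k, a' k y * b' k u)
    (Y Z : U ⊗[ℂ] U) :
    moμ f g (Y * Z) = ∑ p : ι₁ × ι₂, moμ (a p.1) (a' p.2) Y * moμ (b p.1) (b' p.2) Z := by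
  induction Y using TensorProduct.induction_on with
  | zero => simp
  | tmul x y =>
    induction Z using TensorProduct.induction_on with
    | zero => simp
    | tmul x' y' =>
      rw [Algebra.TensorProduct.tmul_mul_tmul]
      simp only [moμ_tmul, hf, hg]
      rw [Fintype.sum_mul_sum, Fintype.sum_prod_type]
      refine Finset.sum_congr rfl fun k _ => Finset.sum_congr rfl fun l _ => by ring
    | add w w' h h' => simp only [mul_add, map_add, h, h', Finset.sum_add_distrib]
  | add w w' h h' => simp only [add_mul, map_add, h, h', Finset.sum_add_distrib]

theorem moμ_conv {ι₁ : Type} [Fintype ι₁] (f : U →ₗ[ℂ] ℂ) (a b s : ι₁ → U →ₗ[ℂ] ℂ) (S : U →ₗ[ℂ] U)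
    (hf : ∀ y u, f (y * u) = ∑ k, a k y * b k u) (hs : ∀ k u, s k u = b k (S u)) (T : U ⊗[ℂ] U) :
    ∑ k, moμ (a k) (s k) T = f (LinearMap.mul' ℂ U (TensorProduct.map LinearMap.id S T)) := by
  induction T using TensorProduct.induction_on with
  | zero => simp
  | tmul x y => simp [hf, hs]
  | add x y hx hy => simp only [map_add, hx, hy, Finset.sum_add_distrib]

end MOA
open scoped TensorProduct
section MOA2
variable {U : Type} [Ring U] [Algebra ℂ U] {A : Type} [Ring A] [Algebra ℂ A]
  {ι : A →ₗ[ℂ] (U →ₗ[ℂ] ℂ)} {Δ : U →ₐ[ℂ] U ⊗[ℂ] U} {ε : U →ₐ[ℂ] ℂ}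

/-- closure under the antipode -/
theorem mo_S_closed (hι1 : ∀ u, ι 1 u = ε u)
    (hM : ∀ x y u, ι (x * y) u = moμ (ι x) (ι y) (Δ u))
    (S : U →ₗ[ℂ] U)
    (hΔS : ∀ u, Δ (S u) = TensorProduct.comm ℂ U U (TensorProduct.map S S (Δ u)))
    (hεS : ∀ u, ε (S u) = ε u) (G : Set A) (hG : Algebra.adjoin ℂ G = ⊤)
    (hGS : ∀ x ∈ G, ∃ g : A, ∀ u, ι g u = ι x (S u)) (f : A) :
    ∃ g : A, ∀ u, ι g u = ι f (S u) := by
  have hf : f ∈ Algebra.adjoin ℂ G := by rw [hG]; trivial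
  induction hf using Algebra.adjoin_induction with
  | mem x hx => exact hGS x hx
  | algebraMap r =>
    refine ⟨algebraMap ℂ A r, fun u => ?_⟩
    simp [Algebra.algebraMap_eq_smul_one, hι1, hεS]
  | add x y _ _ hx hy =>
    obtain ⟨g, hg⟩ := hx
    obtain ⟨g', hg'⟩ := hy
    exact ⟨g + g', fun u => by simp [hg, hg']⟩
  | mul x y _ _ hx hy =>
    obtain ⟨g, hg⟩ := hx
    obtain ⟨g', hg'⟩ := hy
    refine ⟨g' * g, fun u => ?_⟩
    rw [hM, hM, hΔS, moμ_comm, show ι y ∘ₗ S = ι g' from LinearMap.ext fun v => (hg' v).symm,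
      show ι x ∘ₗ S = ι g from LinearMap.ext fun v => (hg v).symm]

/-- closure under the coproduct -/
def MoSplit (ι : A →ₗ[ℂ] (U →ₗ[ℂ] ℂ)) (f : A) : Prop :=
  ∃ (κ : Type) (_ : Fintype κ) (a b : κ → A), ∀ y u, ι f (y * u) = ∑ k, ι (a k) y * ι (b k) u

theorem mo_D_closed (hι1 : ∀ u, ι 1 u = ε u)
    (hM : ∀ x y u, ι (x * y) u = moμ (ι x) (ι y) (Δ u))
    (G : Set A) (hG : Algebra.adjoin ℂ G = ⊤)
    (hGS : ∀ x ∈ G, MoSplit ι x) (f : A) : MoSplit ι f := by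
  have hf : f ∈ Algebra.adjoin ℂ G := by rw [hG]; trivial
  induction hf using Algebra.adjoin_induction with
  | mem x hx => exact hGS x hx
  | algebraMap r =>
    refine ⟨Unit, inferInstance, fun _ => algebraMap ℂ A r, fun _ => 1, fun y u => ?_⟩
    simp [Algebra.algebraMap_eq_smul_one, hι1, mul_assoc]
  | add x y _ _ hx hy =>
    obtain ⟨k, _, a, b, h⟩ := hx
    obtain ⟨k', _, a', b', h'⟩ := hy
    refine ⟨k ⊕ k', inferInstance, Sum.elim a a', Sum.elim b b', fun u v => ?_⟩
    simp [h, h']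
  | mul x y _ _ hx hy =>
    obtain ⟨k, _, a, b, h⟩ := hx
    obtain ⟨k', _, a', b', h'⟩ := hy
    refine ⟨k × k', inferInstance, fun p => a p.1 * a' p.2, fun p => b p.1 * b' p.2, fun u v => ?_⟩
    simp only [hM, map_mul]
    exact moμ_split _ _ (fun k => ι (a k)) (fun k => ι (b k)) (fun k => ι (a' k)) (fun k => ι (b' k))
      h h' _ _

theorem mo_split_cf {X : Type} [AddCommGroup X] [Module ℂ X] [FiniteDimensional ℂ X]
    (ρ : U →ₐ[ℂ] Module.End ℂ X) (cf : Module.Dual ℂ X → X → A)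
    (hcf : ∀ ξ v u, ι (cf ξ v) u = ξ (ρ u v)) (ξ : Module.Dual ℂ X) (v : X) :
    MoSplit ι (cf ξ v) := by
  let B := Module.finBasis ℂ X
  refine ⟨Fin (Module.finrank ℂ X), inferInstance, fun k => cf ξ (B k), fun k => cf (B.coord k) v,
    fun y u => ?_⟩
  simp only [hcf, map_mul, Module.End.mul_apply]
  conv_lhs => rw [← B.sum_repr (ρ u v)]
  simp only [map_sum, map_smul, smul_eq_mul, Module.Basis.coord_apply, mul_comm]

theorem mo_act_exists (hinj : Function.Injective ι) (hsp : ∀ f, MoSplit ι f) :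
    ∃ L : U →ₐ[ℂ] Module.End ℂ A, ∀ u f y, ι (L u f) y = ι f (y * u) := by
  have h : ∀ u f, ∃ g, ∀ y, ι g y = ι f (y * u) := by
    intro u f
    obtain ⟨k, _, a, b, h⟩ := hsp f
    exact ⟨∑ k, (ι (b k) u) • a k, fun y => by simp [h, mul_comm]⟩
  choose L hL using h
  have hext : ∀ f g, (∀ y, ι f y = ι g y) → f = g := fun f g h => hinj (LinearMap.ext h)
  let T : U → Module.End ℂ A := fun u =>
    { toFun := L u
      map_add' := fun f g => hext _ _ fun y => by simp [hL]
      map_smul' := fun r f => hext _ _ fun y => by simp [hL] }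
  have hT : ∀ u f y, ι (T u f) y = ι f (y * u) := hL
  refine ⟨{ toFun := T, map_one' := ?_, map_mul' := ?_, map_zero' := ?_, map_add' := ?_,
            commutes' := ?_ }, hL⟩
  · ext f; exact hext _ _ fun y => by rw [hT]; simp
  · intro u v; ext f; refine hext _ _ fun y => ?_
    rw [Module.End.mul_apply, hT, hT, hT, mul_assoc]
  · ext f; exact hext _ _ fun y => by rw [hT]; simp
  · intro u v; ext f; refine hext _ _ fun y => ?_
    rw [LinearMap.add_apply, map_add, LinearMap.add_apply, hT, hT, hT, mul_add, map_add]
  · intro r; ext f; refine hext _ _ fun y => ?_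
    rw [hT]; simp [Algebra.algebraMap_eq_smul_one]

/-- a nonzero stable right ideal is everything -/
theorem mo_J (hinj : Function.Injective ι) (hι1 : ∀ u, ι 1 u = ε u)
    (hM : ∀ x y u, ι (x * y) u = moμ (ι x) (ι y) (Δ u))
    (S : U →ₗ[ℂ] U)
    (hS : ∀ u, LinearMap.mul' ℂ U (TensorProduct.map LinearMap.id S (Δ u)) = ε u • 1)
    (hSc : ∀ f : A, ∃ g : A, ∀ u, ι g u = ι f (S u))
    (hsp : ∀ f, MoSplit ι f) (L : U →ₐ[ℂ] Module.End ℂ A)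
    (hL : ∀ u f y, ι (L u f) y = ι f (y * u))
    (J : Submodule ℂ A) (hJ0 : ∃ f ∈ J, f ≠ 0) (hJr : ∀ f ∈ J, ∀ g, f * g ∈ J)
    (hJL : ∀ u, ∀ f ∈ J, L u f ∈ J) : (1 : A) ∈ J := by
  obtain ⟨f, hf, hf1⟩ : ∃ f ∈ J, ι f 1 ≠ 0 := by
    obtain ⟨f, hf, hf0⟩ := hJ0
    by_contra hcon
    push Not at hcon
    apply hf0
    apply hinj
    ext u
    have := hcon _ (hJL u f hf)
    rw [hL, one_mul] at this
    simpa using this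
  obtain ⟨k, _, a, b, hab⟩ := hsp f
  let Lf : U →ₗ[ℂ] A := (LinearMap.applyₗ f) ∘ₗ L.toLinearMap
  have hLf : ∀ u, Lf u = L u f := fun u => rfl
  have hLfab : ∀ u, L u f = ∑ k, (ι (b k) u) • a k := fun u => by
    apply hinj; ext y; rw [hL]; simp [hab, mul_comm]
  let N := LinearMap.range Lf
  have hN : N ≤ Submodule.span ℂ (Set.range a) := by
    rintro _ ⟨u, rfl⟩
    rw [hLf, hLfab]
    exact Submodule.sum_mem _ fun i _ => Submodule.smul_mem _ _ (Submodule.subset_span ⟨i, rfl⟩)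
  have : FiniteDimensional ℂ (Submodule.span ℂ (Set.range a)) :=
    FiniteDimensional.span_of_finite ℂ (Set.finite_range a)
  have : FiniteDimensional ℂ N := Submodule.finiteDimensional_of_le hN
  let B := Module.finBasis ℂ N
  have hBJ : ∀ j, (B j : A) ∈ J := by
    intro j
    obtain ⟨u, hu⟩ := (B j).2
    rw [← hu]
    exact hJL u f hf
  choose ℓ hℓ using fun j => LinearMap.exists_extend (B.coord j)
  let b' : Fin (Module.finrank ℂ N) → A := fun j => ∑ k, ℓ j (a k) • b k
  have hb' : ∀ j u, ι (b' j) u = B.coord j ⟨L u f, u, rfl⟩ := by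
    intro j u
    rw [← hℓ j]
    simp only [LinearMap.comp_apply, Submodule.subtype_apply]
    rw [hLfab]
    simp [b', mul_comm]
  have hsplit : ∀ y u, ι f (y * u) = ∑ j, ι (B j : A) y * ι (b' j) u := by
    intro y u
    rw [← hL]
    have := B.sum_repr ⟨L u f, u, rfl⟩
    have h2 := congrArg (fun z : N => ι (z : A) y) this
    simp only [AddSubmonoidClass.coe_finsetSum, Submodule.coe_smul, map_sum, map_smul,
      LinearMap.sum_apply, LinearMap.smul_apply, smul_eq_mul] at h2
    rw [← h2]
    exact Finset.sum_congr rfl fun j _ => by rw [hb', mul_comm]; rfl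
  choose s hs using fun j => hSc (b' j)
  have hsum : ∑ j, (B j : A) * s j = (ι f 1) • (1 : A) := by
    apply hinj; ext u
    have := moμ_conv (ι f) (fun j => ι (B j : A)) (fun j => ι (b' j)) (fun j => ι (s j)) S hsplit hs (Δ u)
    rw [hS] at this
    simp only [map_sum, LinearMap.sum_apply, hM, this]
    simp [hι1, mul_comm]
  have : (ι f 1) • (1 : A) ∈ J := by
    rw [← hsum]
    exact Submodule.sum_mem _ fun j _ => hJr _ (hBJ j) _
  exact (Submodule.smul_mem_iff _ hf1).1 this

end MOA2
open scoped TensorProduct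

theorem mo_pkg {q : ℂ} {n : ℕ} {a : Fin n → Fin n → ℤ} {d : Fin n → ℕ} (C : MoCtx q a d)
    {U : Type} [Ring U] [Algebra ℂ U]
    (E F : Fin n → U) (K : Fin n → Uˣ)
    (hrel : UqRels q a d U E F K)
    (hUuniv : ∀ (B : Type) [Ring B] [Algebra ℂ B] (E' F' : Fin n → B) (K' : Fin n → Bˣ),
      UqRels q a d B E' F' K' → ∃! φ : U →ₐ[ℂ] B,
        (∀ i, φ (E i) = E' i) ∧ (∀ i, φ (F i) = F' i) ∧ (∀ i, φ (K i : U) = (K' i : B)))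
    (Δ : U →ₐ[ℂ] U ⊗[ℂ] U) (ε : U →ₐ[ℂ] ℂ)
    (hΔE : ∀ i, Δ (E i) = E i ⊗ₜ 1 + (K i : U) ⊗ₜ E i)
    (hΔF : ∀ i, Δ (F i) = F i ⊗ₜ (((K i)⁻¹ : Uˣ) : U) + 1 ⊗ₜ F i)
    (hΔK : ∀ i, Δ (K i : U) = (K i : U) ⊗ₜ (K i : U))
    (hεE : ∀ i, ε (E i) = 0) (hεF : ∀ i, ε (F i) = 0) (hεK : ∀ i, ε (K i : U) = 1)
    (V : (Fin n → ℕ) → Type) [∀ c, AddCommGroup (V c)] [∀ c, Module ℂ (V c)]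
    (ρ : ∀ c, U →ₐ[ℂ] Module.End ℂ (V c))
    (hfd : ∀ c, FiniteDimensional ℂ (V c))
    (hsimple : ∀ c (N : Submodule ℂ (V c)), (∀ (u : U), ∀ v ∈ N, ρ c u v ∈ N) → N = ⊥ ∨ N = ⊤)
    (hhw : ∀ c, ∃ v : V c, v ≠ 0 ∧ v ∈ wtSp q d K (ρ c) (fun i => (c i : ℤ)) ∧
      ∀ i, ρ c (E i) v = 0)
    (hwtsum : ∀ c, (⨆ μ : Fin n → ℤ, wtSp q d K (ρ c) μ) = ⊤)
    (A : Type) [Ring A] [Algebra ℂ A]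
    (ι : A →ₗ[ℂ] (U →ₗ[ℂ] ℂ)) (hιinj : Function.Injective ι)
    (hι1 : ι 1 = ε.toLinearMap)
    (hιmul : ∀ x y : A, ι (x * y) =
      (TensorProduct.lid ℂ ℂ).toLinearMap ∘ₗ (TensorProduct.map (ι x) (ι y)) ∘ₗ Δ.toLinearMap)
    (cf : ∀ c : Fin n → ℕ, Module.Dual ℂ (V c) → V c → A)
    (hcf : ∀ c ξ v u, ι (cf c ξ v) u = ξ (ρ c u v))
    (hAgen : Algebra.adjoin ℂ {x : A | ∃ c ξ v, x = cf c ξ v} = ⊤) :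
    (∃ b, MoPos a d b) ∧ MoGen E F K ∧ ∃ L : U →ₐ[ℂ] Module.End ℂ A,
      (∀ u c ξ v, L u (cf c ξ v) = cf c ξ (ρ c u v)) ∧
      (∀ i f g, L (E i) (f * g) = L (E i) f * g + L (K i : U) f * L (E i) g) ∧
      (∀ i f g, L (F i) (f * g) = L (F i) f * L (((K i)⁻¹ : Uˣ) : U) g + f * L (F i) g) ∧
      (∀ i f g, L (K i : U) (f * g) = L (K i : U) f * L (K i : U) g) ∧
      (∀ i f g, L (((K i)⁻¹ : Uˣ) : U) (f * g) =
        L (((K i)⁻¹ : Uˣ) : U) f * L (((K i)⁻¹ : Uˣ) : U) g) ∧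
      (∀ u, L u 1 = ε u • 1) ∧ (∀ i, ε (((K i)⁻¹ : Uˣ) : U) = 1) ∧
      (∀ J : Submodule ℂ A, (∃ f ∈ J, f ≠ 0) → (∀ f ∈ J, ∀ g, f * g ∈ J) →
        (∀ u, ∀ f ∈ J, L u f ∈ J) → (1 : A) ∈ J) := by
  have hgen : MoGen E F K := fun S h1 h2 h3 h4 u => mo_U_gen hrel hUuniv S h1 h2 h3 h4 u
  have hΔK' : ∀ i, Δ (((K i)⁻¹ : Uˣ) : U) = (((K i)⁻¹ : Uˣ) : U) ⊗ₜ (((K i)⁻¹ : Uˣ) : U) := by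
    intro i
    have h1 : Δ (((K i)⁻¹ : Uˣ) : U) * Δ (K i : U) = 1 := by rw [← map_mul]; simp
    have h2 : Δ (K i : U) * ((((K i)⁻¹ : Uˣ) : U) ⊗ₜ (((K i)⁻¹ : Uˣ) : U)) = 1 := by
      rw [hΔK, Algebra.TensorProduct.tmul_mul_tmul]; simp [Algebra.TensorProduct.one_def]
    exact left_inv_eq_right_inv h1 h2
  have hεK' : ∀ i, ε (((K i)⁻¹ : Uˣ) : U) = 1 := by
    intro i
    have h1 : ε (((K i)⁻¹ : Uˣ) : U) * ε (K i : U) = 1 := by rw [← map_mul]; simp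
    rwa [hεK, mul_one] at h1
  obtain ⟨S, hS1, hSm, hSK, hSK', hS, hΔS, hεS, hSs⟩ :=
    mo_antipode C hrel hUuniv Δ ε hΔE hΔF hΔK hΔK' hεE hεF hεK hεK'
  have hpos : ∃ b, MoPos a d b := by
    obtain ⟨v, hv, hvW, -⟩ := hhw (fun _ => 1)
    have := hfd (fun _ => 1)
    refine mo_exists_pos C (moRepMod C hrel (ρ (fun _ => 1))) v hv ?_
    rw [moRepMod_W]
    simpa using hvW
  obtain ⟨b, H⟩ := hpos
  have hM : ∀ x y u, ι (x * y) u = moμ (ι x) (ι y) (Δ u) := by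
    intro x y u; rw [hιmul]; rfl
  have h1 : ∀ u, ι 1 u = ε u := by intro u; rw [hι1]; rfl
  have hSc : ∀ f : A, ∃ g : A, ∀ u, ι g u = ι f (S u) := by
    refine mo_S_closed h1 hM S hΔS hεS _ hAgen ?_
    rintro _ ⟨c, ξ, v, rfl⟩
    by_cases hξ : ξ = 0
    · exact ⟨0, fun u => by rw [hcf, hξ]; simp⟩
    have := hfd c
    obtain ⟨w, hw, -⟩ := hhw c
    have : Nontrivial (V c) := ⟨⟨w, 0, hw⟩⟩
    obtain ⟨c', ξ', v', h⟩ := mo_coef C H hrel hgen V ρ hfd hhw (moDual S hS1 hSm (ρ c))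
      (moDual_simple S hS1 hSm hSs (ρ c) (hsimple c))
      (moDual_wt C hrel hgen S hS1 hSm hSK hSs (ρ c) (hsimple c) (hwtsum c))
      (Module.Dual.eval ℂ (V c) v) ξ hξ
    refine ⟨cf c' ξ' v', fun u => ?_⟩
    rw [hcf, hcf, ← h]
    rfl
  have hsp : ∀ f, MoSplit ι f := by
    refine mo_D_closed h1 hM _ hAgen ?_
    rintro _ ⟨c, ξ, v, rfl⟩
    have := hfd c
    exact mo_split_cf (ρ c) (cf c) (hcf c) ξ v
  obtain ⟨L, hL⟩ := mo_act_exists hιinj hsp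
  have hext : ∀ f g, (∀ y, ι f y = ι g y) → f = g := fun f g h => hιinj (LinearMap.ext h)
  refine ⟨⟨b, H⟩, hgen, L, ?_, ?_, ?_, ?_, ?_, ?_, hεK', ?_⟩
  · intro u c ξ v
    refine hext _ _ fun y => ?_
    rw [hL, hcf, hcf, map_mul]; rfl
  · intro i f g
    refine hext _ _ fun y => ?_
    rw [hL, hM, map_mul, hΔE, mul_add, map_add, map_add, LinearMap.add_apply, hM, hM,
      moμ_mul_right _ _ (ι (L (E i) f)) (ι g) _ _ (hL _ _) (fun y => by rw [mul_one]),
      moμ_mul_right _ _ _ _ _ _ (hL _ _) (hL _ _)]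
  · intro i f g
    refine hext _ _ fun y => ?_
    rw [hL, hM, map_mul, hΔF, mul_add, map_add, map_add, LinearMap.add_apply, hM, hM,
      moμ_mul_right _ _ _ _ _ _ (hL _ _) (hL _ _),
      moμ_mul_right _ _ (ι f) (ι (L (F i) g)) _ _ (fun y => by rw [mul_one]) (hL _ _)]
  · intro i f g
    refine hext _ _ fun y => ?_
    rw [hL, hM, map_mul, hΔK, hM, moμ_mul_right _ _ _ _ _ _ (hL _ _) (hL _ _)]
  · intro i f g
    refine hext _ _ fun y => ?_
    rw [hL, hM, map_mul, hΔK', hM, moμ_mul_right _ _ _ _ _ _ (hL _ _) (hL _ _)]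
  · intro u
    refine hext _ _ fun y => ?_
    rw [hL, h1]
    simp [h1, mul_comm]
  · exact mo_J hιinj h1 hM S hS hSc hsp L hL
section MOFin
variable {D : Type} [DivisionRing D] [Algebra ℂ D]

/-- span of weight vectors -/
def moWS (κ : D ≃ₐ[ℂ] D) (t : ℂ) : Submodule ℂ D :=
  Submodule.span ℂ {z | ∃ m : ℤ, κ z = t ^ m • z}

theorem moWS_le_gr (κ : D ≃ₐ[ℂ] D) (t : ℂ) (ht : t ≠ 0) (x : D) (hx : x ∈ moWS κ t) :
    x ∈ moGr κ t ht ⊤ := by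
  induction hx using Submodule.span_induction with
  | mem x hx =>
    obtain ⟨m, hm⟩ := hx
    exact mo_gr_mem_of_wt ht trivial hm
  | zero => exact Subring.zero_mem _
  | add x y _ _ hx hy => exact Subring.add_mem _ hx hy
  | smul c x _ hx =>
    rw [Algebra.smul_def]
    refine Subring.mul_mem _ (mo_gr_mem_of_wt (l := 0) ht trivial ?_) hx
    simp

theorem mo_gr_le_WS (κ : D ≃ₐ[ℂ] D) (t : ℂ) (ht : t ≠ 0) (hroot : ∀ j : ℕ, t ^ (j + 1) ≠ 1)
    (x : D) (hx : x ∈ moGr κ t ht ⊤) : x ∈ moWS κ t := by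
  have := mo_gr_comp κ t ht hroot ⊤ (fun _ _ => trivial) x trivial hx
  refine Submodule.span_mono ?_ this
  rintro z ⟨-, h⟩
  exact h

theorem moWS_map (κ : D ≃ₐ[ℂ] D) (t : ℂ) (ht : t ≠ 0) (T : D →ₗ[ℂ] D) (c : ℤ)
    (hT : ∀ x, κ (T x) = t ^ c • T (κ x)) (x : D) (hx : x ∈ moWS κ t) : T x ∈ moWS κ t := by
  induction hx using Submodule.span_induction with
  | mem x hx =>
    obtain ⟨m, hm⟩ := hx
    refine Submodule.subset_span ⟨c + m, ?_⟩
    rw [hT, hm, map_smul, smul_smul, zpow_add₀ ht]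
  | zero => simp
  | add x y _ _ hx hy => rw [map_add]; exact Submodule.add_mem _ hx hy
  | smul c x _ hx => rw [map_smul]; exact Submodule.smul_mem _ _ hx

theorem mo_nil_map (δ T : D →ₗ[ℂ] D) (c : ℂ) (hT : ∀ x, δ (T x) = c • T (δ x)) (N : ℕ) (x : D)
    (hx : (δ ^ N) x = 0) : (δ ^ N) (T x) = 0 := by
  have : ∀ N x, (δ ^ N) (T x) = c ^ N • T ((δ ^ N) x) := by
    intro N
    induction N with
    | zero => simp
    | succ N ih =>
      intro x
      rw [pow_succ, Module.End.mul_apply, Module.End.mul_apply, hT, map_smul, ih, smul_smul,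
        pow_succ, mul_comm]
  rw [this, hx, map_zero, smul_zero]

theorem mo_nil_cancel (κ : D ≃ₐ[ℂ] D) (δ : D →ₗ[ℂ] D) (s : ℂ)
    (hδ : ∀ x y, δ (x * y) = δ x * y + κ x * δ y) (hκδ : ∀ x, δ (κ x) = s • κ (δ x)) (N : ℕ) :
    ∀ c w : D, c ≠ 0 → δ c = 0 → (δ ^ N) (c * w) = 0 → (δ ^ N) w = 0 := by
  induction N with
  | zero =>
    intro c w hc _ h
    have h : c * w = 0 := by simpa using h
    have : w = 0 := (mul_eq_zero.1 h).resolve_left hc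
    simpa using this
  | succ N ih =>
    intro c w hc h0 h
    rw [pow_succ, Module.End.mul_apply] at h ⊢
    rw [hδ, h0, zero_mul, zero_add] at h
    refine ih (κ c) (δ w) (fun h => hc (by simpa using h)) ?_ h
    rw [hκδ, h0]; simp

end MOFin

section MOFin2
variable {q : ℂ} {n : ℕ} {a : Fin n → Fin n → ℤ} {d : Fin n → ℕ}
variable {D : Type} [DivisionRing D] [Algebra ℂ D]

/-- the action data on the division ring -/
structure MoAct (q : ℂ) {n : ℕ} (d : Fin n → ℕ) (D : Type) [DivisionRing D]
    [Algebra ℂ D] (I : Type) (A : Subring D) where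
  κ : Fin n → D ≃ₐ[ℂ] D
  δ : I → D →ₗ[ℂ] D
  π : I → Fin n
  c : Fin n → I → ℤ
  q0 : q ≠ 0
  qr : ∀ j : ℕ, q ^ (j + 1) ≠ 1
  dp : ∀ i, 0 < d i
  comm : ∀ i j x, κ i (κ j x) = κ j (κ i x)
  leib : ∀ p x y, δ p (x * y) = δ p x * y + κ (π p) x * δ p y
  cδ : ∀ i p x, κ i (δ p x) = (q ^ (d i : ℤ)) ^ (c i p) • δ p (κ i x)
  cne : ∀ p, c (π p) p ≠ 0
  Aκ : ∀ i, ∀ x ∈ A, κ i x ∈ A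
  Aκ' : ∀ i, ∀ x ∈ A, (κ i).symm x ∈ A
  Aδ : ∀ p, ∀ x ∈ A, δ p x ∈ A
  Anil : ∀ p, ∀ x ∈ A, ∃ m, (δ p ^ m) x = 0
  Ane : ∀ p, ∃ x ∈ A, δ p x ≠ 0
  Agr : ∀ i, A ≤ moGr (κ i) (q ^ (d i : ℤ)) (zpow_ne_zero _ q0) A
  fl : ∀ x : D, ∃ a ∈ A, ∃ b ∈ A, b ≠ 0 ∧ x = b⁻¹ * a
  fr : ∀ x : D, ∃ a ∈ A, ∃ b ∈ A, b ≠ 0 ∧ x = a * b⁻¹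

namespace MoAct
variable {I : Type} {A : Subring D} (P : MoAct q d D I A)

/-- parameter -/
noncomputable def t (_ : MoAct q d D I A) (i : Fin n) : ℂ := q ^ (d i : ℤ)

theorem t0 (i : Fin n) : P.t i ≠ 0 := zpow_ne_zero _ P.q0

theorem troot (i : Fin n) : ∀ j : ℕ, P.t i ^ (j + 1) ≠ 1 := mo_pow_root P.qr (P.dp i)

/-- commutation parameter -/
noncomputable def s (p : I) : ℂ := P.t (P.π p) ^ (-(P.c (P.π p) p))

theorem s0 (p : I) : P.s p ≠ 0 := zpow_ne_zero _ (P.t0 _)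

theorem sroot (p : I) : ∀ j : ℕ, P.s p ^ (j + 1) ≠ 1 := by
  intro j h
  have h2 : P.t (P.π p) ^ (-(P.c (P.π p) p) * ((j + 1 : ℕ) : ℤ)) = P.t (P.π p) ^ (0 : ℤ) := by
    rw [zpow_mul, zpow_natCast, zpow_zero]; exact h
  have h3 := mo_zpow_inj (P.t0 _) (P.troot _) h2
  have h4 := P.cne p
  rcases mul_eq_zero.1 h3 with h5 | h5
  · exact h4 (by omega)
  · omega

theorem δκ (i : Fin n) (p : I) (x : D) :
    P.δ p (P.κ i x) = P.t i ^ (-(P.c i p)) • P.κ i (P.δ p x) := by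
  rw [P.cδ, smul_smul]
  unfold t
  rw [← zpow_add₀ (zpow_ne_zero _ P.q0)]; simp

theorem δκ' (i : Fin n) (p : I) (x : D) :
    P.δ p ((P.κ i).symm x) = P.t i ^ (P.c i p) • (P.κ i).symm (P.δ p x) := by
  apply (P.κ i).injective
  rw [P.cδ, map_smul]; simp [t]

/-- nilpotent subring -/
noncomputable def nil (p : I) : Subring D := moNil (P.κ (P.π p)) (P.δ p) (P.s p) (P.leib p) (P.δκ _ p)

theorem mem_nil (p : I) (x : D) : x ∈ P.nil p ↔ ∃ m, (P.δ p ^ m) x = 0 := Iff.rfl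

/-- the big integrable part -/
noncomputable def L : Submodule ℂ D where
  carrier := {x | (∀ p, x ∈ P.nil p) ∧ ∀ i, x ∈ moWS (P.κ i) (P.t i)}
  zero_mem' := ⟨fun p => Subring.zero_mem _, fun i => Submodule.zero_mem _⟩
  add_mem' := fun h h' => ⟨fun p => Subring.add_mem _ (h.1 p) (h'.1 p),
    fun i => Submodule.add_mem _ (h.2 i) (h'.2 i)⟩
  smul_mem' := fun r x h => ⟨fun p => by
    obtain ⟨m, hm⟩ := h.1 p
    exact ⟨m, by rw [map_smul, hm, smul_zero]⟩, fun i => Submodule.smul_mem _ _ (h.2 i)⟩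

theorem L_κ (i : Fin n) (x : D) (hx : x ∈ P.L) : P.κ i x ∈ P.L := by
  refine ⟨fun p => ?_, fun j => ?_⟩
  · obtain ⟨m, hm⟩ := hx.1 p
    exact ⟨m, mo_nil_map (P.δ p) (P.κ i).toLinearMap _ (P.δκ i p) m x hm⟩
  · exact moWS_map (P.κ j) (P.t j) (P.t0 j) (P.κ i).toLinearMap 0 (fun x => by
      simp [P.comm]) x (hx.2 j)

theorem L_κ' (i : Fin n) (x : D) (hx : x ∈ P.L) : (P.κ i).symm x ∈ P.L := by
  refine ⟨fun p => ?_, fun j => ?_⟩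
  · obtain ⟨m, hm⟩ := hx.1 p
    exact ⟨m, mo_nil_map (P.δ p) (P.κ i).symm.toLinearMap _ (P.δκ' i p) m x hm⟩
  · exact moWS_map (P.κ j) (P.t j) (P.t0 j) (P.κ i).symm.toLinearMap 0 (fun x => by
      apply (P.κ i).injective
      simp [P.comm i j]) x (hx.2 j)

theorem L_δ (r : I) (y : D) (hy : y ∈ P.L) : P.δ r y ∈ P.L := by
  refine ⟨fun p => ?_, fun j => ?_⟩
  · obtain ⟨m, hm⟩ := hy.1 p
    obtain ⟨c, hc, hc0, hδc, hcy⟩ := mo_den (P.κ (P.π p)) (P.δ p) (P.s p) (P.s0 p) (P.sroot p)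
      (P.leib p) (P.δκ _ p) A (P.Aδ p) (P.Anil p) (P.Ane p) P.fl m y hm
    have h1 : P.κ (P.π r) c * P.δ r y ∈ P.nil p := by
      have h2 := P.leib r c y
      rw [← sub_eq_iff_eq_add'] at h2
      rw [← h2]
      exact Subring.sub_mem _ (P.Anil p _ (P.Aδ r _ hcy))
        (Subring.mul_mem _ (P.Anil p _ (P.Aδ r _ hc)) (hy.1 p))
    obtain ⟨N, hN⟩ := h1
    refine ⟨N, mo_nil_cancel (P.κ (P.π p)) (P.δ p) (P.s p) (P.leib p) (P.δκ _ p) N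
      (P.κ (P.π r) c) _ (fun h => hc0 (by simpa using h)) ?_ hN⟩
    rw [P.δκ, hδc]; simp
  · exact moWS_map (P.κ j) (P.t j) (P.t0 j) (P.δ r) (P.c j r) (P.cδ j r) y (hy.2 j)

theorem R_le_L (R : Subring D) (hAR : A ≤ R) (x₁ x₂ : D) (h₁ : x₁ ≠ 0) (h₂ : x₂ ≠ 0)
    (hab : ∀ x ∈ R, x₁ * x * x₂ ∈ A) (x : D) (hx : x ∈ R) : x ∈ P.L := by
  refine ⟨fun p => ?_, fun i => ?_⟩
  · exact mo_nil_max (P.κ (P.π p)) (P.δ p) (P.s p) (P.s0 p) (P.sroot p)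
      (P.leib p) (P.δκ _ p) A (P.Aδ p) (P.Anil p) (P.Ane p) P.fl R hAR P.fr x₁ x₂ h₁ h₂ hab x hx
  · exact mo_gr_le_WS _ _ (P.t0 i) (P.troot i) x
      (mo_gr_max (P.κ i) (P.t i) (P.t0 i) (P.troot i) A R (P.Agr i) hAR P.fr P.fl x₁ x₂ h₁ h₂ hab hx)

theorem L_span (x : D) (hx : x ∈ P.L) :
    x ∈ Submodule.span ℂ {z | z ∈ P.L ∧ ∀ i, ∃ m : ℤ, P.κ i z = P.t i ^ m • z} := by
  classical
  have key : ∀ s : Finset (Fin n), ∀ x ∈ P.L,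
      x ∈ Submodule.span ℂ {z | z ∈ P.L ∧ ∀ i ∈ s, ∃ m : ℤ, P.κ i z = P.t i ^ m • z} := by
    intro s
    induction s using Finset.induction_on with
    | empty => intro x hx; exact Submodule.subset_span ⟨hx, by simp⟩
    | insert i s his ih =>
      intro x hx
      refine (Submodule.span_le.2 ?_) (ih x hx)
      rintro z ⟨hz, hzs⟩
      choose! m hm using hzs
      let L' : Submodule ℂ D := P.L ⊓ ⨅ j ∈ s,
        LinearMap.ker ((P.κ j).toLinearMap - (P.t j ^ m j) • LinearMap.id)
      have hL' : ∀ w, w ∈ L' ↔ w ∈ P.L ∧ ∀ j ∈ s, P.κ j w = P.t j ^ m j • w := by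
        intro w; simp [L', Submodule.mem_iInf, sub_eq_zero]
      have h1 := mo_gr_comp (P.κ i) (P.t i) (P.t0 i) (P.troot i) L' (by
        intro w hw
        rw [hL'] at hw ⊢
        refine ⟨P.L_κ i w hw.1, fun j hj => ?_⟩
        rw [P.comm, hw.2 j hj, map_smul]) z ((hL' z).2 ⟨hz, hm⟩)
        (moWS_le_gr _ _ (P.t0 i) z (hz.2 i))
      refine Submodule.span_mono ?_ h1
      rintro w ⟨hw, hwi⟩
      rw [hL'] at hw
      refine ⟨hw.1, fun j hj => ?_⟩
      rcases Finset.mem_insert.1 hj with rfl | hj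
      · exact hwi
      · exact ⟨_, hw.2 j hj⟩
  simpa using key Finset.univ x hx

theorem final (C : MoCtx q a d) {b : Fin n → ℤ} (H : MoPos a d b)
    (e g : Fin n → I)
    (hce : ∀ i j, P.c i (e j) = a i j) (hcg : ∀ i j, P.c i (g j) = -a i j)
    (hI : ∀ p, (∃ i, p = e i) ∨ ∃ i, p = g i)
    (hef : ∀ i j z, P.δ (e i) ((P.κ j).symm (P.δ (g j) z)) - (P.κ j).symm (P.δ (g j) (P.δ (e i) z))
      = if i = j then (q ^ (d i : ℤ) - q ^ (-(d i : ℤ)))⁻¹ • (P.κ i z - (P.κ i).symm z) else 0)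
    (hscal : ∀ (r : ℂ), ∀ x ∈ A, r • x ∈ A)
    (hcom : ∀ S : Set D, S.Finite → ∃ y ∈ A, y ≠ 0 ∧ ∀ x ∈ S, x * y ∈ A)
    (hJ : ∀ J : Submodule ℂ D, (∀ x ∈ J, x ∈ A) → (∃ x ∈ J, x ≠ 0) → (∀ x ∈ J, ∀ y ∈ A, x * y ∈ J) →
      (∀ i, ∀ x ∈ J, P.κ i x ∈ J) → (∀ i, ∀ x ∈ J, (P.κ i).symm x ∈ J) →
      (∀ p, ∀ x ∈ J, P.δ p x ∈ J) → (1 : D) ∈ J)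
    (R : Subring D) (hAR : A ≤ R) (x₁ x₂ : D) (h₁ : x₁ ≠ 0) (h₂ : x₂ ≠ 0)
    (hab : ∀ x ∈ R, x₁ * x * x₂ ∈ A) (x : D) (hx : x ∈ R) : x ∈ A := by
  let f : Fin n → Module.End ℂ D := fun i => (P.κ i).symm.toLinearMap ∘ₗ P.δ (g i)
  let Q : MoMod a D := moBuild (a := a) C.h0 C.hr C.hd (fun i => (P.κ i).toLinearMap)
    (fun i => (P.κ i).symm.toLinearMap) (fun i => P.δ (e i)) f P.L
    (fun i j => LinearMap.ext fun x => P.comm i j x) (fun i => LinearMap.ext fun x => by simp)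
    (fun i j z => by
      have := P.cδ i (e j) z
      rw [hce, ← zpow_mul] at this
      exact this)
    (fun i j z => by
      have := P.cδ i (g j) z
      rw [hcg, ← zpow_mul, mul_neg] at this
      change P.κ i ((P.κ j).symm (P.δ (g j) z)) = _ • (P.κ j).symm (P.δ (g j) (P.κ i z))
      rw [← map_smul, ← this]
      apply (P.κ j).injective
      rw [P.comm]; simp)
    hef (fun i z hz => P.L_δ _ z hz) (fun i z hz => P.L_κ' i _ (P.L_δ _ z hz))
    (fun i ν z hz _ => hz.1 (e i))
    (fun i ν z hz hw => by
      obtain ⟨N, hN⟩ := hz.1 (g i)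
      refine ⟨N, ?_⟩
      clear hz hw
      induction N generalizing z with
      | zero => simpa using hN
      | succ N ih =>
        rw [pow_succ, Module.End.mul_apply] at hN ⊢
        exact ih _ (mo_nil_map (P.δ (g i)) (P.κ i).symm.toLinearMap _ (P.δκ' i (g i)) N _ hN))
  have hQW : ∀ ν z, z ∈ Q.W ν ↔ z ∈ P.L ∧ ∀ i, P.κ i z = q ^ (ν i * (d i : ℤ)) • z := by
    intro ν z
    change z ∈ P.L ⊓ moW q d (fun i => (P.κ i).toLinearMap) ν ↔ _
    rw [Submodule.mem_inf, mem_moW]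
    rfl
  have hxL := P.R_le_L R hAR x₁ x₂ h₁ h₂ hab x hx
  have hxs := P.L_span x hxL
  let A' : Submodule ℂ D :=
    { carrier := A, zero_mem' := A.zero_mem, add_mem' := fun h h' => A.add_mem h h',
      smul_mem' := fun r x hx => hscal r x hx }
  have hA' : ∀ x, x ∈ A' ↔ x ∈ A := fun x => Iff.rfl
  refine (hA' x).1 ((Submodule.span_le.2 ?_) hxs)
  rintro z ⟨hzL, hzw⟩
  choose ν hν using hzw
  obtain ⟨T, hTf, hTw, hzT, hTe, hTg⟩ := Q.exists_fd H z ν ((hQW _ _).2 ⟨hzL, fun i => by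
    rw [hν]; unfold t; rw [← zpow_mul, mul_comm]⟩)
  set X := Submodule.span ℂ T with hX
  have hXκ : ∀ i, ∀ y ∈ X, P.κ i y ∈ X := by
    intro i y hy
    induction hy using Submodule.span_induction with
    | mem y hy =>
      obtain ⟨ω, hω⟩ := hTw y hy
      rw [((hQW _ _).1 hω).2 i]
      exact Submodule.smul_mem _ _ (Submodule.subset_span hy)
    | zero => simp
    | add x y _ _ hx hy => rw [map_add]; exact Submodule.add_mem _ hx hy
    | smul c x _ hx => rw [map_smul]; exact Submodule.smul_mem _ _ hx
  have hXκ' : ∀ i, ∀ y ∈ X, (P.κ i).symm y ∈ X := by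
    intro i y hy
    induction hy using Submodule.span_induction with
    | mem y hy =>
      obtain ⟨ω, hω⟩ := hTw y hy
      have h1 := ((hQW _ _).1 hω).2 i
      have h2 : (P.κ i).symm y = (q ^ (ω i * (d i : ℤ)))⁻¹ • y := by
        apply (P.κ i).injective
        rw [map_smul, h1, smul_smul, inv_mul_cancel₀ (zpow_ne_zero _ P.q0)]; simp
      rw [h2]
      exact Submodule.smul_mem _ _ (Submodule.subset_span hy)
    | zero => simp
    | add x y _ _ hx hy => rw [map_add]; exact Submodule.add_mem _ hx hy
    | smul c x _ hx => rw [map_smul]; exact Submodule.smul_mem _ _ hx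
  have hXδ : ∀ p, ∀ y ∈ X, P.δ p y ∈ X := by
    intro p y hy
    rcases hI p with ⟨i, rfl⟩ | ⟨i, rfl⟩
    · exact hTe i y hy
    · have h1 : (P.κ i).symm (P.δ (g i) y) ∈ X := hTg i y hy
      have := hXκ i _ h1
      simpa using this
  let J : Submodule ℂ D :=
    { carrier := {y | y ∈ A ∧ ∀ w ∈ X, w * y ∈ A}
      zero_mem' := ⟨A.zero_mem, fun w _ => by rw [mul_zero]; exact A.zero_mem⟩
      add_mem' := fun h h' => ⟨A.add_mem h.1 h'.1, fun w hw => by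
        rw [mul_add]; exact A.add_mem (h.2 w hw) (h'.2 w hw)⟩
      smul_mem' := fun r x h => ⟨hscal r x h.1, fun w hw => by
        rw [mul_smul_comm]; exact hscal r _ (h.2 w hw)⟩ }
  have hJm : ∀ y, y ∈ J ↔ y ∈ A ∧ ∀ w ∈ X, w * y ∈ A := fun y => Iff.rfl
  have h1J : (1 : D) ∈ J := by
    refine hJ J (fun y hy => hy.1) ?_ ?_ ?_ ?_ ?_
    · obtain ⟨y, hy, hy0, hyT⟩ := hcom T hTf
      refine ⟨y, ⟨hy, fun w hw => ?_⟩, hy0⟩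
      induction hw using Submodule.span_induction with
      | mem w hw => exact hyT w hw
      | zero => rw [zero_mul]; exact A.zero_mem
      | add x y _ _ hx hy => rw [add_mul]; exact A.add_mem hx hy
      | smul c x _ hx => rw [smul_mul_assoc]; exact hscal _ _ hx
    · intro y hy y' hy'
      refine ⟨A.mul_mem hy.1 hy', fun w hw => ?_⟩
      rw [← mul_assoc]; exact A.mul_mem (hy.2 w hw) hy'
    · intro i y hy
      refine ⟨P.Aκ i _ hy.1, fun w hw => ?_⟩
      have := P.Aκ i _ (hy.2 _ (hXκ' i w hw))
      simpa using this
    · intro i y hy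
      refine ⟨P.Aκ' i _ hy.1, fun w hw => ?_⟩
      have := P.Aκ' i _ (hy.2 _ (hXκ i w hw))
      simpa using this
    · intro p y hy
      refine ⟨P.Aδ p _ hy.1, fun w hw => ?_⟩
      have hw' := hXκ' (P.π p) w hw
      have h2 := P.leib p ((P.κ (P.π p)).symm w) y
      rw [AlgEquiv.apply_symm_apply, ← sub_eq_iff_eq_add'] at h2
      rw [← h2]
      exact A.sub_mem (P.Aδ p _ (hy.2 _ hw')) (hy.2 _ (hXδ p _ hw'))
  have := h1J.2 z hzT
  rwa [mul_one] at this

end MoAct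
end MOFin2
section MOExt
variable {A D : Type} [Ring A] [Algebra ℂ A] [DivisionRing D] [Algebra ℂ D] (φ : A →ₐ[ℂ] D)
  (hinj : Function.Injective φ)
  (hfr : ∀ x : D, ∃ a b : A, b ≠ 0 ∧ x = φ a * (φ b)⁻¹)

include hfr in
theorem mo_hom_ext (f g : D →+* D) (h : ∀ a, f (φ a) = g (φ a)) (x : D) : f x = g x := by
  obtain ⟨a, b, -, rfl⟩ := hfr x
  rw [map_mul, map_mul, map_inv₀, map_inv₀, h, h]

include hinj hfr in
theorem mo_tw_zero (T : D → D) (α β : D → D)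
    (hα : ∀ x, x ≠ 0 → α x ≠ 0)
    (hT : ∀ x y, T (x * y) = T x * α y + β x * T y) (h : ∀ a, T (φ a) = 0) (x : D) : T x = 0 := by
  obtain ⟨a, b, hb, rfl⟩ := hfr x
  have hb0 : φ b ≠ 0 := fun h => hb (hinj (by simpa using h))
  have h1 := hT (φ a * (φ b)⁻¹) (φ b)
  rw [inv_mul_cancel_right₀ hb0, h, h, mul_zero, add_zero] at h1
  exact (mul_eq_zero.1 h1.symm).resolve_right (hα _ hb0)

include hinj hfr in
theorem mo_ext_κ (k k' : A →ₗ[ℂ] A) (h1 : k 1 = 1) (hm : ∀ x y, k (x * y) = k x * k y)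
    (h1' : k' 1 = 1) (hm' : ∀ x y, k' (x * y) = k' x * k' y)
    (hkk : ∀ x, k (k' x) = x) (hkk' : ∀ x, k' (k x) = x) :
    ∃ κ : D ≃ₐ[ℂ] D, (∀ a, κ (φ a) = φ (k a)) ∧ ∀ a, κ.symm (φ a) = φ (k' a) := by
  obtain ⟨κ, hκ⟩ := mo_ext_aut φ.toRingHom hinj hfr (AlgHom.ofLinearMap k h1 hm).toRingHom
    (fun x y h => by rw [← hkk' x, ← hkk' y]; exact congrArg k' h)
  obtain ⟨κ', hκ'⟩ := mo_ext_aut φ.toRingHom hinj hfr (AlgHom.ofLinearMap k' h1' hm').toRingHom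
    (fun x y h => by rw [← hkk x, ← hkk y]; exact congrArg k h)
  have e1 : ∀ a, κ (φ a) = φ (k a) := hκ
  have e2 : ∀ a, κ' (φ a) = φ (k' a) := hκ'
  have c1 : ∀ x, κ (κ' x) = x := mo_hom_ext φ hfr (κ.comp κ') (RingHom.id D) (fun a => by
    simp [e1, e2, hkk])
  have c2 : ∀ x, κ' (κ x) = x := mo_hom_ext φ hfr (κ'.comp κ) (RingHom.id D) (fun a => by
    simp [e1, e2, hkk'])
  let κe : D ≃ₐ[ℂ] D :=
    { toFun := κ, invFun := κ', left_inv := c2, right_inv := c1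
      map_mul' := map_mul κ, map_add' := map_add κ
      commutes' := fun r => by
        have : algebraMap ℂ D r = φ (algebraMap ℂ A r) := by simp
        rw [this, e1, Algebra.algebraMap_eq_smul_one, map_smul, h1] }
  exact ⟨κe, e1, e2⟩

include hinj hfr in
theorem mo_ext_δ (k : A →ₗ[ℂ] A) (h1 : k 1 = 1) (hm : ∀ x y, k (x * y) = k x * k y)
    (κ : D ≃ₐ[ℂ] D) (hκ : ∀ a, κ (φ a) = φ (k a)) (δ : A →ₗ[ℂ] A)
    (hδ : ∀ x y, δ (x * y) = δ x * y + k x * δ y) :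
    ∃ Δ : D →ₗ[ℂ] D, (∀ a, Δ (φ a) = φ (δ a)) ∧ ∀ x y, Δ (x * y) = Δ x * y + κ x * Δ y := by
  obtain ⟨Δ, e1, e2⟩ := mo_ext_der φ.toRingHom hinj hfr (AlgHom.ofLinearMap k h1 hm).toRingHom
    δ.toAddMonoidHom hδ (κ : D →+* D) hκ
  have e1 : ∀ a, Δ (φ a) = φ (δ a) := e1
  have e2 : ∀ x y, Δ (x * y) = Δ x * y + κ x * Δ y := e2
  have h0 : δ 1 = 0 := by have := hδ 1 1; simpa [h1] using this
  refine ⟨{ toFun := Δ, map_add' := map_add Δ, map_smul' := fun r x => ?_ }, e1, e2⟩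
  have h2 : (algebraMap ℂ D r) = φ (algebraMap ℂ A r) := by simp
  have h3 : κ (algebraMap ℂ D r) = algebraMap ℂ D r := by simp
  have h4 : Δ (algebraMap ℂ D r) = 0 := by
    rw [h2, e1, Algebra.algebraMap_eq_smul_one, map_smul, h0]; simp
  rw [Algebra.smul_def, e2, h3, h4, zero_mul, zero_add, RingHom.id_apply, Algebra.smul_def]

include hinj hfr in
/-- commutation of twisted derivations with automorphisms -/
theorem mo_ext_cδ (κ κ₁ : D ≃ₐ[ℂ] D) (hc : ∀ x, κ (κ₁ x) = κ₁ (κ x)) (Δ : D →ₗ[ℂ] D)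
    (hΔ : ∀ x y, Δ (x * y) = Δ x * y + κ x * Δ y) (r : ℂ)
    (h : ∀ a, κ₁ (Δ (φ a)) = r • Δ (κ₁ (φ a))) (x : D) : κ₁ (Δ x) = r • Δ (κ₁ x) := by
  rw [← sub_eq_zero]
  refine mo_tw_zero φ hinj hfr (fun x => κ₁ (Δ x) - r • Δ (κ₁ x)) κ₁ (fun x => κ (κ₁ x))
    (fun x hx h => hx (by simpa using h)) ?_ (fun a => by simp only [h, sub_self]) x
  intro x y
  simp only [map_mul, hΔ, map_add, smul_add, hc, sub_mul, mul_sub, smul_mul_assoc, mul_smul_comm]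
  abel

include hinj hfr in
theorem mo_ext_hef (κ κ₁ : D ≃ₐ[ℂ] D) (e g : D →ₗ[ℂ] D)
    (he : ∀ x y, e (x * y) = e x * y + κ x * e y)
    (hg : ∀ x y, g (x * y) = g x * y + κ₁ x * g y) (r s : ℂ)
    (hκκ : ∀ x, κ (κ₁ x) = κ₁ (κ x)) (r0 : r ≠ 0)
    (hκe : ∀ x, κ₁ (e x) = r • e (κ₁ x)) (hκg : ∀ x, κ (g x) = r⁻¹ • g (κ x))
    (hs : s = 0 ∨ κ = κ₁)
    (h : ∀ a, e (κ₁.symm (g (φ a))) - κ₁.symm (g (e (φ a))) = s • (κ (φ a) - κ.symm (φ a)))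
    (x : D) : e (κ₁.symm (g x)) - κ₁.symm (g (e x)) = s • (κ x - κ.symm x) := by
  have k1 : ∀ x, e (κ₁.symm x) = r • κ₁.symm (e x) := by
    intro x
    have := hκe (κ₁.symm x)
    apply κ₁.injective
    rw [this, map_smul]; simp
  have k2 : ∀ x, κ (κ₁.symm x) = κ₁.symm (κ x) := by
    intro x
    apply κ₁.injective
    rw [← hκκ]; simp
  rw [← sub_eq_zero]
  refine mo_tw_zero φ hinj hfr (fun x => e (κ₁.symm (g x)) - κ₁.symm (g (e x)) -
    s • (κ x - κ.symm x)) κ₁.symm κ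
    (fun x hx h => hx (by simpa using h)) ?_ (fun a => by simp only [h, sub_self]) x
  intro x y
  have m1 : e (κ₁.symm (g (x * y))) = e (κ₁.symm (g x)) * κ₁.symm y
      + κ₁.symm (g (κ x)) * κ₁.symm (e y) + (e x * κ₁.symm (g y) + κ x * e (κ₁.symm (g y))) := by
    rw [hg, map_add, map_mul, map_mul, map_add, he, he, k1 y, k2, hκg, map_smul, smul_mul_assoc,
      mul_smul_comm, smul_smul, inv_mul_cancel₀ r0, one_smul, AlgEquiv.symm_apply_apply]
  have m2 : κ₁.symm (g (e (x * y))) = κ₁.symm (g (e x)) * κ₁.symm y + e x * κ₁.symm (g y)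
      + (κ₁.symm (g (κ x)) * κ₁.symm (e y) + κ x * κ₁.symm (g (e y))) := by
    rw [he, map_add, hg, hg, map_add, map_add, map_add, map_mul, map_mul, map_mul, map_mul,
      AlgEquiv.symm_apply_apply, AlgEquiv.symm_apply_apply]
  have m3 : s • (κ (x * y) - κ.symm (x * y)) = s • (κ x - κ.symm x) * κ₁.symm y +
      κ x * (s • (κ y - κ.symm y)) := by
    rcases hs with rfl | rfl
    · simp
    · simp only [map_mul, smul_mul_assoc, mul_smul_comm, ← smul_add]
      congr 1
      noncomm_ring
  simp only [m1, m2, m3]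
  noncomm_ring

end MOExt
section MOLast
variable {q : ℂ} {n : ℕ} {a : Fin n → Fin n → ℤ} {d : Fin n → ℕ} (C : MoCtx q a d)
variable {U : Type} [Ring U] [Algebra ℂ U] {E F : Fin n → U} {K : Fin n → Uˣ}

include C in
theorem mo_rep_nil (hrel : UqRels q a d U E F K) {X : Type} [AddCommGroup X] [Module ℂ X]
    [FiniteDimensional ℂ X] (ρ : U →ₐ[ℂ] Module.End ℂ X)
    (hwt : (⨆ μ : Fin n → ℤ, wtSp q d K ρ μ) = ⊤) (i : Fin n) (v : X) :
    (∃ N : ℕ, (ρ (E i) ^ N) v = 0) ∧ ∃ N : ℕ, (ρ ((K i : U) * F i) ^ N) v = 0 := by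
  have hind : iSupIndep (wtSp q d K ρ) := by
    have := (moRepMod C hrel ρ).ind
    rwa [show (moRepMod C hrel ρ).W = wtSp q d K ρ from funext (moRepMod_W C hrel ρ)] at this
  have key : ∀ (s : ℤ) (_ : s ≠ 0) (e : Module.End ℂ X)
      (_ : ∀ ν z, z ∈ wtSp q d K ρ ν → e z ∈ wtSp q d K ρ (ν + s • moA a (Pi.single i 1))) (v : X),
      ∃ N : ℕ, (e ^ N) v = 0 := by
    intro s hs e he v
    have hv : v ∈ ⨆ μ : Fin n → ℤ, wtSp q d K ρ μ := by rw [hwt]; trivial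
    induction hv using Submodule.iSup_induction' with
    | mem ν x hx => exact mo_fd_nil C _ hind i s hs e he ν x hx
    | zero => exact ⟨0, by simp⟩
    | add x y _ _ hx hy =>
      obtain ⟨N, hN⟩ := hx
      obtain ⟨M, hM⟩ := hy
      refine ⟨N + M, ?_⟩
      rw [map_add]
      nth_rewrite 1 [add_comm N M]
      rw [pow_add, pow_add, Module.End.mul_apply, Module.End.mul_apply, hN, hM]
      simp
  constructor
  · refine key 1 one_ne_zero _ (fun ν z hz => ?_) v
    rw [← moRepMod_W C hrel] at hz ⊢
    rw [one_smul]
    exact (moRepMod C hrel ρ).eW i ν z hz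
  · refine key (-1) (by norm_num) _ (fun ν z hz => ?_) v
    rw [← moRepMod_W C hrel] at hz
    have := (moRepMod C hrel ρ).fW i ν z hz
    rw [moRepMod_W, moRepMod_f] at this
    rw [neg_one_smul, ← sub_eq_add_neg, map_mul, Module.End.mul_apply]
    have h2 := (mem_moW.1 this) i
    rw [h2]
    exact Submodule.smul_mem _ _ this

include C in
theorem mo_rep_ne (hrel : UqRels q a d U E F K) {X : Type} [AddCommGroup X] [Module ℂ X]
    (ρ : U →ₐ[ℂ] Module.End ℂ X) (v : X) (hv : v ≠ 0)
    (hvw : v ∈ wtSp q d K ρ (fun _ => 1)) (hve : ∀ i, ρ (E i) v = 0) (i : Fin n) :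
    ρ (E i) (ρ (F i) v) ≠ 0 ∧ ρ ((K i : U) * F i) v ≠ 0 := by
  have h1 := mo_hef C hrel ρ i i v
  rw [hve, map_zero, sub_zero, if_pos rfl, mo_Kinv C.h0 ρ hvw i, (mem_moW.1 hvw) i] at h1
  rw [one_mul, ← sub_smul, smul_smul, inv_mul_cancel₀, one_smul] at h1
  · refine ⟨by rw [h1]; exact hv, fun h0 => ?_⟩
    have h2 : ρ (((K i)⁻¹ : Uˣ) : U) (ρ ((K i : U) * F i) v) = ρ (F i) v := by
      rw [← Module.End.mul_apply, ← map_mul]; simp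
    rw [h0, map_zero] at h2
    rw [← h2, map_zero] at h1
    exact hv h1.symm
  · rw [sub_ne_zero]
    intro h
    have := mo_zpow_inj C.h0 C.hr h
    have := C.hd i
    omega
end MOLast
theorem OqG_maximal_order
    -- the deformation parameter: a transcendental complex number
    (q : ℂ) (hq : Transcendental ℚ q)
    -- Cartan data of the complex semisimple Lie algebra 𝔤 of rank n
    (n : ℕ) (hn : 0 < n) (a : Fin n → Fin n → ℤ) (d : Fin n → ℕ)
    (ha_diag : ∀ i, a i i = 2) (ha_off : ∀ i j, i ≠ j → a i j ≤ 0)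
    (ha_zero : ∀ i j, a i j = 0 ↔ a j i = 0)
    (hd_pos : ∀ i, 0 < d i)
    (ha_symm : ∀ i j, (d i : ℤ) * a i j = (d j : ℤ) * a j i)
    -- the quantised enveloping algebra U = U_q(𝔤): carries elements E i, F i and units K i
    -- satisfying the defining relations, and is universal for these relations
    (U : Type) [Ring U] [Algebra ℂ U]
    (E F : Fin n → U) (K : Fin n → Uˣ)
    (hrel : UqRels q a d U E F K)
    (hUuniv : ∀ (B : Type) [Ring B] [Algebra ℂ B] (E' F' : Fin n → B) (K' : Fin n → Bˣ),
      UqRels q a d B E' F' K' → ∃! φ : U →ₐ[ℂ] B,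
        (∀ i, φ (E i) = E' i) ∧ (∀ i, φ (F i) = F' i) ∧ (∀ i, φ (K i : U) = (K' i : B)))
    -- the Hopf algebra structure of U_q(𝔤)
    (Δ : U →ₐ[ℂ] U ⊗[ℂ] U) (ε : U →ₐ[ℂ] ℂ)
    (hΔE : ∀ i, Δ (E i) = E i ⊗ₜ 1 + (K i : U) ⊗ₜ E i)
    (hΔF : ∀ i, Δ (F i) = F i ⊗ₜ (((K i)⁻¹ : Uˣ) : U) + 1 ⊗ₜ F i)
    (hΔK : ∀ i, Δ (K i : U) = (K i : U) ⊗ₜ (K i : U))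
    (hεE : ∀ i, ε (E i) = 0) (hεF : ∀ i, ε (F i) = 0) (hεK : ∀ i, ε (K i : U) = 1)
    -- the simple finite-dimensional modules V(λ) of highest weight λ = ∑ c i ϖ i ∈ P⁺
    (V : (Fin n → ℕ) → Type) [∀ c, AddCommGroup (V c)] [∀ c, Module ℂ (V c)]
    (ρ : ∀ c, U →ₐ[ℂ] Module.End ℂ (V c))
    (hfd : ∀ c, FiniteDimensional ℂ (V c))
    (hsimple : ∀ c (N : Submodule ℂ (V c)), (∀ (u : U), ∀ v ∈ N, ρ c u v ∈ N) → N = ⊥ ∨ N = ⊤)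
    (hhw : ∀ c, ∃ v : V c, v ≠ 0 ∧ v ∈ wtSp q d K (ρ c) (fun i => (c i : ℤ)) ∧
      ∀ i, ρ c (E i) v = 0)
    (hwtsum : ∀ c, (⨆ μ : Fin n → ℤ, wtSp q d K (ρ c) μ) = ⊤)
    -- the quantised coordinate ring A = O_q(G): an algebra of linear forms on U (via the
    -- injection ι into the dual space, multiplication being convolution through Δ),
    -- generated by the coordinate functions cf c ξ v = c^λ_{ξ,v} : u ↦ ξ (u · v)
    (A : Type) [Ring A] [Algebra ℂ A]
    (ι : A →ₗ[ℂ] (U →ₗ[ℂ] ℂ)) (hιinj : Function.Injective ι)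
    (hι1 : ι 1 = ε.toLinearMap)
    (hιmul : ∀ x y : A, ι (x * y) =
      (TensorProduct.lid ℂ ℂ).toLinearMap ∘ₗ (TensorProduct.map (ι x) (ι y)) ∘ₗ Δ.toLinearMap)
    (cf : ∀ c : Fin n → ℕ, Module.Dual ℂ (V c) → V c → A)
    (hcf : ∀ c ξ v u, ι (cf c ξ v) u = ξ (ρ c u v))
    (hAgen : Algebra.adjoin ℂ {x : A | ∃ c ξ v, x = cf c ξ v} = ⊤)
    -- the division ring of fractions D of the noetherian domain O_q(G)
    (hdom : IsDomain A) (hnoeth : IsNoetherianRing A)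
    (D : Type) [DivisionRing D] [Algebra ℂ D] (φ : A →ₐ[ℂ] D)
    (hφinj : Function.Injective φ)
    (hfrac_r : ∀ x : D, ∃ a b : A, b ≠ 0 ∧ x = φ a * (φ b)⁻¹)
    (hfrac_l : ∀ x : D, ∃ a b : A, b ≠ 0 ∧ x = (φ b)⁻¹ * φ a) :
    -- O_q(G) is a maximal order in D: there is no ring R' with φ(A) ⊊ R' ⊆ D such that
    -- a R' b ⊆ φ(A) for some nonzero a, b ∈ D
    ∀ R' : Subring D, φ.toRingHom.range ≤ R' →
      (∃ a b : D, a ≠ 0 ∧ b ≠ 0 ∧ ∀ x ∈ R', a * x * b ∈ φ.toRingHom.range) →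
      R' = φ.toRingHom.range := by
  obtain ⟨hq0, hqr⟩ := mo_transc_root hq
  have C : MoCtx q a d := ⟨hq0, hqr, ha_diag, ha_off, hd_pos, ha_symm⟩
  obtain ⟨⟨b, H⟩, hgen, L, hLcf, hLE, hLF, hLK, hLK', hL1, hεK', hJ⟩ :=
    mo_pkg C E F K hrel hUuniv Δ ε hΔE hΔF hΔK hεE hεF hεK V ρ hfd hsimple hhw hwtsum A ι hιinj
      hι1 hιmul cf hcf hAgen
  have hext : ∀ f g, (∀ y, ι f y = ι g y) → f = g := fun f g h => hιinj (LinearMap.ext h)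
  have hcfa : ∀ c ξ v w, cf c ξ (v + w) = cf c ξ v + cf c ξ w := fun c ξ v w =>
    hext _ _ fun y => by simp [hcf]
  have hcfs : ∀ c ξ (r : ℂ) v, cf c ξ (r • v) = r • cf c ξ v := fun c ξ r v =>
    hext _ _ fun y => by simp [hcf]
  have hcf0 : ∀ c ξ, cf c ξ 0 = 0 := fun c ξ => hext _ _ fun y => by simp [hcf]
  have hLKK : ∀ i x, L (K i : U) (L (((K i)⁻¹ : Uˣ) : U) x) = x := fun i x => by
    rw [← Module.End.mul_apply, ← map_mul]; simp
  have hLKK' : ∀ i x, L (((K i)⁻¹ : Uˣ) : U) (L (K i : U) x) = x := fun i x => by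
    rw [← Module.End.mul_apply, ← map_mul]; simp
  have hLK1 : ∀ i, L (K i : U) 1 = 1 := fun i => by rw [hL1, hεK, one_smul]
  have hLK1' : ∀ i, L (((K i)⁻¹ : Uˣ) : U) 1 = 1 := fun i => by rw [hL1, hεK', one_smul]
  have hLG : ∀ i f g, L ((K i : U) * F i) (f * g) = L ((K i : U) * F i) f * g
      + L (K i : U) f * L ((K i : U) * F i) g := by
    intro i f g
    simp only [map_mul, Module.End.mul_apply]
    rw [hLF, map_add, hLK, hLK, hLKK]
  choose κ hκ hκ' using fun i => mo_ext_κ φ hφinj hfrac_r (L (K i : U)) (L (((K i)⁻¹ : Uˣ) : U))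
    (hLK1 i) (hLK i) (hLK1' i) (hLK' i) (hLKK i) (hLKK' i)
  choose e he heL using fun i => mo_ext_δ φ hφinj hfrac_r (L (K i : U)) (hLK1 i) (hLK i) (κ i) (hκ i)
    (L (E i)) (hLE i)
  choose g hg hgL using fun i => mo_ext_δ φ hφinj hfrac_r (L (K i : U)) (hLK1 i) (hLK i) (κ i) (hκ i)
    (L ((K i : U) * F i)) (hLG i)
  have hcomm : ∀ i j x, κ i (κ j x) = κ j (κ i x) := fun i j =>
    mo_hom_ext φ hfrac_r (((κ i : D →ₐ[ℂ] D).comp (κ j : D →ₐ[ℂ] D)).toRingHom)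
      (((κ j : D →ₐ[ℂ] D).comp (κ i : D →ₐ[ℂ] D)).toRingHom) (fun x => by
        change κ i (κ j (φ x)) = κ j (κ i (φ x))
        rw [hκ, hκ, hκ, hκ, ← Module.End.mul_apply, ← Module.End.mul_apply, ← map_mul, ← map_mul,
          hrel.1])
  have hκe : ∀ i j x, κ i (e j x) = q ^ ((d i : ℤ) * a i j) • e j (κ i x) := fun i j =>
    mo_ext_cδ φ hφinj hfrac_r (κ j) (κ i) (hcomm j i) (e j) (heL j) _ (fun x => by
      rw [he, hκ, hκ, he, mo_hκe C hrel L, map_smul])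
  have hκg : ∀ i j x, κ i (g j x) = q ^ (-((d i : ℤ) * a i j)) • g j (κ i x) := fun i j =>
    mo_ext_cδ φ hφinj hfrac_r (κ j) (κ i) (hcomm j i) (g j) (hgL j) _ (fun x => by
      rw [hg, hκ, hκ, hg, map_mul, Module.End.mul_apply, Module.End.mul_apply,
        ← Module.End.mul_apply, ← map_mul, hrel.1, map_mul, Module.End.mul_apply,
        mo_hκf C hrel L, map_smul, map_smul])
  have hF : ∀ j x, (κ j).symm (g j (φ x)) = φ (L (F j) x) := by
    intro j x
    rw [hg, hκ', map_mul, Module.End.mul_apply, hLKK']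
  have hef : ∀ i j z, e i ((κ j).symm (g j z)) - (κ j).symm (g j (e i z))
      = if i = j then (q ^ (d i : ℤ) - q ^ (-(d i : ℤ)))⁻¹ • (κ i z - (κ i).symm z) else 0 := by
    intro i j z
    have h1 := mo_ext_hef φ hφinj hfrac_r (κ i) (κ j) (e i) (g j) (heL i) (hgL j)
      (q ^ ((d j : ℤ) * a j i)) (if i = j then (q ^ (d i : ℤ) - q ^ (-(d i : ℤ)))⁻¹ else 0)
      (hcomm i j) (zpow_ne_zero _ hq0) (hκe j i) (fun x => by
        rw [hκg, ha_symm i j, zpow_neg]) (by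
        by_cases hij : i = j
        · right; rw [hij]
        · left; rw [if_neg hij]) (fun x => by
        rw [hF, he, he, hF, hκ, hκ', ← map_sub, ← map_sub, ← map_smul, mo_hef C hrel L]
        split_ifs <;> simp) z
    rw [h1]
    split_ifs <;> simp
  intro R' hAR ⟨x₁, x₂, h₁, h₂, hab⟩
  have hmem : ∀ x, x ∈ φ.toRingHom.range ↔ ∃ y, φ y = x := fun x => Iff.rfl
  have hgenA : ∀ (B : Subring D), (∀ r : ℂ, algebraMap ℂ D r ∈ B) → (∀ c ξ v, φ (cf c ξ v) ∈ B) →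
      ∀ x ∈ φ.toRingHom.range, x ∈ B := by
    rintro B hB1 hB2 _ ⟨y, rfl⟩
    have hy : y ∈ Algebra.adjoin ℂ {x : A | ∃ c ξ v, x = cf c ξ v} := by rw [hAgen]; trivial
    change φ y ∈ B
    induction hy using Algebra.adjoin_induction with
    | mem x hx => obtain ⟨c, ξ, v, rfl⟩ := hx; exact hB2 c ξ v
    | algebraMap r => simpa using hB1 r
    | add x y _ _ hx hy => rw [map_add]; exact B.add_mem hx hy
    | mul x y _ _ hx hy => rw [map_mul]; exact B.mul_mem hx hy
  have hpow : ∀ (δ : D →ₗ[ℂ] D) (u : U) (_ : ∀ x, δ (φ x) = φ (L u x)) (N : ℕ) c ξ v,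
      (δ ^ N) (φ (cf c ξ v)) = φ (cf c ξ ((ρ c u ^ N) v)) := by
    intro δ u hδ N c ξ v
    induction N with
    | zero => simp
    | succ N ih => rw [pow_succ', Module.End.mul_apply, ih, hδ, hLcf, pow_succ', Module.End.mul_apply]
  have hnil : ∀ i (δ : D →ₗ[ℂ] D) (u : U) (_ : ∀ x, δ (φ x) = φ (L u x))
      (hδ : ∀ x y, δ (x * y) = δ x * y + κ i x * δ y) (s : ℂ)
      (hκδ : ∀ x, δ (κ i x) = s • κ i (δ x))
      (_ : ∀ c v, ∃ N : ℕ, (ρ c u ^ N) v = 0), ∀ x ∈ φ.toRingHom.range, ∃ m, (δ ^ m) x = 0 := by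
    intro i δ u hu hδ s hκδ hN
    refine hgenA (moNil (κ i) δ s hδ hκδ) (fun r => ⟨1, ?_⟩) (fun c ξ v => ?_)
    · have : δ 1 = 0 := by have := hδ 1 1; simpa using this
      rw [pow_one, Algebra.algebraMap_eq_smul_one, map_smul, this, smul_zero]
    · obtain ⟨N, h⟩ := hN c v
      exact ⟨N, by rw [hpow δ u hu, h, hcf0, map_zero]⟩
  have hinv : ∀ (i : Fin n) (δ : D →ₗ[ℂ] D) (m : ℤ), (∀ x, κ i (δ x) = q ^ m • δ (κ i x)) →
      ∀ x, δ (κ i x) = q ^ (-m) • κ i (δ x) := by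
    intro i δ m h x
    rw [h, smul_smul, ← zpow_add₀ hq0]; simp
  have hAgr : ∀ i, φ.toRingHom.range ≤
      moGr (κ i) (q ^ (d i : ℤ)) (zpow_ne_zero _ hq0) φ.toRingHom.range := by
    intro i
    refine hgenA _ (fun r => mo_gr_mem_of_wt (l := 0) _ ⟨algebraMap ℂ A r, by simp⟩ (by simp)) ?_
    intro c ξ v
    have hv : v ∈ ⨆ μ : Fin n → ℤ, wtSp q d K (ρ c) μ := by rw [hwtsum]; trivial
    induction hv using Submodule.iSup_induction' with
    | mem ν x hx =>
      refine mo_gr_mem_of_wt (l := ν i) _ ⟨cf c ξ x, rfl⟩ ?_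
      have hx' : ρ c (K i : U) x = _ := (mem_moW.1 hx) i
      rw [hκ, hLcf, hx', hcfs, map_smul, ← zpow_mul, mul_comm]
    | zero => rw [hcf0, map_zero]; exact Subring.zero_mem _
    | add x y _ _ hx hy => rw [hcfa, map_add]; exact Subring.add_mem _ hx hy
  have hcfne : ∀ c (v : V c), v ≠ 0 → ∃ ξ, φ (cf c ξ v) ≠ 0 := by
    intro c v hv
    obtain ⟨ξ, hξ⟩ : ∃ ξ : Module.Dual ℂ (V c), ξ v ≠ 0 := by
      by_contra hcon
      push Not at hcon
      exact hv ((Module.forall_dual_apply_eq_zero_iff ℂ v).1 hcon)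
    refine ⟨ξ, fun h => hξ ?_⟩
    have h2 : cf c ξ v = 0 := hφinj (by rw [h, map_zero])
    have h3 := hcf c ξ v 1
    rw [h2] at h3
    simpa using h3.symm
  obtain ⟨v, hv0, hvw, hve⟩ := hhw (fun _ => 1)
  have hvw : v ∈ wtSp q d K (ρ (fun _ => 1)) (fun _ => 1) := by simpa using hvw
  let P : MoAct q d D (Fin n ⊕ Fin n) φ.toRingHom.range :=
    { κ := κ
      δ := Sum.elim e g
      π := Sum.elim id id
      c := fun i => Sum.elim (a i) (fun j => - a i j)
      q0 := hq0
      qr := hqr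
      dp := hd_pos
      comm := hcomm
      leib := by rintro (i | i); exacts [heL i, hgL i]
      cδ := by
        rintro i (j | j) x
        · have := hκe i j x
          rw [zpow_mul] at this
          exact this
        · have := hκg i j x
          rw [← mul_neg, zpow_mul] at this
          exact this
      cne := by rintro (i | i) <;> simp [ha_diag]
      Aκ := by rintro i _ ⟨y, rfl⟩; exact ⟨_, (hκ i y).symm⟩
      Aκ' := by rintro i _ ⟨y, rfl⟩; exact ⟨_, (hκ' i y).symm⟩
      Aδ := by
        rintro (i | i) _ ⟨y, rfl⟩
        · exact ⟨_, (he i y).symm⟩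
        · exact ⟨_, (hg i y).symm⟩
      Anil := by
        rintro (i | i)
        · exact hnil i (e i) (E i) (he i) (heL i) _ (hinv i (e i) _ (hκe i i)) (fun c v => by
            have := hfd c
            exact (mo_rep_nil C hrel (ρ c) (hwtsum c) i v).1)
        · exact hnil i (g i) ((K i : U) * F i) (hg i) (hgL i) _ (hinv i (g i) _ (hκg i i))
            (fun c v => by
              have := hfd c
              exact (mo_rep_nil C hrel (ρ c) (hwtsum c) i v).2)
      Ane := by
        have hne := mo_rep_ne C hrel (ρ (fun _ => 1)) v hv0 hvw hve
        rintro (i | i)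
        · obtain ⟨ξ, hξ⟩ := hcfne _ _ (hne i).1
          refine ⟨_, ⟨cf _ ξ (ρ _ (F i) v), rfl⟩, ?_⟩
          change e i (φ _) ≠ 0
          rwa [he, hLcf]
        · obtain ⟨ξ, hξ⟩ := hcfne _ _ (hne i).2
          refine ⟨_, ⟨cf _ ξ v, rfl⟩, ?_⟩
          change g i (φ _) ≠ 0
          rwa [hg, hLcf]
      Agr := hAgr
      fl := fun x => by
        obtain ⟨y, z, hz, rfl⟩ := hfrac_l x
        exact ⟨_, ⟨y, rfl⟩, _, ⟨z, rfl⟩, fun h => hz (hφinj (h.trans (map_zero φ).symm)), rfl⟩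
      fr := fun x => by
        obtain ⟨y, z, hz, rfl⟩ := hfrac_r x
        exact ⟨_, ⟨y, rfl⟩, _, ⟨z, rfl⟩, fun h => hz (hφinj (h.trans (map_zero φ).symm)), rfl⟩ }
  refine le_antisymm (fun x hx => ?_) hAR
  refine P.final C H Sum.inl Sum.inr (fun _ _ => rfl) (fun _ _ => rfl) ?_ hef ?_ ?_ ?_ R' hAR x₁ x₂
    h₁ h₂ hab x hx
  · rintro (i | i)
    · exact Or.inl ⟨i, rfl⟩
    · exact Or.inr ⟨i, rfl⟩
  · rintro r _ ⟨y, rfl⟩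
    exact ⟨r • y, map_smul φ r y⟩
  · intro S hS
    obtain ⟨y, hy, h⟩ := mo_common φ.toRingHom hφinj hfrac_r hS.toFinset
    refine ⟨φ y, ⟨y, rfl⟩, fun h => hy (hφinj (h.trans (map_zero φ).symm)), fun x hx => ?_⟩
    obtain ⟨z, hz⟩ := h x (by simpa using hx)
    exact ⟨z, hz.symm⟩
  · intro J hJA hJ0 hJr hJκ hJκ' hJδ
    have := hJ (J.comap φ.toLinearMap) (by
      obtain ⟨x, hx, hx0⟩ := hJ0
      obtain ⟨y, rfl⟩ := hJA x hx
      exact ⟨y, hx, fun h => hx0 (by rw [h]; exact map_zero φ)⟩) (by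
      intro f hf g
      change φ (f * g) ∈ J
      rw [map_mul]
      exact hJr _ hf _ ⟨g, rfl⟩) (by
      refine mo_stable hgen L _ ?_ ?_ ?_ ?_
      · intro i f hf
        change φ _ ∈ J
        rw [← he]
        exact hJδ (Sum.inl i) _ hf
      · intro i f hf
        change φ _ ∈ J
        rw [← hF]
        exact hJκ' i _ (hJδ (Sum.inr i) _ hf)
      · intro i f hf
        change φ _ ∈ J
        rw [← hκ]
        exact hJκ i _ hf
      · intro i f hf
        change φ _ ∈ J
        rw [← hκ']
        exact hJκ' i _ hf)
    have h2 : φ 1 ∈ J := this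
    rwa [map_one] at h2
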